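/- Let M be a closed subspace of D(μ) invariant under multiplication by z. Then there exists a multiplier φ of D(μ) (i.e. φ is holomorphic on 𝔻 with φ·g ∈ D(μ) for every g ∈ D(μ)) such that M = [φ]_{D(μ)}. -/

import Mathlib

open MeasureTheory Metric Filter Complex Set
open scoped ENNReal Topology

noncomputable section

namespace DirichletMu

/-- The open unit disc in `ℂ`. -/
def disc : Set ℂ := Metric.ball 0 1

/-- The unit circle `𝕋`. -/
def circleT : Set ℂ := Metric.sphere 0 1

/-- The boundary point `e^{it}`. -/
def bpt (t : ℝ) : ℂ := Complex.exp (Complex.I * (t : ℂ))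

/-- Arc-length parametrizing measure on `(0, 2π]`. -/
def θm : Measure ℝ := volume.restrict (Set.Ioc 0 (2 * Real.pi))

/-- A measure is carried by the unit circle. -/
def OnCircle (μ : Measure ℂ) : Prop := μ circleTᶜ = 0

/-- The mean-square integrals of `f` over circles of radius `r < 1`. -/
def hardySet (f : ℂ → ℂ) : Set ℝ :=
  {x | ∃ r : ℝ, 0 < r ∧ r < 1 ∧
    x = (1 / (2 * Real.pi)) * ∫ t in (0:ℝ)..(2 * Real.pi), ‖f ((r : ℂ) * bpt t)‖ ^ 2}

/-- Membership in the Hardy space `H²`. -/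
def MemHardy2 (f : ℂ → ℂ) : Prop :=
  DifferentiableOn ℂ f disc ∧ BddAbove (hardySet f)

/-- The squared Hardy norm. -/
def hardyNormSq (f : ℂ → ℂ) : ℝ := sSup (hardySet f)

/-- Membership in `H^∞`. -/
def MemHinf (f : ℂ → ℂ) : Prop :=
  DifferentiableOn ℂ f disc ∧ ∃ C : ℝ, ∀ z ∈ disc, ‖f z‖ ≤ C

/-- The sup norm over the disc. -/
def supNorm (f : ℂ → ℂ) : ℝ := sSup ((fun z => ‖f z‖) '' disc)

/-- The Poisson integral of the measure `μ`. -/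
def poissonMu (μ : Measure ℂ) (z : ℂ) : ℝ :=
  ∫ ζ, (1 - ‖z‖ ^ 2) / ‖1 - (starRingEnd ℂ) ζ * z‖ ^ 2 ∂μ

/-- The integrand of the Dirichlet integral. -/
def dirichletDensity (μ : Measure ℂ) (f : ℂ → ℂ) (z : ℂ) : ℝ :=
  ‖deriv f z‖ ^ 2 * poissonMu μ z

/-- The Dirichlet integral `D_μ(f)`. -/
def dirichletIntegral (μ : Measure ℂ) (f : ℂ → ℂ) : ℝ :=
  (1 / Real.pi) * ∫ z in disc, dirichletDensity μ f z

/-- Membership in the Dirichlet-type space `D(μ)`. -/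
def MemD (μ : Measure ℂ) (f : ℂ → ℂ) : Prop :=
  MemHardy2 f ∧ IntegrableOn (dirichletDensity μ f) disc

/-- The squared norm `‖f‖_μ²` of `D(μ)`. -/
def dNormSq (μ : Measure ℂ) (f : ℂ → ℂ) : ℝ :=
  hardyNormSq f + dirichletIntegral μ f

/-- `f` has radial limit `L` at `ζ`. -/
def HasRadialLimitAt (f : ℂ → ℂ) (ζ L : ℂ) : Prop :=
  Tendsto (fun r : ℝ => f ((r : ℂ) * ζ)) (nhdsWithin 1 (Set.Iio 1)) (nhds L)

/-- The modulus of `f` has radial limit `m` at `e^{it}`. -/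
def BoundaryAbs (f : ℂ → ℂ) (t : ℝ) (m : ℝ) : Prop :=
  Tendsto (fun r : ℝ => ‖f ((r : ℂ) * bpt t)‖) (nhdsWithin 1 (Set.Iio 1)) (nhds m)

/-- The boundary zero set `Z_𝕋(f)`. -/
def ZT (f : ℂ → ℂ) : Set ℂ :=
  {ζ | ζ ∈ circleT ∧ HasRadialLimitAt f ζ 0}

/-- The set `Z̲(f)`. -/
def Zlow (f : ℂ → ℂ) : Set ℂ :=
  {ζ | ζ ∈ Metric.closedBall (0 : ℂ) 1 ∧
    Filter.liminf (fun z => ‖f z‖) (nhdsWithin ζ disc) = 0}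

def ZlowSet (S : Set (ℂ → ℂ)) : Set ℂ := ⋂ f ∈ S, Zlow f

def ZTSet (S : Set (ℂ → ℂ)) : Set ℂ := ⋂ f ∈ S, ZT f

/-- `[f]_{D(μ)}`: the closure in `D(μ)` of the polynomial multiples of `f`. -/
def closedSpan (μ : Measure ℂ) (f : ℂ → ℂ) : Set (ℂ → ℂ) :=
  {g | MemD μ g ∧ ∀ ε > 0, ∃ q : Polynomial ℂ,
    dNormSq μ (fun z => g z - q.eval z * f z) < ε}

/-- `f` is cyclic for `D(μ)`. -/
def IsCyclic (μ : Measure ℂ) (f : ℂ → ℂ) : Prop :=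
  closedSpan μ f = {g | MemD μ g}

/-- `f` is the outer function with boundary modulus `φ` (parametrized by `e^{it}`). -/
def OuterWith (f : ℂ → ℂ) (φ : ℝ → ℝ) : Prop :=
  (∀ t, 0 ≤ φ t) ∧
  IntervalIntegrable (fun t => Real.log (φ t)) volume 0 (2 * Real.pi) ∧
  ∀ z ∈ disc, f z = Complex.exp (((2 * Real.pi : ℝ) : ℂ)⁻¹ *
    ∫ t in (0:ℝ)..(2 * Real.pi), ((bpt t + z) / (bpt t - z)) * (Real.log (φ t) : ℂ))

/-- `f` is an outer function. -/
def IsOuter (f : ℂ → ℂ) : Prop := ∃ φ, OuterWith f φ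

/-- Inner functions. -/
def IsInner (f : ℂ → ℂ) : Prop :=
  DifferentiableOn ℂ f disc ∧ (∀ z ∈ disc, ‖f z‖ ≤ 1) ∧
  ∀ᵐ t ∂θm, BoundaryAbs f t 1

/-- `f / Θ ∈ H²`. -/
def InnerDivides (Θ f : ℂ → ℂ) : Prop :=
  ∃ g, MemHardy2 g ∧ ∀ z ∈ disc, f z = Θ z * g z

/-- `Θ / Θ'` is bounded on the disc. -/
def DividesBdd (Θ' Θ : ℂ → ℂ) : Prop :=
  ∃ g, MemHinf g ∧ ∀ z ∈ disc, Θ z = Θ' z * g z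

/-- `Θ` is the greatest common inner divisor of the family `M`. -/
def IsGCDInner (M : Set (ℂ → ℂ)) (Θ : ℂ → ℂ) : Prop :=
  IsInner Θ ∧ (∀ f ∈ M, InnerDivides Θ f) ∧
  ∀ Θ', IsInner Θ' → (∀ f ∈ M, InnerDivides Θ' f) → DividesBdd Θ' Θ

/-- The set `Θ H²`. -/
def innerMulH2 (Θ : ℂ → ℂ) : Set (ℂ → ℂ) :=
  {h | ∃ g, MemHardy2 g ∧ ∀ z ∈ disc, h z = Θ z * g z}

/-- Poisson extension of a boundary function (parametrized by `e^{it}`). -/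
def poissonExt (u : ℝ → ℝ) (z : ℂ) : ℝ :=
  (1 / (2 * Real.pi)) * ∫ t in (0:ℝ)..(2 * Real.pi),
    ((1 - ‖z‖ ^ 2) / ‖bpt t - z‖ ^ 2) * u t

/-- `|∇ P[u]|² P_μ`. -/
def gradDensity (μ : Measure ℂ) (u : ℝ → ℝ) (z : ℂ) : ℝ :=
  ‖fderiv ℝ (poissonExt u) z‖ ^ 2 * poissonMu μ z

/-- Membership in the harmonic Dirichlet space `D^h(μ)`. -/
def MemDh (μ : Measure ℂ) (u : ℝ → ℝ) : Prop :=
  IntegrableOn (fun t => (u t) ^ 2) (Set.Ioc 0 (2 * Real.pi)) volume ∧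
  IntegrableOn (gradDensity μ u) disc

/-- The squared norm of `D^h(μ)`. -/
def dhNormSq (μ : Measure ℂ) (u : ℝ → ℝ) : ℝ :=
  (1 / (2 * Real.pi)) * (∫ t in Set.Ioc 0 (2 * Real.pi), (u t) ^ 2) +
  (1 / Real.pi) * ∫ z in disc, gradDensity μ u z

/-- Relatively open subsets of the circle. -/
def RelOpen (U : Set ℂ) : Prop := ∃ V : Set ℂ, IsOpen V ∧ U = V ∩ circleT

/-- Capacity of a relatively open subset of the circle. -/
def capOpen (μ : Measure ℂ) (U : Set ℂ) : ℝ≥0∞ :=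
  ⨅ (u : ℝ → ℝ) (_ : MemDh μ u ∧ (∀ t, 0 ≤ u t) ∧
      ∀ᵐ t ∂θm, bpt t ∈ U → 1 ≤ u t),
    ENNReal.ofReal (dhNormSq μ u)

/-- The capacity `c_μ` of an arbitrary subset of the circle. -/
def cap (μ : Measure ℂ) (F : Set ℂ) : ℝ≥0∞ :=
  ⨅ (U : Set ℂ) (_ : RelOpen U ∧ F ⊆ U), capOpen μ U

/-- The (closed) support of a measure on `ℂ`. -/
def msupport (μ : Measure ℂ) : Set ℂ :=
  {x | ∀ r > 0, 0 < μ (Metric.ball x r)}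

/-- `M_μ(E)`: functions of `D(μ)` whose radial limits vanish `c_μ`-q.e. on `E`. -/
def Mspace (μ : Measure ℂ) (E : Set ℂ) : Set (ℂ → ℂ) :=
  {g | MemD μ g ∧ ∃ N : Set ℂ, cap μ N = 0 ∧ ∀ ζ ∈ E \ N, HasRadialLimitAt g ζ 0}

/-- Closed shift-invariant subspaces of `D(μ)` (closedness for the `D(μ)` norm). -/
structure ClosedInvSubspace (μ : Measure ℂ) (M : Set (ℂ → ℂ)) : Prop where
  subset : M ⊆ {f | MemD μ f}
  zero_mem : (fun _ => (0 : ℂ)) ∈ M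
  add_mem : ∀ f ∈ M, ∀ g ∈ M, (fun z => f z + g z) ∈ M
  smul_mem : ∀ (c : ℂ), ∀ f ∈ M, (fun z => c * f z) ∈ M
  shift_mem : ∀ f ∈ M, (fun z => z * f z) ∈ M
  closed : ∀ g, MemD μ g →
    (∀ ε > 0, ∃ h ∈ M, dNormSq μ (fun z => g z - h z) < ε) → g ∈ M

/-- The norm `‖f‖_{∞,μ}` of the Banach algebra `D(μ) ∩ H^∞`. -/
def algNorm (μ : Measure ℂ) (f : ℂ → ℂ) : ℝ :=
  supNorm f + Real.sqrt (dirichletIntegral μ f)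

/-- Membership in the Banach algebra `D(μ) ∩ H^∞`. -/
def MemA (μ : Measure ℂ) (f : ℂ → ℂ) : Prop := MemD μ f ∧ MemHinf f

/-- Closed ideals of `D(μ) ∩ H^∞`. -/
structure ClosedIdeal (μ : Measure ℂ) (J : Set (ℂ → ℂ)) : Prop where
  subset : J ⊆ {f | MemA μ f}
  zero_mem : (fun _ => (0 : ℂ)) ∈ J
  add_mem : ∀ f ∈ J, ∀ g ∈ J, (fun z => f z + g z) ∈ J
  mul_mem : ∀ f, MemA μ f → ∀ g ∈ J, (fun z => f z * g z) ∈ J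
  closed : ∀ g, MemA μ g →
    (∀ ε > 0, ∃ h ∈ J, algNorm μ (fun z => g z - h z) < ε) → g ∈ J

/-- A multiplier of `D(μ)`. -/
def IsMultiplier (μ : Measure ℂ) (φ : ℂ → ℂ) : Prop :=
  DifferentiableOn ℂ φ disc ∧ ∀ g, MemD μ g → MemD μ (fun z => φ z * g z)

/-- Distance between two subsets of `ℂ`. -/
def setDist (A B : Set ℂ) : ℝ :=
  sInf ((fun p : ℂ × ℂ => dist p.1 p.2) '' (A ×ˢ B))

open scoped ComplexConjugate InnerProductSpace

section Kernels

variable {X : Type*}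

/-- Positive semidefinite kernels on an arbitrary set. -/
def PSD (K : X → X → ℂ) : Prop :=
  (∀ x y, K y x = conj (K x y)) ∧
    ∀ (s : Finset X) (c : X → ℂ), 0 ≤ (∑ i ∈ s, ∑ j ∈ s, conj (c i) * K i j * c j).re

theorem PSD.im_quad {K : X → X → ℂ} (h : ∀ x y, K y x = conj (K x y)) (s : Finset X) (c : X → ℂ) :
    (∑ i ∈ s, ∑ j ∈ s, conj (c i) * K i j * c j).im = 0 := by
  rw [← Complex.conj_eq_iff_im, map_sum]
  simp_rw [map_sum]
  rw [Finset.sum_comm]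
  refine Finset.sum_congr rfl fun i _ => Finset.sum_congr rfl fun j _ => ?_
  simp only [map_mul, conj_conj, ← h]
  ring

open scoped ComplexOrder in
theorem psd_iff_posSemidef {K : X → X → ℂ} : PSD K ↔ (Matrix.of K).PosSemidef := by
  classical
  constructor
  · rintro ⟨h1, h2⟩
    refine ⟨?_, fun x => ?_⟩
    · ext i j
      simp [Matrix.conjTranspose_apply, h1 i j]
    · rw [Complex.nonneg_iff]
      exact ⟨h2 x.support x, (PSD.im_quad h1 x.support x).symm⟩
  · rintro ⟨h1, h2⟩
    refine ⟨fun x y => (h1.apply y x).symm, fun s c => ?_⟩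
    have hs : ∀ i, (if i ∈ s then c i else 0) ≠ 0 → i ∈ s := fun i hi => by
      by_contra h; simp [h] at hi
    have := h2 (Finsupp.onFinset s (fun i => if i ∈ s then c i else 0) hs)
    rw [Finsupp.onFinset_sum _ (by simp)] at this
    have e : ∀ i, ((Finsupp.onFinset s (fun i => if i ∈ s then c i else 0) hs).sum
        fun j xj => star (if i ∈ s then c i else 0) * Matrix.of K i j * xj)
        = ∑ j ∈ s, star (if i ∈ s then c i else 0) * K i j * (if j ∈ s then c j else 0) := by
      intro i
      rw [Finsupp.onFinset_sum _ (by simp)]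
      rfl
    simp only [e] at this
    convert (Complex.nonneg_iff.1 this).1 using 2
    refine Finset.sum_congr rfl fun i hi => Finset.sum_congr rfl fun j hj => ?_
    simp [hi, hj]

theorem PSD.mul {K L : X → X → ℂ} (hK : PSD K) (hL : PSD L) : PSD (fun x y => K x y * L x y) := by
  rw [psd_iff_posSemidef] at *
  exact hK.hadamard hL

theorem PSD.add {K L : X → X → ℂ} (hK : PSD K) (hL : PSD L) : PSD (fun x y => K x y + L x y) := by
  refine ⟨fun x y => by simp only [hK.1 x y, hL.1 x y, map_add], fun s c => ?_⟩
  have := add_nonneg (hK.2 s c) (hL.2 s c)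
  rw [← Complex.add_re, ← Finset.sum_add_distrib] at this
  simp_rw [← Finset.sum_add_distrib] at this
  refine this.trans_eq (congrArg _ ?_)
  refine Finset.sum_congr rfl fun i _ => Finset.sum_congr rfl fun j _ => ?_
  ring

theorem PSD.rankOne (b : X → ℂ) : PSD (fun x y => b x * conj (b y)) := by
  refine ⟨fun x y => by simp [mul_comm], fun s c => ?_⟩
  have : ∑ i ∈ s, ∑ j ∈ s, conj (c i) * (b i * conj (b j)) * c j
      = ((‖∑ i ∈ s, conj (c i) * b i‖ ^ 2 : ℝ) : ℂ) := by
    rw [← Complex.normSq_eq_norm_sq, ← Complex.mul_conj, map_sum, Finset.sum_mul_sum]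
    refine Finset.sum_congr rfl fun i _ => Finset.sum_congr rfl fun j _ => ?_
    simp; ring
  rw [this, Complex.ofReal_re]
  positivity

theorem PSD.const {t : ℝ} (ht : 0 ≤ t) : PSD (fun _ _ : X => (t : ℂ)) := by
  convert PSD.rankOne (fun _ : X => ((√t : ℝ) : ℂ)) using 3
  rw [Complex.conj_ofReal, ← Complex.ofReal_mul, Real.mul_self_sqrt ht]

theorem PSD.smul {K : X → X → ℂ} (hK : PSD K) {t : ℝ} (ht : 0 ≤ t) :
    PSD (fun x y => (t : ℂ) * K x y) := (PSD.const ht).mul hK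

theorem PSD.zero : PSD (fun _ _ : X => (0 : ℂ)) := by
  simpa using PSD.const (X := X) le_rfl

theorem PSD.sum {ι : Type*} (s : Finset ι) {K : ι → X → X → ℂ} (hK : ∀ i ∈ s, PSD (K i)) :
    PSD (fun x y => ∑ i ∈ s, K i x y) := by
  classical
  induction s using Finset.induction_on with
  | empty => simpa using PSD.zero
  | insert a s ha ih =>
    simp_rw [Finset.sum_insert ha]
    exact (hK a (by simp)).add (ih fun i hi => hK i (by simp [hi]))

theorem PSD.pow {K : X → X → ℂ} (hK : PSD K) (n : ℕ) : PSD (fun x y => K x y ^ n) := by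
  induction n with
  | zero => simpa using PSD.const (X := X) zero_le_one
  | succ n ih => simp_rw [pow_succ]; exact ih.mul hK

theorem PSD.of_tendsto {ι : Type*} {l : Filter ι} [l.NeBot] {K : ι → X → X → ℂ} {L : X → X → ℂ}
    (hK : ∀ i, PSD (K i)) (h : ∀ x y, Tendsto (fun i => K i x y) l (𝓝 (L x y))) : PSD L := by
  refine ⟨fun x y => ?_, fun s c => ?_⟩
  · refine tendsto_nhds_unique (h y x) ?_
    simp_rw [fun i => (hK i).1 x y]
    exact (Complex.continuous_conj.tendsto _).comp (h x y)
  · have : Tendsto (fun n => (∑ i ∈ s, ∑ j ∈ s, conj (c i) * K n i j * c j).re) l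
        (𝓝 (∑ i ∈ s, ∑ j ∈ s, conj (c i) * L i j * c j).re) := by
      refine (Complex.continuous_re.tendsto _).comp ?_
      refine tendsto_finsetSum _ fun i _ => tendsto_finsetSum _ fun j _ => ?_
      exact ((h i j).const_mul _).mul_const _
    exact ge_of_tendsto' this fun n => (hK n).2 s c

theorem PSD.conj_mul {K : X → X → ℂ} (hK : PSD K) (b : X → ℂ) :
    PSD (fun x y => b x * K x y * conj (b y)) := by
  convert (PSD.rankOne b).mul hK using 3
  ring

theorem PSD.diag_eq {K : X → X → ℂ} (hK : PSD K) (x : X) : K x x = ((K x x).re : ℂ) := by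
  have := hK.1 x x
  exact (Complex.conj_eq_iff_re.1 this.symm).symm

theorem PSD.diag_nonneg {K : X → X → ℂ} (hK : PSD K) (x : X) : 0 ≤ (K x x).re := by
  simpa using hK.2 {x} 1

theorem PSD.quad_insert {K : X → X → ℂ} (hK : PSD K) (w : X) (s : Finset X) (c : X → ℂ) (t : ℂ) :
    0 ≤ (∑ i ∈ s, ∑ j ∈ s, conj (c i) * K i j * c j).re
      + 2 * (conj t * ∑ j ∈ s, K w j * c j).re + ‖t‖ ^ 2 * (K w w).re := by
  classical
  have h := hK.2 (insert w s) (fun i => (if i ∈ s then c i else 0) + t * (if i = w then 1 else 0))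
  have e1 : ∀ g : X → ℂ, ∑ j ∈ insert w s, g j * ((if j ∈ s then c j else 0)
      + t * (if j = w then 1 else 0)) = (∑ j ∈ s, g j * c j) + g w * t := by
    intro g
    simp_rw [mul_add, Finset.sum_add_distrib]
    congr 1
    · have : ∀ x, g x * (if x ∈ s then c x else 0) = if x ∈ s then g x * c x else 0 := by
        intro x; split_ifs <;> simp
      simp_rw [this]
      rw [← Finset.sum_filter]
      congr 1
      ext x; simp
    · rw [Finset.sum_eq_single w]
      · simp
      · intro b _ hb; simp [hb]
      · simp
  simp_rw [e1] at h
  have e2 : ∀ g : X → ℂ, ∑ j ∈ insert w s, conj ((if j ∈ s then c j else 0)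
      + t * (if j = w then 1 else 0)) * g j = (∑ j ∈ s, conj (c j) * g j) + conj t * g w := by
    intro g
    have := congrArg conj (e1 (fun j => conj (g j)))
    simp only [map_sum, map_mul, map_add, conj_conj] at this
    rw [mul_comm (conj t)]
    convert this using 1
    · refine Finset.sum_congr rfl fun j _ => ?_
      rw [mul_comm, map_add, map_mul]
    · congr 1
      exact Finset.sum_congr rfl fun j _ => mul_comm _ _
  have e3 : ∑ x ∈ insert w s, (∑ x_1 ∈ s, conj ((if x ∈ s then c x else 0)
      + t * if x = w then 1 else 0) * K x x_1 * c x_1 + conj ((if x ∈ s then c x else 0)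
      + t * if x = w then 1 else 0) * K x w * t)
      = (∑ i ∈ s, ∑ j ∈ s, conj (c i) * K i j * c j) + conj t * ∑ j ∈ s, K w j * c j
        + t * (∑ j ∈ s, conj (c j) * K j w) + (conj t * t) * K w w := by
    have : ∀ x, (∑ x_1 ∈ s, conj ((if x ∈ s then c x else 0)
      + t * if x = w then 1 else 0) * K x x_1 * c x_1 + conj ((if x ∈ s then c x else 0)
      + t * if x = w then 1 else 0) * K x w * t) = conj ((if x ∈ s then c x else 0)
      + t * if x = w then 1 else 0) * (∑ j ∈ s, K x j * c j + K x w * t) := by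
      intro x
      rw [mul_add, Finset.mul_sum]
      simp only [mul_assoc]
    simp_rw [this]
    rw [e2]
    simp_rw [mul_add, Finset.sum_add_distrib, Finset.mul_sum]
    simp only [mul_assoc, mul_comm, mul_left_comm]
    ring
  rw [e3] at h
  have e4 : t * (∑ j ∈ s, conj (c j) * K j w) = conj (conj t * ∑ j ∈ s, K w j * c j) := by
    simp only [map_mul, map_sum, conj_conj]
    congr 1
    refine Finset.sum_congr rfl fun j _ => ?_
    rw [hK.1 w j, mul_comm]
  rw [e4, hK.diag_eq w, ← Complex.normSq_eq_conj_mul_self, Complex.normSq_eq_norm_sq] at h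
  simp only [Complex.add_re, Complex.conj_re, Complex.re_ofReal_mul, Complex.ofReal_re] at h
  linarith

theorem PSD.sub_rankOne {K : X → X → ℂ} (hK : PSD K) {w : X} (hw : 0 < (K w w).re) :
    PSD (fun x y => K x y - K x w * K w y / K w w) := by
  refine ⟨fun x y => ?_, fun s c => ?_⟩
  · simp only [map_sub, map_div₀, map_mul, ← hK.1]
    ring
  · have h := hK.quad_insert w s c (-(∑ j ∈ s, K w j * c j) / (K w w).re)
    set S := ∑ j ∈ s, K w j * c j with hS
    have e : ∑ i ∈ s, ∑ j ∈ s, conj (c i) * (K i j - K i w * K w j / K w w) * c j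
        = (∑ i ∈ s, ∑ j ∈ s, conj (c i) * K i j * c j) - ((‖S‖ ^ 2 / (K w w).re : ℝ) : ℂ) := by
      have : ((‖S‖ ^ 2 / (K w w).re : ℝ) : ℂ) = conj S * S / K w w := by
        rw [← Complex.normSq_eq_conj_mul_self, Complex.normSq_eq_norm_sq, hK.diag_eq w]
        push_cast; simp
      rw [this, hS, map_sum, Finset.sum_mul_sum, Finset.sum_div, ← Finset.sum_sub_distrib]
      refine Finset.sum_congr rfl fun i _ => ?_
      rw [Finset.sum_div, ← Finset.sum_sub_distrib]
      refine Finset.sum_congr rfl fun j _ => ?_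
      rw [map_mul, ← hK.1]
      ring
    rw [e, Complex.sub_re, Complex.ofReal_re]
    have e2 : (conj (-S / ((K w w).re : ℂ)) * S).re = - (‖S‖ ^ 2 / (K w w).re) := by
      have : conj (-S / ((K w w).re : ℂ)) * S = ((-(‖S‖ ^ 2 / (K w w).re) : ℝ) : ℂ) := by
        rw [map_div₀, map_neg, Complex.conj_ofReal, div_mul_eq_mul_div, neg_mul,
          ← Complex.normSq_eq_conj_mul_self, Complex.normSq_eq_norm_sq]
        push_cast; ring
      rw [this, Complex.ofReal_re]
    rw [e2, norm_div, norm_neg, Complex.norm_real, Real.norm_of_nonneg hw.le] at h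
    have e3 : (‖S‖ / (K w w).re) ^ 2 * (K w w).re = ‖S‖ ^ 2 / (K w w).re := by
      field_simp
    rw [e3] at h
    linarith

theorem PSD.normSq_le {K : X → X → ℂ} (hK : PSD K) (x w : X) :
    ‖K x w‖ ^ 2 ≤ (K x x).re * (K w w).re := by
  rcases (hK.diag_nonneg w).lt_or_eq with hw | hw
  · have := (hK.sub_rankOne hw).diag_nonneg x
    have e : K x w * K w x / K w w = ((‖K x w‖ ^ 2 / (K w w).re : ℝ) : ℂ) := by
      rw [hK.1 x w, Complex.mul_conj, Complex.normSq_eq_norm_sq, hK.diag_eq w]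
      push_cast; simp
    rw [e, Complex.sub_re, Complex.ofReal_re, sub_nonneg, div_le_iff₀ hw] at this
    exact this
  · rw [← hw, mul_zero]
    by_contra! hne
    have key := hK.quad_insert w {x} 1
      (-(((K x x).re + 1) / ‖K x w‖ ^ 2 : ℝ) * conj (K x w))
    rw [← hw] at key
    have e : (conj (-((((K x x).re + 1) / ‖K x w‖ ^ 2 : ℝ) : ℂ) * conj (K x w)) *
        ∑ j ∈ {x}, K w j * (1 : X → ℂ) j).re = -((K x x).re + 1) := by
      have : conj (-((((K x x).re + 1) / ‖K x w‖ ^ 2 : ℝ) : ℂ) * conj (K x w)) *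
        ∑ j ∈ {x}, K w j * (1 : X → ℂ) j = ((-((K x x).re + 1) : ℝ) : ℂ) := by
        simp only [Finset.sum_singleton, map_mul, map_neg, Complex.conj_ofReal, conj_conj,
          Pi.one_apply, mul_one]
        rw [mul_assoc, hK.1 x w, Complex.mul_conj, Complex.normSq_eq_norm_sq]
        rw [← Complex.ofReal_neg, ← Complex.ofReal_mul]
        congr 1
        rw [neg_mul, div_mul_cancel₀ _ hne.ne']
      rw [this, Complex.ofReal_re]
    rw [e] at key
    simp at key
    linarith [hK.diag_nonneg x]

theorem PSD.eq_zero_of_diag {K : X → X → ℂ} (hK : PSD K) {w : X} (hw : (K w w).re = 0) (x : X) :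
    K x w = 0 := by
  have := hK.normSq_le x w
  rw [hw, mul_zero] at this
  simpa using le_antisymm this (by positivity)

end Kernels

section CompletePick

variable {X : Type*}

/-- A kernel of the form `h(x) conj(h(y)) / (1 - P(x, y))` with `P` positive semidefinite. -/
def CNP (k : X → X → ℂ) : Prop :=
  ∃ (h : X → ℂ) (P : X → X → ℂ), PSD P ∧ (∀ x, h x ≠ 0) ∧
    ∀ x y, k x y * (1 - P x y) = h x * conj (h y)

theorem CNP.ne_zero {k : X → X → ℂ} (h : CNP k) (x y : X) : k x y ≠ 0 := by
  obtain ⟨b, P, -, hb, e⟩ := h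
  intro h0
  have := e x y
  rw [h0, zero_mul] at this
  exact mul_ne_zero (hb x) ((map_ne_zero _).2 (hb y)) this.symm

theorem CNP.diag_pos {k : X → X → ℂ} (hk : PSD k) (h : CNP k) (x : X) : 0 < (k x x).re := by
  refine lt_of_le_of_ne (hk.diag_nonneg x) fun h0 => h.ne_zero x x ?_
  rw [hk.diag_eq, ← h0, Complex.ofReal_zero]

theorem CNP.basePoint {k : X → X → ℂ} (hk : PSD k) (h : CNP k) (w : X) :
    PSD (fun x y => 1 - k x w * k w y / (k w w * k x y)) := by
  have hne := h.ne_zero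
  have hpos := h.diag_pos hk w
  obtain ⟨b, P, hP, hb, e⟩ := h
  have hbc : ∀ x, conj (b x) ≠ 0 := fun x => (map_ne_zero _).2 (hb x)
  have hP1 : ∀ x y, 1 - P x y ≠ 0 := fun x y h0 => by
    have := e x y
    rw [h0, mul_zero] at this
    exact mul_ne_zero (hb x) (hbc y) this.symm
  have hg1 : (P w w).re < 1 := by
    have := e w w
    rw [hk.diag_eq, hP.diag_eq, Complex.mul_conj, Complex.normSq_eq_norm_sq] at this
    have h2 : (k w w).re * (1 - (P w w).re) = ‖b w‖ ^ 2 := by exact_mod_cast this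
    have h3 : 0 < ‖b w‖ ^ 2 := by have := norm_pos_iff.2 (hb w); positivity
    rw [← h2] at h3
    linarith [(pos_iff_pos_of_mul_pos h3).1 hpos]
  have hkeq : ∀ x y, k x y = b x * conj (b y) / (1 - P x y) := fun x y => by
    rw [eq_div_iff (hP1 x y), e]
  have hnum : PSD (fun x y => (1 - P w w) * P x y + P w w - P x w - P w y + P x w * P w y) := by
    rcases (hP.diag_nonneg w).lt_or_eq with hg | hg
    · have h1 := (hP.sub_rankOne hg).smul (sub_nonneg.2 hg1.le)
      have h2 := (PSD.rankOne (fun x => P w w - P x w)).smul (inv_nonneg.2 hg.le)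
      convert h1.add h2 using 3 with x y
      have hg0 : P w w ≠ 0 := by
        rw [hP.diag_eq]; exact_mod_cast hg.ne'
      push_cast
      rw [← hP.diag_eq, map_sub, ← hP.1, ← hP.1 y w]
      field_simp
      ring
    · have h0 := hP.eq_zero_of_diag hg.symm
      have h0' : ∀ y, P w y = 0 := fun y => by rw [hP.1 y w, h0, map_zero]
      convert hP using 3 with x y
      simp [h0, h0']
  convert hnum.conj_mul (fun x => (1 - P x w)⁻¹) using 3 with x y
  rw [hkeq, hkeq, hkeq, hkeq, map_inv₀, map_sub, map_one, ← hP.1]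
  have := hP1 x w
  have := hP1 w y
  have := hP1 w w
  have := hP1 x y
  have := hb x
  have := hb w
  have := hbc y
  have := hbc w
  field_simp
  ring

theorem PSD.geometric {F : X → X → ℂ} (hF : PSD F) (hF1 : ∀ x y, ‖F x y‖ ≤ 1) {τ : ℝ}
    (hτ : 0 ≤ τ) : PSD (fun x y => 1 / (1 + τ - τ * F x y)) := by
  have hq0 : 0 ≤ τ / (1 + τ) := by positivity
  have hq1 : τ / (1 + τ) < 1 := by rw [div_lt_one (by positivity)]; linarith
  have hs : ∀ x y, HasSum (fun n : ℕ => (((1 / (1 + τ)) : ℝ) : ℂ) *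
      ((((τ / (1 + τ)) ^ n : ℝ) : ℂ) * F x y ^ n)) (1 / (1 + τ - τ * F x y)) := by
    intro x y
    have h1 : ‖((τ / (1 + τ) : ℝ) : ℂ) * F x y‖ < 1 := by
      rw [norm_mul, Complex.norm_real, Real.norm_of_nonneg hq0]
      calc _ ≤ τ / (1 + τ) * 1 := by gcongr; exact hF1 x y
        _ < 1 := by linarith
    have h2 := (hasSum_geometric_of_norm_lt_one h1).mul_left (((1 / (1 + τ)) : ℝ) : ℂ)
    have h3 : (1 : ℂ) - ((τ / (1 + τ) : ℝ) : ℂ) * F x y ≠ 0 := by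
      intro h0
      rw [sub_eq_zero] at h0
      rw [← h0] at h1
      simp at h1
    have hA : (fun n : ℕ => (((1 / (1 + τ)) : ℝ) : ℂ) *
      ((((τ / (1 + τ)) ^ n : ℝ) : ℂ) * F x y ^ n)) = fun n : ℕ => (((1 / (1 + τ)) : ℝ) : ℂ) *
        (((τ / (1 + τ) : ℝ) : ℂ) * F x y) ^ n := by
      ext n
      rw [mul_pow, Complex.ofReal_pow]
    rw [hA]
    have hB : 1 / (1 + τ - τ * F x y)
        = (((1 / (1 + τ)) : ℝ) : ℂ) * (1 - ((τ / (1 + τ) : ℝ) : ℂ) * F x y)⁻¹ := by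
      have h4 : (1 : ℂ) + τ ≠ 0 := by
        have : (1 + τ : ℝ) ≠ 0 := by positivity
        exact_mod_cast this
      push_cast at h3 ⊢
      have : (1 : ℂ) + τ - τ * F x y = (1 + τ) * (1 - τ / (1 + τ) * F x y) := by
        field_simp
      rw [this]
      field_simp
    rw [hB]
    exact h2
  refine PSD.of_tendsto (fun n : ℕ => ?_) (fun x y => (hs x y).tendsto_sum_nat)
  refine PSD.sum _ fun i _ => ((hF.pow i).smul ?_).smul ?_ <;> positivity

theorem CNP.update {k : X → X → ℂ} (hk : PSD k) (h : CNP k) (w : X) {t : ℝ} (ht : 0 ≤ t) :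
    CNP (fun x y => k x y + t * (k x w * k w y)) := by
  rcases ht.eq_or_lt with rfl | ht
  · simpa using h
  have hne := h.ne_zero
  have hpos := h.diag_pos hk
  have hF := h.basePoint hk w
  have hF1 : ∀ x, (1 - k x w * k w x / (k w w * k x x)).re ≤ 1 := fun x => by
    have : k x w * k w x / (k w w * k x x)
        = ((‖k x w‖ ^ 2 / ((k w w).re * (k x x).re) : ℝ) : ℂ) := by
      rw [hk.1 x w, Complex.mul_conj, Complex.normSq_eq_norm_sq, hk.diag_eq w, hk.diag_eq x]
      push_cast; simp
    rw [this, Complex.sub_re, Complex.ofReal_re, Complex.one_re, sub_le_self_iff]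
    have := hpos w
    have := hpos x
    positivity
  have hF2 : ∀ x y, ‖1 - k x w * k w y / (k w w * k x y)‖ ≤ 1 := fun x y => by
    have := hF.normSq_le x y
    rw [← sq_le_one_iff₀ (norm_nonneg _)]
    exact this.trans (mul_le_one₀ (hF1 x) (hF.diag_nonneg y) (hF1 y))
  have hτ : 0 ≤ t * (k w w).re := mul_nonneg ht.le (hpos w).le
  refine ⟨fun x => (√t : ℝ) * k x w, _, hF.geometric hF2 hτ, fun x =>
    mul_ne_zero (by exact_mod_cast (Real.sqrt_pos.2 ht).ne') (hne x w), fun x y => ?_⟩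
  have hw := hne w w
  have hxy := hne x y
  have e1 : (1 : ℂ) + (t * (k w w).re : ℝ)
      - (t * (k w w).re : ℝ) * (1 - k x w * k w y / (k w w * k x y))
      = (k x y + t * (k x w * k w y)) / k x y := by
    push_cast
    rw [← hk.diag_eq]
    field_simp
    ring
  rw [map_mul, Complex.conj_ofReal, ← hk.1]
  have e2 : (k x y + t * (k x w * k w y)) / k x y ≠ 0 := by
    intro h0
    rw [h0, sub_eq_zero] at e1
    have h1 := congrArg norm e1
    have h2 : ‖((t * (k w w).re : ℝ) : ℂ) * (1 - k x w * k w y / (k w w * k x y))‖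
        ≤ t * (k w w).re := by
      rw [norm_mul, Complex.norm_real, Real.norm_of_nonneg hτ]
      exact mul_le_of_le_one_right hτ (hF2 x y)
    rw [← h1] at h2
    have h3 : ((1 : ℂ) + (t * (k w w).re : ℝ)) = ((1 + t * (k w w).re : ℝ) : ℂ) := by push_cast; rfl
    rw [h3, Complex.norm_real, Real.norm_of_nonneg (by positivity)] at h2
    linarith
  have e3 : k x y + t * (k x w * k w y) ≠ 0 := fun h0 => e2 (by rw [h0, zero_div])
  have e4 : ((√t : ℝ) : ℂ) * (√t : ℝ) = t := by
    rw [← Complex.ofReal_mul, Real.mul_self_sqrt ht.le]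
  rw [e1]
  calc _ = t * (k x w * k w y) := by
        rw [one_div_div, mul_sub, mul_one, mul_div_cancel₀ _ e3]
        ring
    _ = _ := by rw [← e4]; ring

theorem CNP.normalized {k : X → X → ℂ} (hk : PSD k) (h : CNP k) {w : X} (hw : ∀ x, k x w = 1) :
    PSD (fun x y => 1 - 1 / k x y) := by
  have := h.basePoint hk w
  have hw' : ∀ x, k w x = 1 := fun x => by rw [hk.1 x w, hw, map_one]
  simpa [hw, hw'] using this

theorem psd_one_sub_inv_of_tendsto {ι : Type*} {l : Filter ι} [l.NeBot] {k : ι → X → X → ℂ}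
    {κ : X → X → ℂ} (hk : ∀ i, PSD (k i)) (h0 : ∀ i x, 0 < (k i x x).re)
    (h : ∀ i, PSD (fun x y => 1 - 1 / k i x y)) (hne : ∀ i x y, k i x y ≠ 0)
    (hlim : ∀ x y, Tendsto (fun i => k i x y) l (𝓝 (κ x y))) :
    (∀ x y, κ x y ≠ 0) ∧ PSD (fun x y => 1 - 1 / κ x y) := by
  have hd : ∀ i x, (1 - 1 / k i x x).re ≤ 1 := fun i x => by
    rw [(hk i).diag_eq x, Complex.sub_re, Complex.one_re, sub_le_self_iff,
      ← Complex.ofReal_one, ← Complex.ofReal_div, Complex.ofReal_re]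
    have := h0 i x
    positivity
  have hb : ∀ i x y, 1 / 2 ≤ ‖k i x y‖ := fun i x y => by
    have h1 : ‖1 - 1 / k i x y‖ ≤ 1 := by
      rw [← sq_le_one_iff₀ (norm_nonneg _)]
      exact ((h i).normSq_le x y).trans (mul_le_one₀ (hd i x) ((h i).diag_nonneg y) (hd i y))
    have h2 : ‖1 / k i x y‖ ≤ 2 := by
      calc ‖1 / k i x y‖ = ‖1 - (1 - 1 / k i x y)‖ := by congr 1; ring
        _ ≤ ‖(1 : ℂ)‖ + ‖1 - 1 / k i x y‖ := norm_sub_le _ _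
        _ ≤ 2 := by rw [norm_one]; linarith
    rw [norm_div, norm_one, div_le_iff₀ (norm_pos_iff.2 (hne i x y))] at h2
    linarith
  have hκ : ∀ x y, κ x y ≠ 0 := fun x y => by
    have ht := (hlim x y).norm
    have : 1 / 2 ≤ ‖κ x y‖ := ge_of_tendsto' ht (fun i => hb i x y)
    exact norm_pos_iff.1 (by linarith)
  refine ⟨hκ, PSD.of_tendsto (l := l) h fun x y => ?_⟩
  exact tendsto_const_nhds.sub (tendsto_const_nhds.div (hlim x y) (hκ x y))

end CompletePick

section AbstractMultipliers

variable {X : Type*} {H : Type*} [NormedAddCommGroup H] [InnerProductSpace ℂ H]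

theorem gram_quad (u : X → H) (s : Finset X) (c : X → ℂ) :
    ∑ i ∈ s, ∑ j ∈ s, conj (c i) * ⟪u i, u j⟫_ℂ * c j = ((‖∑ j ∈ s, c j • u j‖ ^ 2 : ℝ) : ℂ) := by
  rw [Complex.ofReal_pow]
  have h : ⟪∑ j ∈ s, c j • u j, ∑ j ∈ s, c j • u j⟫_ℂ = (‖∑ j ∈ s, c j • u j‖ : ℂ) ^ 2 :=
    inner_self_eq_norm_sq_to_K _
  rw [← h, sum_inner]
  refine Finset.sum_congr rfl fun i _ => ?_
  rw [inner_sum]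
  refine Finset.sum_congr rfl fun j _ => ?_
  rw [inner_smul_left, inner_smul_right]
  ring

theorem PSD.gram (u : X → H) : PSD (fun x y => ⟪u x, u y⟫_ℂ) :=
  ⟨fun x y => (inner_conj_symm _ _).symm, fun s c => by
    rw [gram_quad, Complex.ofReal_re]; positivity⟩

/-- `B` acts as multiplication by `b` with respect to the kernel vectors `k`. -/
def IsMul (k : X → H) (b : X → ℂ) (B : H →L[ℂ] H) : Prop :=
  ∀ f x, ⟪k x, B f⟫_ℂ = b x * ⟪k x, f⟫_ℂ

theorem inner_starProjection_eq [CompleteSpace H] (M : Submodule ℂ H) [M.HasOrthogonalProjection]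
    (u v : H) : ⟪M.starProjection u, M.starProjection v⟫_ℂ = ⟪u, M.starProjection v⟫_ℂ := by
  rw [M.inner_starProjection_left_eq_right, M.starProjection_eq_self_iff.2
    (M.starProjection_apply_mem v)]

variable [CompleteSpace H] {k : X → H}

theorem denseRange_linearCombination (hk : ∀ f, (∀ x, ⟪k x, f⟫_ℂ = 0) → f = 0) :
    DenseRange (Finsupp.linearCombination ℂ k) := by
  have h : (LinearMap.range (Finsupp.linearCombination ℂ k)).topologicalClosure = ⊤ := by
    rw [Submodule.topologicalClosure_eq_top_iff, Submodule.eq_bot_iff]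
    intro f hf
    refine hk f fun x => ?_
    rw [Submodule.mem_orthogonal] at hf
    exact hf (k x) ⟨Finsupp.single x 1, by simp⟩
  rw [DenseRange, ← LinearMap.coe_range]
  exact Submodule.dense_iff_topologicalClosure_eq_top.2 h

theorem IsMul.adjoint_apply {b : X → ℂ} {B : H →L[ℂ] H}
    (hB : IsMul k b B) (x : X) : B.adjoint (k x) = conj (b x) • k x := by
  refine ext_inner_right ℂ fun f => ?_
  rw [ContinuousLinearMap.adjoint_inner_left, hB, inner_smul_left, conj_conj]

theorem exists_isMul (hk : ∀ f, (∀ x, ⟪k x, f⟫_ℂ = 0) → f = 0) (M : Submodule ℂ H)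
    [M.HasOrthogonalProjection] (b : X → ℂ) {C : ℝ} (hC : 0 ≤ C)
    (h : PSD (fun x y => (C ^ 2 : ℝ) * ⟪k x, M.starProjection (k y)⟫_ℂ
      - b x * conj (b y) * ⟪k x, k y⟫_ℂ)) :
    ∃ B : H →L[ℂ] H, IsMul k b B ∧ (∀ f, ‖B f‖ ≤ C * ‖f‖) ∧ ∀ f, B f ∈ M := by
  set e := Finsupp.linearCombination ℂ k with he
  set g := Finsupp.linearCombination ℂ (fun x => conj (b x) • k x) with hg
  have hd := denseRange_linearCombination hk
  have hbound : ∀ c : X →₀ ℂ, ‖g c‖ ≤ C * ‖M.starProjection (e c)‖ := by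
    intro c
    have h1 := h.2 c.support c
    have h2 : ∑ i ∈ c.support, ∑ j ∈ c.support, conj (c i) *
        ((C ^ 2 : ℝ) * ⟪k i, M.starProjection (k j)⟫_ℂ - b i * conj (b j) * ⟪k i, k j⟫_ℂ) * c j
        = ((C ^ 2 * ‖M.starProjection (e c)‖ ^ 2 - ‖g c‖ ^ 2 : ℝ) : ℂ) := by
      have e1 : M.starProjection (e c) = ∑ j ∈ c.support, c j • M.starProjection (k j) := by
        simp [he, Finsupp.linearCombination_apply, Finsupp.sum, map_sum]
      have e2 : g c = ∑ j ∈ c.support, c j • (conj (b j) • k j) := by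
        simp [hg, Finsupp.linearCombination_apply, Finsupp.sum]
      rw [e1, e2, Complex.ofReal_sub, Complex.ofReal_mul, ← gram_quad, ← gram_quad,
        Finset.mul_sum, ← Finset.sum_sub_distrib]
      refine Finset.sum_congr rfl fun i _ => ?_
      rw [Finset.mul_sum, ← Finset.sum_sub_distrib]
      refine Finset.sum_congr rfl fun j _ => ?_
      rw [inner_starProjection_eq, inner_smul_left, inner_smul_right, conj_conj]
      ring
    rw [h2, Complex.ofReal_re, sub_nonneg, ← mul_pow] at h1
    exact le_of_sq_le_sq h1 (by positivity)
  have hbound' : ∀ c : X →₀ ℂ, ‖g c‖ ≤ C * ‖e c‖ := fun c =>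
    (hbound c).trans (mul_le_mul_of_nonneg_left (M.norm_starProjection_apply_le _) hC)
  set T := g.extendOfNorm e with hT
  have hTe : ∀ c, T (e c) = g c := LinearMap.extendOfNorm_eq hd ⟨C, hbound'⟩
  have hTb : ∀ f, ‖T f‖ ≤ C * ‖M.starProjection f‖ := by
    intro f
    refine hd.induction_on (p := fun f => ‖T f‖ ≤ C * ‖M.starProjection f‖) f
      (isClosed_le (by fun_prop) (by fun_prop)) fun c => ?_
    rw [hTe]
    exact hbound c
  have hTC : ‖T‖ ≤ C := T.opNorm_le_bound hC fun f =>
    (hTb f).trans (mul_le_mul_of_nonneg_left (M.norm_starProjection_apply_le _) hC)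
  refine ⟨T.adjoint, fun f x => ?_, fun f => ?_, fun f => ?_⟩
  · have : T (k x) = conj (b x) • k x := by
      have := hTe (Finsupp.single x 1)
      simpa [he, hg] using this
    rw [ContinuousLinearMap.adjoint_inner_right, this, inner_smul_left, conj_conj]
  · refine (T.adjoint.le_opNorm f).trans ?_
    rw [LinearIsometryEquiv.norm_map]
    gcongr
  · have h0 : ∀ y ∈ Mᗮ, ⟪y, T.adjoint f⟫_ℂ = 0 := by
      intro y hy
      have : T y = 0 := by
        have h1 := hTb y
        rw [(M.starProjection_apply_eq_zero_iff).2 hy, norm_zero, mul_zero] at h1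
        exact norm_le_zero_iff.1 h1
      rw [ContinuousLinearMap.adjoint_inner_right, this, inner_zero_left]
    rw [← M.orthogonal_orthogonal]
    exact (Submodule.mem_orthogonal _ _).2 h0

theorem PSD.peel {P : X → X → ℂ} (hP : PSD P) (Z : Finset X) :
    ∃ (n : ℕ) (b : ℕ → X → ℂ) (R : X → X → ℂ), PSD R ∧ (∀ z ∈ Z, ∀ x, R x z = 0) ∧
      ∀ x y, P x y = (∑ l ∈ Finset.range n, b l x * conj (b l y)) + R x y := by
  classical
  induction Z using Finset.induction_on with
  | empty => exact ⟨0, fun _ _ => 0, P, hP, by simp, by simp⟩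
  | insert w Z hw ih =>
    obtain ⟨n, b, R, hR, hRZ, hPR⟩ := ih
    rcases (hR.diag_nonneg w).lt_or_eq with hg | hg
    · refine ⟨n + 1, fun l => if l = n then fun x => R x w / (√(R w w).re : ℝ) else b l, _,
        hR.sub_rankOne hg, fun z hz x => ?_, fun x y => ?_⟩
      · rcases Finset.mem_insert.1 hz with rfl | hz
        · have : R z z ≠ 0 := by
            rw [hR.diag_eq]; exact_mod_cast hg.ne'
          field_simp
          ring
        · have : R w z = 0 := hRZ z hz w
          simp [this, hRZ z hz]
      · beta_reduce
        rw [Finset.sum_range_succ, hPR x y, if_pos rfl]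
        have e1 : ∑ l ∈ Finset.range n, (if l = n then fun x => R x w / (√(R w w).re : ℝ) else b l) x
            * conj ((if l = n then fun x => R x w / (√(R w w).re : ℝ) else b l) y)
            = ∑ l ∈ Finset.range n, b l x * conj (b l y) := by
          refine Finset.sum_congr rfl fun l hl => ?_
          rw [if_neg (Finset.mem_range.1 hl).ne]
        have e2 : R x w / (√(R w w).re : ℝ) * conj (R y w / (√(R w w).re : ℝ))
            = R x w * R w y / R w w := by
          rw [map_div₀, Complex.conj_ofReal, ← hR.1, div_mul_div_comm, ← Complex.ofReal_mul,
            Real.mul_self_sqrt hg.le, ← hR.diag_eq]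
        rw [e1, e2]
        ring
    · refine ⟨n, b, R, hR, fun z hz x => ?_, hPR⟩
      rcases Finset.mem_insert.1 hz with rfl | hz
      · exact hR.eq_zero_of_diag hg.symm x
      · exact hRZ z hz x

theorem psd_projection_kernel (hk : ∀ f, (∀ x, ⟪k x, f⟫_ℂ = 0) → f = 0) {P : X → X → ℂ}
    (hP : PSD P) (hkP : ∀ x y, ⟪k x, k y⟫_ℂ * (1 - P x y) = 1) (M : Submodule ℂ H)
    [M.HasOrthogonalProjection]
    (hM : ∀ (b : X → ℂ) (B : H →L[ℂ] H), IsMul k b B → (∀ f, ‖B f‖ ≤ ‖f‖) → ∀ f ∈ M, B f ∈ M) :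
    PSD (fun x y => ⟪k x, M.starProjection (k y)⟫_ℂ * (1 - P x y)) := by
  have hG := PSD.gram k
  have hGM : ∀ x y, ⟪k x, M.starProjection (k y)⟫_ℂ
      = ⟪M.starProjection (k x), M.starProjection (k y)⟫_ℂ := fun x y =>
    (inner_starProjection_eq M _ _).symm
  refine ⟨fun x y => ?_, fun Z c => ?_⟩
  · simp only [hGM]
    rw [map_mul, map_sub, map_one, ← hP.1, inner_conj_symm]
  obtain ⟨n, b, R, hR, hRZ, hPR⟩ := hP.peel Z
  have hS : PSD (fun x y => ⟪k x, k y⟫_ℂ *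
      (1 - ∑ l ∈ Finset.range n, b l x * conj (b l y))) := by
    convert (PSD.const (X := X) zero_le_one).add (hG.mul hR) using 3 with x y
    have := hkP x y
    rw [hPR] at this
    rw [Complex.ofReal_one]
    linear_combination this
  have hB : ∀ l ∈ Finset.range n, ∃ B : H →L[ℂ] H, IsMul k (b l) B ∧ ∀ f, ‖B f‖ ≤ ‖f‖ := by
    intro l hl
    have : PSD (fun x y => ((1 : ℝ) ^ 2 : ℝ) *
        ⟪k x, (⊤ : Submodule ℂ H).starProjection (k y)⟫_ℂ
        - b l x * conj (b l y) * ⟪k x, k y⟫_ℂ) := by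
      convert hS.add (hG.mul (PSD.sum ((Finset.range n).erase l)
        (fun i _ => PSD.rankOne (b i)))) using 3 with x y
      rw [← Finset.add_sum_erase _ _ hl, Submodule.starProjection_top]
      simp
      ring
    obtain ⟨B, h1, h2, -⟩ := exists_isMul hk ⊤ (b l) zero_le_one this
    exact ⟨B, h1, by simpa using h2⟩
  choose! B hB1 hB2 using hB
  have hrow : ∀ f, ∑ l ∈ Finset.range n, ‖(B l).adjoint f‖ ^ 2 ≤ ‖f‖ ^ 2 := by
    intro f
    refine (denseRange_linearCombination hk).induction_on
      (p := fun f => ∑ l ∈ Finset.range n, ‖(B l).adjoint f‖ ^ 2 ≤ ‖f‖ ^ 2) f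
      (isClosed_le (by fun_prop) (by fun_prop)) fun c => ?_
    have h1 := hS.2 c.support c
    have e0 : Finsupp.linearCombination ℂ k c = ∑ j ∈ c.support, c j • k j := by
      simp [Finsupp.linearCombination_apply, Finsupp.sum]
    have e1 : ∀ l ∈ Finset.range n, (B l).adjoint (Finsupp.linearCombination ℂ k c)
        = ∑ j ∈ c.support, c j • (conj (b l j) • k j) := by
      intro l hl
      rw [e0, map_sum]
      refine Finset.sum_congr rfl fun j _ => ?_
      rw [map_smul, (hB1 l hl).adjoint_apply]
    have h2 : ∑ i ∈ c.support, ∑ j ∈ c.support, conj (c i) * (⟪k i, k j⟫_ℂ *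
        (1 - ∑ l ∈ Finset.range n, b l i * conj (b l j))) * c j
        = ((‖Finsupp.linearCombination ℂ k c‖ ^ 2 - ∑ l ∈ Finset.range n,
          ‖(B l).adjoint (Finsupp.linearCombination ℂ k c)‖ ^ 2 : ℝ) : ℂ) := by
      have e2 : ∑ l ∈ Finset.range n, ‖(B l).adjoint (Finsupp.linearCombination ℂ k c)‖ ^ 2
          = ∑ l ∈ Finset.range n, ‖∑ j ∈ c.support, c j • (conj (b l j) • k j)‖ ^ 2 :=
        Finset.sum_congr rfl (fun l hl => by rw [e1 l hl])
      rw [e2, e0, Complex.ofReal_sub, Complex.ofReal_sum]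
      simp_rw [← gram_quad]
      rw [Finset.sum_comm (s := Finset.range n), ← Finset.sum_sub_distrib]
      refine Finset.sum_congr rfl fun i _ => ?_
      rw [Finset.sum_comm (s := Finset.range n), ← Finset.sum_sub_distrib]
      refine Finset.sum_congr rfl fun j _ => ?_
      simp_rw [inner_smul_left, inner_smul_right, conj_conj]
      rw [mul_sub, mul_one, Finset.mul_sum, mul_sub, sub_mul, Finset.mul_sum, Finset.sum_mul]
      congr 1
      refine Finset.sum_congr rfl fun l _ => ?_
      ring
    rw [h2, Complex.ofReal_re, sub_nonneg] at h1
    exact h1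
  have hproj : ∀ l ∈ Finset.range n, ∀ x, M.starProjection ((B l).adjoint
      (M.starProjection (k x))) = conj (b l x) • M.starProjection (k x) := by
    intro l hl x
    have h1 : (B l).adjoint (k x - M.starProjection (k x)) ∈ Mᗮ := by
      rw [Submodule.mem_orthogonal]
      intro u hu
      rw [ContinuousLinearMap.adjoint_inner_right]
      rw [← inner_conj_symm, M.starProjection_inner_eq_zero _ _ (hM _ _ (hB1 l hl) (hB2 l hl) u hu),
        map_zero]
    have h2 := (M.starProjection_apply_eq_zero_iff).2 h1
    rw [map_sub, map_sub, (hB1 l hl).adjoint_apply, map_smul, sub_eq_zero] at h2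
    exact h2.symm
  have h3 := hrow (∑ j ∈ Z, c j • M.starProjection (k j))
  have h4 : ∑ l ∈ Finset.range n, ‖∑ j ∈ Z, c j • (conj (b l j) • M.starProjection (k j))‖ ^ 2
      ≤ ‖∑ j ∈ Z, c j • M.starProjection (k j)‖ ^ 2 := by
    refine le_trans (Finset.sum_le_sum fun l hl => ?_) h3
    have : ∑ j ∈ Z, c j • (conj (b l j) • M.starProjection (k j)) = M.starProjection
        ((B l).adjoint (∑ j ∈ Z, c j • M.starProjection (k j))) := by
      simp_rw [map_sum, map_smul, hproj l hl]
    rw [this]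
    gcongr
    exact M.norm_starProjection_apply_le _
  have h5 : ∑ i ∈ Z, ∑ j ∈ Z, conj (c i) * (⟪k i, M.starProjection (k j)⟫_ℂ * (1 - P i j)) * c j
      = ((‖∑ j ∈ Z, c j • M.starProjection (k j)‖ ^ 2 - ∑ l ∈ Finset.range n,
        ‖∑ j ∈ Z, c j • (conj (b l j) • M.starProjection (k j))‖ ^ 2 : ℝ) : ℂ) := by
    rw [Complex.ofReal_sub, Complex.ofReal_sum]
    simp_rw [← gram_quad]
    rw [Finset.sum_comm (s := Finset.range n), ← Finset.sum_sub_distrib]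
    refine Finset.sum_congr rfl fun i _ => ?_
    rw [Finset.sum_comm (s := Finset.range n), ← Finset.sum_sub_distrib]
    refine Finset.sum_congr rfl fun j hj => ?_
    simp_rw [inner_smul_left, inner_smul_right, conj_conj]
    rw [hPR i j, hRZ j hj, add_zero, hGM, mul_sub, mul_one, Finset.mul_sum, mul_sub, sub_mul,
      Finset.mul_sum, Finset.sum_mul]
    congr 1
    refine Finset.sum_congr rfl fun l _ => ?_
    ring
  rw [h5, Complex.ofReal_re, sub_nonneg]
  exact h4

theorem exists_kernel_factor (hk : ∀ f, (∀ x, ⟪k x, f⟫_ℂ = 0) → f = 0) {P : X → X → ℂ}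
    (hP : PSD P) (hkP : ∀ x y, ⟪k x, k y⟫_ℂ * (1 - P x y) = 1) (M : Submodule ℂ H)
    [M.HasOrthogonalProjection]
    (hM : ∀ (b : X → ℂ) (B : H →L[ℂ] H), IsMul k b B → (∀ f, ‖B f‖ ≤ ‖f‖) → ∀ f ∈ M, B f ∈ M)
    (w : X) : ∃ (b : X → ℂ) (B : H →L[ℂ] H), IsMul k b B ∧ (∀ f, B f ∈ M) ∧
      M.starProjection (k w) = B (k w) := by
  have hG := psd_projection_kernel hk hP hkP M hM
  set G : X → X → ℂ := fun x y => ⟪k x, M.starProjection (k y)⟫_ℂ * (1 - P x y) with hGdef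
  have hfac : ∀ x y, ⟪k x, M.starProjection (k y)⟫_ℂ = G x y * ⟪k x, k y⟫_ℂ := fun x y => by
    simp only [hGdef]
    linear_combination (- ⟪k x, M.starProjection (k y)⟫_ℂ) * hkP x y
  have key : ∃ B : H →L[ℂ] H, IsMul k (fun x => G x w) B ∧ ∀ f, B f ∈ M := by
    rcases (hG.diag_nonneg w).lt_or_eq with hg | hg
    · have h1 : PSD (fun x y => ((√(G w w).re ^ 2 : ℝ) : ℂ) * ⟪k x, M.starProjection (k y)⟫_ℂ
          - G x w * conj (G y w) * ⟪k x, k y⟫_ℂ) := by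
        convert ((hG.sub_rankOne hg).smul hg.le).mul (PSD.gram k) using 3 with x y
        have hd := hG.diag_eq w
        rw [Real.sq_sqrt hg.le, hfac, ← hG.1]
        have : G w w ≠ 0 := by
          rw [hd]; exact_mod_cast hg.ne'
        rw [← hd]
        field_simp
      obtain ⟨B, h2, -, h3⟩ := exists_isMul hk M _ (Real.sqrt_nonneg _) h1
      exact ⟨B, h2, h3⟩
    · refine ⟨0, fun f x => ?_, fun f => ?_⟩
      · simp [hG.eq_zero_of_diag hg.symm x]
      · simp
  obtain ⟨B, h1, h2⟩ := key
  refine ⟨_, B, h1, h2, ?_⟩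
  rw [← sub_eq_zero]
  refine hk _ fun x => ?_
  rw [inner_sub_right, hfac, h1, sub_self]

end AbstractMultipliers

/-- Partial sums of `∑ aᵢ ζⁱ`. -/
def psum (ζ : ℂ) (a : ℕ → ℂ) (j : ℕ) : ℂ := ∑ i ∈ Finset.range (j + 1), a i * ζ ^ i

/-- Partial sums of `∑ i aᵢ ζⁱ`. -/
def hsum (ζ : ℂ) (a : ℕ → ℂ) (j : ℕ) : ℂ := ∑ i ∈ Finset.range (j + 1), i * a i * ζ ^ i

/-- The local Dirichlet integral at `ζ`, in terms of Taylor coefficients. -/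
def dz (ζ : ℂ) (a : ℕ → ℂ) : ℝ≥0∞ :=
  ∑' k : ℕ, ENNReal.ofReal (‖hsum ζ a (k + 1)‖ ^ 2 / ((k + 1) * (k + 2)))

/-- The partial sums of the series defining `dz`. -/
def dK (K : ℕ) (ζ : ℂ) (a : ℕ → ℂ) : ℝ :=
  ∑ j ∈ Finset.range (K + 1), ‖psum ζ a j‖ ^ 2 -
    ‖∑ j ∈ Finset.range (K + 1), psum ζ a j‖ ^ 2 / (K + 1)

/-- Coefficients of `z f`. -/
def shiftSeq (a : ℕ → ℂ) : ℕ → ℂ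
  | 0 => 0
  | n + 1 => a n

@[simp] lemma shiftSeq_zero (a : ℕ → ℂ) : shiftSeq a 0 = 0 := rfl

@[simp] lemma shiftSeq_succ (a : ℕ → ℂ) (n : ℕ) : shiftSeq a (n + 1) = a n := rfl

/-- Coefficients of `(f - f 0) / z`. -/
def tailSeq (a : ℕ → ℂ) : ℕ → ℂ := fun n => a (n + 1)

lemma hsum_succ_eq (ζ : ℂ) (a : ℕ → ℂ) (K : ℕ) :
    hsum ζ a (K + 1) =
      (K + 1) * psum ζ a (K + 1) - ∑ j ∈ Finset.range (K + 1), psum ζ a j := by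
  induction K with
  | zero => simp [hsum, psum, Finset.sum_range_succ]
  | succ K ih =>
    have h1 : hsum ζ a (K + 1 + 1) = hsum ζ a (K + 1) + ((K + 2 : ℕ) : ℂ) * a (K + 2) * ζ ^ (K + 2) := by
      simp only [hsum]; rw [Finset.sum_range_succ]
    have h2 : psum ζ a (K + 1 + 1) = psum ζ a (K + 1) + a (K + 2) * ζ ^ (K + 2) := by
      simp only [psum]; rw [Finset.sum_range_succ]
    rw [h1, ih, Finset.sum_range_succ _ (K + 1), h2]
    push_cast
    ring

lemma normSq_identity (s t : ℂ) (n : ℝ) (hn : 0 < n) :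
    ‖s‖ ^ 2 - ‖t + s‖ ^ 2 / (n + 1) + ‖t‖ ^ 2 / n = ‖(n : ℂ) * s - t‖ ^ 2 / (n * (n + 1)) := by
  simp only [← Complex.normSq_eq_norm_sq, Complex.normSq_apply, Complex.add_re, Complex.add_im,
    Complex.sub_re, Complex.sub_im, Complex.mul_re, Complex.mul_im, Complex.ofReal_re,
    Complex.ofReal_im]
  field_simp
  ring

lemma dK_zero (ζ : ℂ) (a : ℕ → ℂ) : dK 0 ζ a = 0 := by
  simp [dK]

lemma dK_succ (K : ℕ) (ζ : ℂ) (a : ℕ → ℂ) :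
    dK (K + 1) ζ a = dK K ζ a + ‖hsum ζ a (K + 1)‖ ^ 2 / ((K + 1) * (K + 2)) := by
  have h := normSq_identity (psum ζ a (K + 1)) (∑ j ∈ Finset.range (K + 1), psum ζ a j) (K + 1)
    (by positivity)
  rw [hsum_succ_eq]
  simp only [dK]
  rw [Finset.sum_range_succ _ (K + 1), Finset.sum_range_succ _ (K + 1)]
  push_cast at h ⊢
  rw [show (K : ℝ) + 1 + 1 = K + 2 by ring] at *
  linarith

lemma dK_eq_sum (K : ℕ) (ζ : ℂ) (a : ℕ → ℂ) :
    dK K ζ a = ∑ k ∈ Finset.range K, ‖hsum ζ a (k + 1)‖ ^ 2 / ((k + 1) * (k + 2)) := by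
  induction K with
  | zero => simp [dK_zero]
  | succ K ih => rw [dK_succ, ih, Finset.sum_range_succ]

lemma dK_nonneg (K : ℕ) (ζ : ℂ) (a : ℕ → ℂ) : 0 ≤ dK K ζ a := by
  rw [dK_eq_sum]; exact Finset.sum_nonneg fun k _ => by positivity

lemma dK_mono (ζ : ℂ) (a : ℕ → ℂ) : Monotone fun K => dK K ζ a := by
  refine monotone_nat_of_le_succ fun K => ?_
  rw [dK_succ]
  have : 0 ≤ ‖hsum ζ a (K + 1)‖ ^ 2 / (((K : ℝ) + 1) * (K + 2)) := by positivity
  linarith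

lemma tendsto_dK (ζ : ℂ) (a : ℕ → ℂ) :
    Tendsto (fun K => ENNReal.ofReal (dK K ζ a)) atTop (𝓝 (dz ζ a)) := by
  have h := ENNReal.summable (f := fun k : ℕ =>
    ENNReal.ofReal (‖hsum ζ a (k + 1)‖ ^ 2 / ((k + 1) * (k + 2)))) |>.hasSum.tendsto_sum_nat
  refine h.congr fun K => ?_
  rw [dK_eq_sum, ENNReal.ofReal_sum_of_nonneg]
  intro i _; positivity

lemma ofReal_dK_le_dz (K : ℕ) (ζ : ℂ) (a : ℕ → ℂ) : ENNReal.ofReal (dK K ζ a) ≤ dz ζ a := by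
  refine ge_of_tendsto (tendsto_dK ζ a) ?_
  filter_upwards [eventually_ge_atTop K] with n hn
  exact ENNReal.ofReal_le_ofReal (dK_mono ζ a hn)

lemma dz_le_of_dK_le {ζ : ℂ} {a : ℕ → ℂ} {C : ℝ} (h : ∀ K, dK K ζ a ≤ C) :
    dz ζ a ≤ ENNReal.ofReal C :=
  le_of_tendsto' (tendsto_dK ζ a) fun K => ENNReal.ofReal_le_ofReal (h K)

lemma dK_le_toReal {ζ : ℂ} {a : ℕ → ℂ} (h : dz ζ a ≠ ∞) (K : ℕ) : dK K ζ a ≤ (dz ζ a).toReal := by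
  have := ENNReal.toReal_mono h (ofReal_dK_le_dz K ζ a)
  rwa [ENNReal.toReal_ofReal (dK_nonneg K ζ a)] at this

lemma psum_shift_succ (ζ : ℂ) (a : ℕ → ℂ) (j : ℕ) :
    psum ζ (shiftSeq a) (j + 1) = ζ * psum ζ a j := by
  simp only [psum]
  rw [Finset.sum_range_succ']
  simp only [shiftSeq_succ, shiftSeq_zero, zero_mul, add_zero, Finset.mul_sum]
  exact Finset.sum_congr rfl fun i _ => by ring

lemma psum_shift_zero (ζ : ℂ) (a : ℕ → ℂ) : psum ζ (shiftSeq a) 0 = 0 := by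
  simp [psum]

section Circle

variable {ζ : ℂ}

lemma sum_normSq_psum_shift (hζ : ‖ζ‖ = 1) (a : ℕ → ℂ) (K : ℕ) :
    ∑ j ∈ Finset.range (K + 1 + 1), ‖psum ζ (shiftSeq a) j‖ ^ 2 =
      ∑ j ∈ Finset.range (K + 1), ‖psum ζ a j‖ ^ 2 := by
  rw [Finset.sum_range_succ']
  simp [psum_shift_succ, psum_shift_zero, hζ]

lemma sum_psum_shift (a : ℕ → ℂ) (K : ℕ) :
    ∑ j ∈ Finset.range (K + 1 + 1), psum ζ (shiftSeq a) j =
      ζ * ∑ j ∈ Finset.range (K + 1), psum ζ a j := by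
  rw [Finset.sum_range_succ']
  simp [psum_shift_succ, psum_shift_zero, Finset.mul_sum]

lemma dK_shift (hζ : ‖ζ‖ = 1) (a : ℕ → ℂ) (K : ℕ) :
    dK (K + 1) ζ (shiftSeq a) = ∑ j ∈ Finset.range (K + 1), ‖psum ζ a j‖ ^ 2 -
      ‖∑ j ∈ Finset.range (K + 1), psum ζ a j‖ ^ 2 / (K + 2) := by
  simp only [dK]
  rw [sum_normSq_psum_shift hζ, sum_psum_shift, norm_mul, hζ, one_mul]
  push_cast
  ring

lemma dK_shift_shift (hζ : ‖ζ‖ = 1) (a : ℕ → ℂ) (K : ℕ) :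
    dK (K + 2) ζ (shiftSeq (shiftSeq a)) = ∑ j ∈ Finset.range (K + 1), ‖psum ζ a j‖ ^ 2 -
      ‖∑ j ∈ Finset.range (K + 1), psum ζ a j‖ ^ 2 / (K + 3) := by
  rw [dK_shift hζ, sum_normSq_psum_shift hζ, sum_psum_shift, norm_mul, hζ, one_mul]
  push_cast
  ring

lemma le_dz_shift (hζ : ‖ζ‖ = 1) (a : ℕ → ℂ) : dz ζ a ≤ dz ζ (shiftSeq a) := by
  refine le_of_tendsto_of_tendsto' (tendsto_dK ζ a)
    ((tendsto_add_atTop_iff_nat 1).2 (tendsto_dK ζ (shiftSeq a))) fun K => ?_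
  refine ENNReal.ofReal_le_ofReal ?_
  rw [dK_shift hζ, dK]
  gcongr
  norm_num

lemma dz_shift_concave (hζ : ‖ζ‖ = 1) (a : ℕ → ℂ) :
    dz ζ (shiftSeq (shiftSeq a)) + dz ζ a ≤ 2 * dz ζ (shiftSeq a) := by
  have h1 := (tendsto_add_atTop_iff_nat 2).2 (tendsto_dK ζ (shiftSeq (shiftSeq a)))
  have h2 := (tendsto_add_atTop_iff_nat 1).2 (tendsto_dK ζ (shiftSeq a))
  refine le_of_tendsto_of_tendsto' (h1.add (tendsto_dK ζ a))
    (ENNReal.Tendsto.const_mul h2 (Or.inr (by simp))) fun K => ?_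
  rw [← ENNReal.ofReal_add (dK_nonneg _ _ _) (dK_nonneg _ _ _),
    show (2 : ℝ≥0∞) = ENNReal.ofReal 2 by simp, ← ENNReal.ofReal_mul (by norm_num)]
  refine ENNReal.ofReal_le_ofReal ?_
  rw [dK_shift_shift hζ, dK_shift hζ, dK]
  set t := ‖∑ j ∈ Finset.range (K + 1), psum ζ a j‖ ^ 2 with ht
  have h : 2 * (t / (K + 2)) ≤ t / (K + 3) + t / (K + 1) := by
    have h3 : t / (K + 3) + t / (K + 1) - 2 * (t / (K + 2)) =
        2 * t / ((K + 1) * (K + 2) * (K + 3)) := by field_simp; ring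
    have h4 : 0 ≤ 2 * t / (((K : ℝ) + 1) * (K + 2) * (K + 3)) := by positivity
    linarith
  linarith

end Circle

lemma sum_norm_sub_sq (n : ℕ) (u : ℕ → ℂ) (c : ℂ) :
    ∑ j ∈ Finset.range (n + 1), ‖u j - c‖ ^ 2 =
      (∑ j ∈ Finset.range (n + 1), ‖u j‖ ^ 2 - ‖∑ j ∈ Finset.range (n + 1), u j‖ ^ 2 / (n + 1)) +
        (n + 1) * ‖(∑ j ∈ Finset.range (n + 1), u j) / (n + 1) - c‖ ^ 2 := by
  have h1 : ∀ j, ‖u j - c‖ ^ 2 = ‖u j‖ ^ 2 - 2 * (u j * conj c).re + ‖c‖ ^ 2 := by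
    intro j
    simp only [← Complex.normSq_eq_norm_sq]
    rw [Complex.normSq_sub]; ring
  simp only [h1]
  rw [Finset.sum_add_distrib, Finset.sum_sub_distrib, ← Finset.mul_sum, ← Complex.re_sum,
    ← Finset.sum_mul]
  set s := ∑ j ∈ Finset.range (n + 1), u j
  have h2 : s / (n + 1) - c = ((1 / (n + 1) : ℝ) : ℂ) * (s - ((n + 1 : ℝ) : ℂ) * c) := by
    have : (n : ℂ) + 1 ≠ 0 := by exact_mod_cast Nat.succ_ne_zero n
    push_cast; field_simp
  rw [h2]
  simp only [← Complex.normSq_eq_norm_sq, Complex.normSq_apply, Complex.sub_re,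
    Complex.sub_im, Complex.mul_re, Complex.mul_im, Complex.ofReal_re,
    Complex.ofReal_im, Complex.conj_re, Complex.conj_im, Finset.sum_const, Finset.card_range,
    nsmul_eq_mul]
  push_cast
  field_simp
  ring

lemma dK_le_sum_norm_sub_sq (K : ℕ) (ζ : ℂ) (a : ℕ → ℂ) (c : ℂ) :
    dK K ζ a ≤ ∑ j ∈ Finset.range (K + 1), ‖psum ζ a j - c‖ ^ 2 := by
  rw [sum_norm_sub_sq]
  have : 0 ≤ ((K : ℝ) + 1) *
    ‖(∑ j ∈ Finset.range (K + 1), psum ζ a j) / (K + 1) - c‖ ^ 2 := by positivity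
  simp only [dK]; linarith

/-- Means of the partial sums. -/
def meanSum (K : ℕ) (ζ : ℂ) (a : ℕ → ℂ) : ℂ :=
  (∑ j ∈ Finset.range (K + 1), psum ζ a j) / (K + 1)

lemma dK_eq_sum_norm_sub_meanSum (K : ℕ) (ζ : ℂ) (a : ℕ → ℂ) :
    ∑ j ∈ Finset.range (K + 1), ‖psum ζ a j - meanSum K ζ a‖ ^ 2 = dK K ζ a := by
  rw [sum_norm_sub_sq]; simp [dK, meanSum]

lemma normSq_meanSum_le (K : ℕ) (ζ : ℂ) (a : ℕ → ℂ) :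
    ‖meanSum K ζ a‖ ^ 2 ≤ 2 * dK K ζ a + 2 * ‖a 0‖ ^ 2 := by
  have h1 : ‖psum ζ a 0 - meanSum K ζ a‖ ^ 2 ≤ dK K ζ a := by
    rw [← dK_eq_sum_norm_sub_meanSum]
    exact Finset.single_le_sum (f := fun j => ‖psum ζ a j - meanSum K ζ a‖ ^ 2)
      (fun i _ => by positivity) (Finset.mem_range.2 (Nat.succ_pos K))
  have h2 : psum ζ a 0 = a 0 := by simp [psum]
  rw [h2] at h1
  have h3 : ‖meanSum K ζ a‖ ≤ ‖a 0 - meanSum K ζ a‖ + ‖a 0‖ := by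
    rw [norm_sub_rev]
    calc _ = ‖(meanSum K ζ a - a 0) + a 0‖ := by simp
      _ ≤ _ := norm_add_le _ _
  have h4 := norm_nonneg (meanSum K ζ a)
  nlinarith [sq_nonneg (‖a 0 - meanSum K ζ a‖ - ‖a 0‖)]

lemma dz_shift_le {ζ : ℂ} (hζ : ‖ζ‖ = 1) (a : ℕ → ℂ) :
    dz ζ (shiftSeq a) ≤ 3 * dz ζ a + ENNReal.ofReal (2 * ‖a 0‖ ^ 2) := by
  have h2 := (tendsto_add_atTop_iff_nat 1).2 (tendsto_dK ζ (shiftSeq a))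
  refine le_of_tendsto_of_tendsto' h2
    ((ENNReal.Tendsto.const_mul (tendsto_dK ζ a) (Or.inr (by simp))).add_const _) fun K => ?_
  rw [show (3 : ℝ≥0∞) = ENNReal.ofReal 3 by simp, ← ENNReal.ofReal_mul (by norm_num),
    ← ENNReal.ofReal_add (mul_nonneg (by norm_num) (dK_nonneg _ _ _)) (by positivity)]
  refine ENNReal.ofReal_le_ofReal ?_
  have h3 := normSq_meanSum_le K ζ a
  have h4 : dK (K + 1) ζ (shiftSeq a) ≤ dK K ζ a + ‖meanSum K ζ a‖ ^ 2 := by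
    rw [dK_shift hζ, meanSum, norm_div, show (K : ℂ) + 1 = ((K + 1 : ℝ) : ℂ) by push_cast; rfl,
      Complex.norm_real, Real.norm_of_nonneg (by positivity), div_pow, dK]
    set t := ‖∑ j ∈ Finset.range (K + 1), psum ζ a j‖ ^ 2 with ht
    have h5 : t / (K + 1) - t / (K + 2) ≤ t / (K + 1) ^ 2 := by
      have ht0 : 0 ≤ t := by positivity
      rw [show t / (K + 1) - t / (K + 2) = t / ((K + 1) * (K + 2)) by field_simp; ring]
      gcongr
      nlinarith
    linarith
  linarith

lemma dz_congr_succ {ζ : ℂ} {a b : ℕ → ℂ} (h : ∀ n, a (n + 1) = b (n + 1)) : dz ζ a = dz ζ b := by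
  have : ∀ k, hsum ζ a k = hsum ζ b k := by
    intro k
    refine Finset.sum_congr rfl fun i _ => ?_
    cases i <;> simp [h]
  simp only [dz, this]

lemma dz_tail_le {ζ : ℂ} (hζ : ‖ζ‖ = 1) (a : ℕ → ℂ) : dz ζ (tailSeq a) ≤ dz ζ a := by
  refine (le_dz_shift hζ (tailSeq a)).trans (le_of_eq (dz_congr_succ fun n => ?_))
  simp [tailSeq]

/-- The Hilbert space of square summable sequences. -/
abbrev E2 := lp (fun _ : ℕ => ℂ) 2

lemma E2.hasSum_normSq (x : E2) : HasSum (fun n => ‖x n‖ ^ 2) (‖x‖ ^ 2) := by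
  have := lp.hasSum_norm (p := 2) (by simp) x
  simpa using this

lemma E2.memℓp_of_summable {a : ℕ → ℂ} (h : Summable fun n => ‖a n‖ ^ 2) : Memℓp a 2 := by
  rw [memℓp_gen_iff (by simp)]
  simpa using h

lemma E2.sum_le (x : E2) (s : Finset ℕ) : ∑ n ∈ s, ‖x n‖ ^ 2 ≤ ‖x‖ ^ 2 :=
  sum_le_hasSum s (fun _ _ => by positivity) (E2.hasSum_normSq x)

lemma E2.normSq_le_of_sum_le (x : E2) {C : ℝ}
    (h : ∀ K, ∑ n ∈ Finset.range K, ‖x n‖ ^ 2 ≤ C) : ‖x‖ ^ 2 ≤ C :=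
  le_of_tendsto' (E2.hasSum_normSq x).tendsto_sum_nat h

lemma E2.exists_of_sum_le {a : ℕ → ℂ} {C : ℝ}
    (h : ∀ K, ∑ n ∈ Finset.range K, ‖a n‖ ^ 2 ≤ C) :
    ∃ x : E2, (∀ n, x n = a n) ∧ ‖x‖ ^ 2 ≤ C := by
  have hs : Summable fun n => ‖a n‖ ^ 2 :=
    summable_of_sum_range_le (fun _ => by positivity) h
  let x : E2 := ⟨a, E2.memℓp_of_summable hs⟩
  exact ⟨x, fun n => rfl, E2.normSq_le_of_sum_le x h⟩

lemma dz_le_of_rep {ζ c : ℂ} (hζ : ‖ζ‖ = 1) {a : ℕ → ℂ} (g : E2)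
    (h : ∀ j, psum ζ a j = c + ζ ^ j * g j) : dz ζ a ≤ ENNReal.ofReal (‖g‖ ^ 2) := by
  refine dz_le_of_dK_le fun K => (dK_le_sum_norm_sub_sq K ζ a c).trans ?_
  simp only [h, add_sub_cancel_left, norm_mul, norm_pow, hζ, one_pow, one_mul]
  exact E2.sum_le g _

lemma exists_rep_of_dz_ne_top {ζ : ℂ} (hζ : ‖ζ‖ = 1) {a : ℕ → ℂ} (h : dz ζ a ≠ ∞) :
    ∃ (c : ℂ) (g : E2), ‖g‖ ^ 2 ≤ (dz ζ a).toReal ∧ ∀ j, psum ζ a j = c + ζ ^ j * g j := by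
  have hb : ∀ K, meanSum K ζ a ∈ Metric.closedBall (0 : ℂ)
      (Real.sqrt (2 * (dz ζ a).toReal + 2 * ‖a 0‖ ^ 2)) := by
    intro K
    rw [mem_closedBall_zero_iff]
    refine Real.le_sqrt_of_sq_le ((normSq_meanSum_le K ζ a).trans ?_)
    linarith [dK_le_toReal h K]
  obtain ⟨c, -, φ, hφ, hc⟩ := (isCompact_closedBall (0 : ℂ) _).tendsto_subseq hb
  have hJ : ∀ J, ∑ j ∈ Finset.range J, ‖psum ζ a j - c‖ ^ 2 ≤ (dz ζ a).toReal := by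
    intro J
    have ht : Tendsto (fun n => ∑ j ∈ Finset.range J, ‖psum ζ a j - meanSum (φ n) ζ a‖ ^ 2) atTop
        (𝓝 (∑ j ∈ Finset.range J, ‖psum ζ a j - c‖ ^ 2)) :=
      tendsto_finsetSum _ fun j _ => (((tendsto_const_nhds.sub hc).norm).pow 2)
    refine le_of_tendsto ht ?_
    filter_upwards [eventually_ge_atTop J] with n hn
    refine le_trans ?_ (dK_le_toReal h (φ n))
    rw [← dK_eq_sum_norm_sub_meanSum]
    refine Finset.sum_le_sum_of_subset_of_nonneg ?_ fun _ _ _ => by positivity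
    exact Finset.range_mono (hn.trans ((hφ.id_le n).trans (Nat.le_succ _)))
  have hζ0 : ζ ≠ 0 := by rintro rfl; simp at hζ
  obtain ⟨g, hg, hgn⟩ := E2.exists_of_sum_le (a := fun j => (psum ζ a j - c) / ζ ^ j)
    (C := (dz ζ a).toReal) (fun K => by simpa [hζ] using hJ K)
  refine ⟨c, g, hgn, fun j => ?_⟩
  rw [hg]
  field_simp
  ring

section Space

variable (μ : Measure ℂ)

/-- The Dirichlet energy in terms of Taylor coefficients. -/
def Dir (a : ℕ → ℂ) : ℝ≥0∞ := ∫⁻ ζ, dz ζ a ∂μ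

lemma continuous_hsum (a : ℕ → ℂ) (k : ℕ) : Continuous fun ζ => hsum ζ a k := by
  unfold hsum; fun_prop

lemma measurable_dz (a : ℕ → ℂ) : Measurable fun ζ => dz ζ a := by
  unfold dz
  refine Measurable.tsum fun k => ?_
  have := continuous_hsum a (k + 1)
  fun_prop

variable [IsFiniteMeasure μ] [Fact (OnCircle μ)]

omit [IsFiniteMeasure μ] in
lemma ae_norm_eq_one : ∀ᵐ ζ ∂μ, ‖ζ‖ = 1 := by
  have h : OnCircle μ := Fact.out
  rw [OnCircle, ← mem_ae_iff] at h
  filter_upwards [h] with ζ hζ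
  simpa [circleT] using hζ

lemma memLp_hsum (a : ℕ → ℂ) (k : ℕ) : MemLp (fun ζ => hsum ζ a k) 2 μ := by
  refine MemLp.of_bound (continuous_hsum a k).aestronglyMeasurable
    (∑ i ∈ Finset.range (k + 1), ‖(i : ℂ) * a i‖) ?_
  filter_upwards [ae_norm_eq_one μ] with ζ hζ
  refine (norm_sum_le _ _).trans (le_of_eq (Finset.sum_congr rfl fun i _ => ?_))
  rw [norm_mul _ (ζ ^ i), norm_pow, hζ, one_pow, mul_one]

lemma memLp_pow (j : ℕ) : MemLp (fun ζ : ℂ => ζ ^ j) 2 μ := by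
  refine MemLp.of_bound (by fun_prop) 1 ?_
  filter_upwards [ae_norm_eq_one μ] with ζ hζ
  simp [hζ]

/-- The coordinate functional on square summable sequences. -/
def coordE (j : ℕ) : E2 →L[ℂ] ℂ := lp.evalCLM ℂ (fun _ : ℕ => ℂ) 2 j

@[simp] lemma coordE_apply (j : ℕ) (a : E2) : coordE j a = a j := rfl

/-- The components of the energy map. -/
def energyCLM (k : ℕ) : E2 →L[ℂ] Lp ℂ 2 μ :=
  ∑ j ∈ Finset.range (k + 2), (((j : ℝ) / Real.sqrt ((k + 1) * (k + 2)) : ℝ) : ℂ) •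
    (coordE j).smulRight ((memLp_pow μ j).toLp _)

lemma coeFn_energyCLM (k : ℕ) (a : E2) :
    energyCLM μ k a =ᵐ[μ] fun ζ =>
      ((1 / Real.sqrt ((k + 1) * (k + 2)) : ℝ) : ℂ) * hsum ζ a (k + 1) := by
  have h : energyCLM μ k a = ((memLp_hsum μ a (k + 1)).const_mul
      ((1 / Real.sqrt ((k + 1) * (k + 2)) : ℝ) : ℂ)).toLp _ := by
    have h1 : ∀ s : Finset ℕ, ∀ (f : ℕ → ℂ → ℂ) (hf : ∀ j, MemLp (f j) 2 μ)
        (hs : MemLp (fun ζ => ∑ j ∈ s, f j ζ) 2 μ),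
        ∑ j ∈ s, (hf j).toLp _ = hs.toLp _ := by
      intro s f hf
      induction s using Finset.induction_on with
      | empty => intro hs; simp
      | insert i s hi ih =>
        intro hs
        rw [Finset.sum_insert hi, ih (memLp_finsetSum s fun j _ => hf j), ← MemLp.toLp_add]
        congr 1
        funext ζ
        simp [Finset.sum_insert hi]
    have h2 : ∀ j : ℕ, MemLp (fun ζ : ℂ => ((((j : ℕ) : ℝ) / Real.sqrt ((k + 1) * (k + 2)) : ℝ) : ℂ) *
        (a j * ζ ^ j)) 2 μ := fun j => ((memLp_pow μ j).const_mul _).const_mul _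
    have h3 : energyCLM μ k a = ∑ j ∈ Finset.range (k + 2), (h2 j).toLp _ := by
      simp only [energyCLM, sum_apply, smul_apply,
        ContinuousLinearMap.smulRight_apply, coordE_apply]
      rfl
    rw [h3, h1 _ _ h2 (memLp_finsetSum _ fun j _ => h2 j)]
    congr 1
    funext ζ
    simp only [hsum, Finset.mul_sum]
    refine Finset.sum_congr rfl fun j _ => ?_
    push_cast
    ring
  rw [h]
  exact MemLp.coeFn_toLp _

lemma normSq_energyCLM (k : ℕ) (a : E2) :
    ENNReal.ofReal (‖energyCLM μ k a‖ ^ 2) =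
      ∫⁻ ζ, ENNReal.ofReal (‖hsum ζ a (k + 1)‖ ^ 2 / ((k + 1) * (k + 2))) ∂μ := by
  have h1 : (‖energyCLM μ k a‖ ^ 2 : ℝ) = ∫ ζ, ‖energyCLM μ k a ζ‖ ^ 2 ∂μ := by
    have h := L2.inner_def (𝕜 := ℂ) (energyCLM μ k a) (energyCLM μ k a)
    have h' : ⟪energyCLM μ k a, energyCLM μ k a⟫_ℂ = (‖energyCLM μ k a‖ : ℂ) ^ 2 :=
      inner_self_eq_norm_sq_to_K _
    have h'' : ∀ ζ, ⟪energyCLM μ k a ζ, energyCLM μ k a ζ⟫_ℂ =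
        ((‖energyCLM μ k a ζ‖ ^ 2 : ℝ) : ℂ) := fun ζ => by
      push_cast; exact inner_self_eq_norm_sq_to_K _
    rw [h'] at h
    simp only [h''] at h
    rw [integral_complex_ofReal] at h
    exact_mod_cast h
  have h2 : ∀ᵐ ζ ∂μ, ‖energyCLM μ k a ζ‖ ^ 2 =
      ‖hsum ζ a (k + 1)‖ ^ 2 / ((k + 1) * (k + 2)) := by
    filter_upwards [coeFn_energyCLM μ k a] with ζ hζ
    rw [hζ, norm_mul, Complex.norm_real, mul_pow, Real.norm_of_nonneg (by positivity), div_pow,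
      Real.sq_sqrt (by positivity)]
    ring
  rw [h1, integral_congr_ae h2, ofReal_integral_eq_lintegral_ofReal]
  · exact (((memLp_hsum μ a (k + 1)).integrable_norm_pow (by norm_num)).div_const _)
  · exact Eventually.of_forall fun ζ => by positivity

lemma Dir_eq_tsum (a : E2) : Dir μ a = ∑' k, ENNReal.ofReal (‖energyCLM μ k a‖ ^ 2) := by
  simp only [normSq_energyCLM, Dir, dz]
  refine lintegral_tsum fun k => ?_
  have := continuous_hsum a (k + 1)
  fun_prop

/-- The ambient Hilbert space. -/
abbrev Ambient := WithLp 2 (E2 × lp (fun _ : ℕ => Lp ℂ 2 μ) 2)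

/-- The graph of the energy map. -/
def graphSub : Submodule ℂ (Ambient μ) where
  carrier := {p | ∀ k, p.snd k = energyCLM μ k p.fst}
  add_mem' := by
    intro p q hp hq k
    simp only [Set.mem_ofPred_eq] at hp hq
    simp [hp k, hq k]
  zero_mem' := by intro k; simp
  smul_mem' := by
    intro c p hp k
    simp only [Set.mem_ofPred_eq] at hp
    simp [hp k]

lemma isClosed_graphSub : IsClosed (graphSub μ : Set (Ambient μ)) := by
  have : (graphSub μ : Set (Ambient μ)) = ⋂ k, {p | p.snd k = energyCLM μ k p.fst} := by
    ext p; simp only [Set.mem_iInter]; rfl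
  rw [this]
  refine isClosed_iInter fun k => isClosed_eq ?_ ?_
  · exact (lp.evalCLM ℂ (fun _ : ℕ => Lp ℂ 2 μ) 2 k).continuous.comp (WithLp.continuous_snd ..)
  · exact (energyCLM μ k).continuous.comp (WithLp.continuous_fst ..)

/-- The Dirichlet-type space as a Hilbert space. -/
def DH : Type := graphSub μ

instance : NormedAddCommGroup (DH μ) := inferInstanceAs (NormedAddCommGroup (graphSub μ))

instance : InnerProductSpace ℂ (DH μ) := inferInstanceAs (InnerProductSpace ℂ (graphSub μ))

instance : CompleteSpace (DH μ) := (isClosed_graphSub μ).completeSpace_coe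

/-- The Taylor coefficients of an element of the space. -/
def coef : DH μ →L[ℂ] E2 :=
  (WithLp.fstL 2 ℂ E2 (lp (fun _ : ℕ => Lp ℂ 2 μ) 2)).comp (graphSub μ).subtypeL

lemma coef_injective : Function.Injective (coef μ) := by
  intro x y h
  have h' : WithLp.fst (x.1 : Ambient μ) = WithLp.fst (y.1 : Ambient μ) := h
  refine Subtype.ext (WithLp.ofLp_injective 2 (Prod.ext h' (lp.ext (funext fun k => ?_))))
  exact (x.2 k).trans ((congrArg _ h').trans (y.2 k).symm)

lemma normSq_ambient (x : DH μ) :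
    ‖x‖ ^ 2 = ‖coef μ x‖ ^ 2 + ‖WithLp.snd (x.1 : Ambient μ)‖ ^ 2 :=
  WithLp.prod_norm_sq_eq_of_L2 (x.1 : Ambient μ)

lemma hasSum_energy (x : DH μ) :
    HasSum (fun k => ‖energyCLM μ k (coef μ x)‖ ^ 2) (‖WithLp.snd (x.1 : Ambient μ)‖ ^ 2) := by
  have h := lp.hasSum_norm (p := 2) (by simp) (WithLp.snd (x.1 : Ambient μ))
  have h2 : ∀ k, WithLp.snd (x.1 : Ambient μ) k = energyCLM μ k (coef μ x) := x.2
  simp only [h2] at h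
  simpa using h

lemma Dir_coef (x : DH μ) :
    Dir μ (coef μ x) = ENNReal.ofReal (‖WithLp.snd (x.1 : Ambient μ)‖ ^ 2) := by
  rw [Dir_eq_tsum, ← ENNReal.ofReal_tsum_of_nonneg (fun _ => by positivity)
    (hasSum_energy μ x).summable, (hasSum_energy μ x).tsum_eq]

lemma Dir_coef_ne_top (x : DH μ) : Dir μ (coef μ x) ≠ ∞ := by
  rw [Dir_coef]; exact ENNReal.ofReal_ne_top

lemma DH.normSq (x : DH μ) : ‖x‖ ^ 2 = ‖coef μ x‖ ^ 2 + (Dir μ (coef μ x)).toReal := by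
  rw [normSq_ambient, Dir_coef, ENNReal.toReal_ofReal (by positivity)]

lemma DH.exists_of_Dir {a : E2} (h : Dir μ a ≠ ∞) : ∃ x : DH μ, coef μ x = a := by
  rw [Dir_eq_tsum] at h
  have hs : Summable fun k => ‖energyCLM μ k a‖ ^ 2 := by
    have := ENNReal.summable_toReal h
    simpa [ENNReal.toReal_ofReal] using this
  have hm : Memℓp (fun k => energyCLM μ k a) 2 := by
    rw [memℓp_gen_iff (by simp)]; simpa using hs
  exact ⟨⟨WithLp.toLp 2 (a, ⟨fun k => energyCLM μ k a, hm⟩), fun k => rfl⟩, rfl⟩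

end Space

section Weak

variable {E : Type*} [NormedAddCommGroup E] [InnerProductSpace ℂ E]

lemma tendsto_inner_of_dense {ι : Type*} {l : Filter ι} {f : ι → E} {g : E} {C : ℝ}
    (hC : ∀ i, ‖f i‖ ≤ C) {D : Set E} (hD : Dense (Submodule.span ℂ D : Set E))
    (h : ∀ y ∈ D, Tendsto (fun i => ⟪y, f i⟫_ℂ) l (𝓝 ⟪y, g⟫_ℂ)) (y : E) :
    Tendsto (fun i => ⟪y, f i⟫_ℂ) l (𝓝 ⟪y, g⟫_ℂ) := by
  have hspan : ∀ y ∈ Submodule.span ℂ D, Tendsto (fun i => ⟪y, f i⟫_ℂ) l (𝓝 ⟪y, g⟫_ℂ) := by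
    intro y hy
    induction hy using Submodule.span_induction with
    | mem x hx => exact h x hx
    | zero => simp only [inner_zero_left]; exact tendsto_const_nhds
    | add x y _ _ hx hy => simpa [inner_add_left] using hx.add hy
    | smul c x _ hx => simpa [inner_smul_left, mul_comm] using hx.const_mul (conj c)
  rw [Metric.tendsto_nhds]
  intro ε hε
  have hpos : 0 < |C| + ‖g‖ + 1 := by positivity
  obtain ⟨y', hy', hd⟩ := Metric.mem_closure_iff.1 (hD y) (ε / (2 * (|C| + ‖g‖ + 1)))
    (by positivity)
  filter_upwards [(Metric.tendsto_nhds.1 (hspan y' hy')) (ε / 2) (by positivity)] with i hi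
  rw [dist_eq_norm] at hi hd ⊢
  rw [← inner_sub_right] at hi ⊢
  have h1 : ⟪y, f i - g⟫_ℂ = ⟪y - y', f i - g⟫_ℂ + ⟪y', f i - g⟫_ℂ := by
    rw [inner_sub_left]; ring
  have h2 : ‖⟪y - y', f i - g⟫_ℂ‖ ≤ ‖y - y'‖ * (|C| + ‖g‖ + 1) := by
    refine (norm_inner_le_norm _ _).trans (mul_le_mul_of_nonneg_left ?_ (norm_nonneg _))
    have := norm_sub_le (f i) g
    linarith [hC i, le_abs_self C]
  have h3 : ‖y - y'‖ * (|C| + ‖g‖ + 1) < ε / 2 := by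
    calc _ < ε / (2 * (|C| + ‖g‖ + 1)) * (|C| + ‖g‖ + 1) := by gcongr
      _ = ε / 2 := by field_simp
  rw [h1]
  exact (norm_add_le _ _).trans_lt (by linarith)

lemma dense_span_of_forall_inner_eq_zero [CompleteSpace E] {D : Set E}
    (h : ∀ x, (∀ y ∈ D, ⟪y, x⟫_ℂ = 0) → x = 0) : Dense (Submodule.span ℂ D : Set E) := by
  rw [Submodule.dense_iff_topologicalClosure_eq_top, Submodule.topologicalClosure_eq_top_iff,
    Submodule.eq_bot_iff]
  intro x hx
  refine h x fun y hy => ?_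
  exact (Submodule.mem_orthogonal _ _).1 hx y (Submodule.subset_span hy)

end Weak

lemma eq_zero_of_hasSum_pow {a : ℕ → ℂ}
    (h : ∀ z : ℂ, ‖z‖ < 1 → HasSum (fun n => a n * z ^ n) 0) : a = 0 := by
  have hp : HasFPowerSeriesAt (fun _ => (0 : ℂ)) (FormalMultilinearSeries.ofScalars ℂ a) 0 := by
    rw [hasFPowerSeriesAt_iff]
    filter_upwards [Metric.ball_mem_nhds (0 : ℂ) one_pos] with z hz
    have := h z (by simpa using hz)
    simpa [FormalMultilinearSeries.coeff_ofScalars, mul_comm] using this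
  have h0 := hp.eq_zero
  funext n
  have := congrArg (fun p => FormalMultilinearSeries.coeff p n) h0
  rw [FormalMultilinearSeries.coeff_ofScalars] at this
  rw [this]; rfl

/-- The points of the unit disc. -/
abbrev Dsc := {z : ℂ // ‖z‖ < 1}

/-- The origin. -/
def o : Dsc := ⟨0, by simp⟩

@[simp] lemma o_val : (o : ℂ) = 0 := rfl

lemma summable_evec (z : Dsc) : Summable fun n => ‖conj (z : ℂ) ^ n‖ ^ 2 := by
  have h : ∀ n : ℕ, ‖conj (z : ℂ) ^ n‖ ^ 2 = (‖(z : ℂ)‖ ^ 2) ^ n := fun n => by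
    rw [norm_pow, RCLike.norm_conj, ← pow_mul, ← pow_mul, mul_comm]
  simp only [h]
  exact summable_geometric_of_lt_one (by positivity) (by
    have := z.2; have := norm_nonneg (z : ℂ); nlinarith)

/-- The Szegő kernel vectors. -/
def evec (z : Dsc) : E2 := ⟨fun n => conj (z : ℂ) ^ n, E2.memℓp_of_summable (summable_evec z)⟩

@[simp] lemma evec_apply (z : Dsc) (n : ℕ) : evec z n = conj (z : ℂ) ^ n := rfl

lemma hasSum_inner_evec (z : Dsc) (a : E2) :
    HasSum (fun n => a n * (z : ℂ) ^ n) ⟪evec z, a⟫_ℂ := by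
  have := lp.hasSum_inner (𝕜 := ℂ) (evec z) a
  simpa using this

lemma inner_evec_o (a : E2) : ⟪evec o, a⟫_ℂ = a 0 := by
  refine (hasSum_inner_evec o a).unique ?_
  convert hasSum_single (f := fun n => a n * (o : ℂ) ^ n) 0 ?_ using 1
  · simp
  · intro n hn; simp [hn]

/-- The standard basis. -/
def bas (n : ℕ) : E2 := lp.single 2 n 1

lemma bas_apply (n m : ℕ) : bas n m = if m = n then 1 else 0 := by
  simp [bas, lp.single_apply, Pi.single_apply]

lemma inner_bas (n : ℕ) (a : E2) : ⟪bas n, a⟫_ℂ = a n := by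
  rw [bas, lp.inner_single_left]; simp

lemma E2.add_apply (a b : E2) (n : ℕ) : (a + b) n = a n + b n := rfl

lemma E2.sub_apply (a b : E2) (n : ℕ) : (a - b) n = a n - b n := rfl

lemma E2.smul_apply (c : ℂ) (a : E2) (n : ℕ) : (c • a) n = c * a n := rfl

lemma E2.ext {a b : E2} (h : ∀ n, a n = b n) : a = b := lp.ext (funext h)

lemma E2.tendsto_inner {ι : Type*} {l : Filter ι} {f : ι → E2} {g : E2} {C : ℝ}
    (hC : ∀ i, ‖f i‖ ≤ C) (h : ∀ n, Tendsto (fun i => f i n) l (𝓝 (g n))) (y : E2) :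
    Tendsto (fun i => ⟪y, f i⟫_ℂ) l (𝓝 ⟪y, g⟫_ℂ) := by
  refine tendsto_inner_of_dense hC (D := Set.range bas)
    (dense_span_of_forall_inner_eq_zero fun x hx => E2.ext fun n => ?_) ?_ y
  · rw [← inner_bas, hx _ ⟨n, rfl⟩]; rfl
  · rintro _ ⟨n, rfl⟩
    simpa only [inner_bas] using h n

lemma hasSum_shiftSeq (a : E2) : HasSum (fun n => ‖shiftSeq a n‖ ^ 2) (‖a‖ ^ 2) := by
  rw [← hasSum_nat_add_iff' 1]
  simpa using E2.hasSum_normSq a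

/-- The unilateral shift. -/
def shiftE : E2 →ₗᵢ[ℂ] E2 where
  toFun a := ⟨shiftSeq a, E2.memℓp_of_summable (hasSum_shiftSeq a).summable⟩
  map_add' a b := E2.ext fun n => by
    cases n
    · exact (add_zero (0 : ℂ)).symm
    · rfl
  map_smul' c a := E2.ext fun n => by
    cases n
    · exact (mul_zero c).symm
    · rfl
  norm_map' a := by
    have h1 := (E2.hasSum_normSq
      (⟨shiftSeq a, E2.memℓp_of_summable (hasSum_shiftSeq a).summable⟩ : E2)).unique
      (hasSum_shiftSeq a)
    exact (sq_eq_sq₀ (norm_nonneg _) (norm_nonneg _)).1 h1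

/-- The shift as a continuous linear map. -/
def SE : E2 →L[ℂ] E2 := shiftE.toContinuousLinearMap

lemma coe_SE (a : E2) : (SE a : ℕ → ℂ) = shiftSeq a := rfl

@[simp] lemma SE_zero (a : E2) : SE a 0 = 0 := rfl

@[simp] lemma SE_succ (a : E2) (n : ℕ) : SE a (n + 1) = a n := rfl

lemma norm_SE (a : E2) : ‖SE a‖ = ‖a‖ := shiftE.norm_map a

lemma inner_SE (a b : E2) : ⟪SE a, SE b⟫_ℂ = ⟪a, b⟫_ℂ := shiftE.inner_map_map a b

lemma SE_bas (n : ℕ) : SE (bas n) = bas (n + 1) :=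
  E2.ext fun m => by cases m <;> simp [bas_apply]

/-- The backward shift. -/
def BE : E2 →L[ℂ] E2 := SE.adjoint

@[simp] lemma BE_apply (a : E2) (n : ℕ) : BE a n = a (n + 1) := by
  rw [← inner_bas, BE, ContinuousLinearMap.adjoint_inner_right, SE_bas, inner_bas]

lemma coe_BE (a : E2) : (BE a : ℕ → ℂ) = tailSeq a := funext fun n => BE_apply a n

lemma BE_SE (a : E2) : BE (SE a) = a := E2.ext fun n => by simp

lemma SE_BE (a : E2) : SE (BE a) = a - a 0 • bas 0 :=
  E2.ext fun n => by
    rw [E2.sub_apply, E2.smul_apply, bas_apply]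
    cases n <;> simp

lemma norm_BE_le (a : E2) : ‖BE a‖ ≤ ‖a‖ := by
  rw [← norm_SE (BE a)]
  have h1 : ‖SE (BE a)‖ ^ 2 ≤ ‖a‖ ^ 2 := by
    rw [norm_SE]
    refine E2.normSq_le_of_sum_le _ fun K => ?_
    have := E2.sum_le a (Finset.range (K + 1))
    rw [Finset.sum_range_succ'] at this
    simp only [BE_apply]
    have h0 : 0 ≤ ‖a 0‖ ^ 2 := by positivity
    linarith
  exact (sq_le_sq₀ (norm_nonneg _) (norm_nonneg _)).1 h1

lemma BE_evec (z : Dsc) : BE (evec z) = conj (z : ℂ) • evec z :=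
  E2.ext fun n => by simp [pow_succ, mul_comm]

lemma inner_evec_SE (z : Dsc) (a : E2) : ⟪evec z, SE a⟫_ℂ = z * ⟪evec z, a⟫_ℂ := by
  rw [← ContinuousLinearMap.adjoint_inner_left, ← BE, BE_evec, inner_smul_left]
  simp

lemma evec_o : evec o = bas 0 := E2.ext fun n => by
  cases n <;> simp [bas_apply]

lemma E2.norm_coord_le (a : E2) (n : ℕ) : ‖a n‖ ≤ ‖a‖ := lp.norm_apply_le_norm (by simp) a n

section Dirichlet

variable (μ : Measure ℂ) [IsFiniteMeasure μ] [Fact (OnCircle μ)]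

lemma DH.ext {x y : DH μ} (h : ∀ n, coef μ x n = coef μ y n) : x = y :=
  coef_injective μ (E2.ext h)

/-- Reproducing kernel vectors. -/
def kv (z : Dsc) : DH μ := (coef μ).adjoint (evec z)

lemma inner_kv (z : Dsc) (x : DH μ) : ⟪kv μ z, x⟫_ℂ = ⟪evec z, coef μ x⟫_ℂ := by
  rw [kv, ContinuousLinearMap.adjoint_inner_left]

lemma hasSum_inner_kv (z : Dsc) (x : DH μ) :
    HasSum (fun n => coef μ x n * (z : ℂ) ^ n) ⟪kv μ z, x⟫_ℂ := by
  rw [inner_kv]; exact hasSum_inner_evec z _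

lemma eq_zero_of_inner_kv (x : DH μ) (h : ∀ z, ⟪kv μ z, x⟫_ℂ = 0) : x = 0 := by
  refine DH.ext μ fun n => ?_
  have h0 : (coef μ x : ℕ → ℂ) = 0 := eq_zero_of_hasSum_pow fun z hz => by
    have := hasSum_inner_kv μ ⟨z, hz⟩ x
    rwa [h] at this
  rw [h0, map_zero]; rfl

lemma dense_span_kv : Dense (Submodule.span ℂ (Set.range (kv μ)) : Set (DH μ)) :=
  dense_span_of_forall_inner_eq_zero fun x hx => eq_zero_of_inner_kv μ x fun z => hx _ ⟨z, rfl⟩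

lemma DH.tendsto_inner {ι : Type*} {l : Filter ι} {f : ι → DH μ} {g : DH μ} {C : ℝ}
    (hC : ∀ i, ‖f i‖ ≤ C)
    (h : ∀ z, Tendsto (fun i => ⟪kv μ z, f i⟫_ℂ) l (𝓝 ⟪kv μ z, g⟫_ℂ)) (y : DH μ) :
    Tendsto (fun i => ⟪y, f i⟫_ℂ) l (𝓝 ⟪y, g⟫_ℂ) := by
  refine tendsto_inner_of_dense hC (dense_span_kv μ) ?_ y
  rintro _ ⟨z, rfl⟩
  exact h z

lemma dz_eq_zero_of_succ {ζ : ℂ} {a : ℕ → ℂ} (h : ∀ n, a (n + 1) = 0) : dz ζ a = 0 := by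
  rw [dz_congr_succ (b := 0) (by simpa using h)]
  simp [dz, hsum]

omit [IsFiniteMeasure μ] [Fact (OnCircle μ)] in
lemma Dir_bas_zero : Dir μ (bas 0) = 0 := by
  have : ∀ ζ, dz ζ (bas 0) = 0 := fun ζ => dz_eq_zero_of_succ fun n => by simp [bas_apply]
  simp [Dir, this]

/-- The constant function. -/
def oneH : DH μ := (DH.exists_of_Dir μ (a := bas 0) (by simp [Dir_bas_zero])).choose

lemma coef_oneH : coef μ (oneH μ) = bas 0 :=
  (DH.exists_of_Dir μ (a := bas 0) (by simp [Dir_bas_zero])).choose_spec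

lemma inner_kv_oneH (z : Dsc) : ⟪kv μ z, oneH μ⟫_ℂ = 1 := by
  rw [inner_kv, coef_oneH, ← inner_conj_symm, inner_bas]; simp

lemma DH.normSq_add_const {x y : DH μ} {t : ℂ} (h : coef μ y = t • bas 0) (h0 : coef μ x 0 = 0) :
    ‖x + y‖ ^ 2 = ‖x‖ ^ 2 + ‖y‖ ^ 2 := by
  have h1 : ∀ n, coef μ (x + y) (n + 1) = coef μ x (n + 1) := fun n => by
    rw [map_add, h, E2.add_apply, E2.smul_apply, bas_apply]; simp
  have h2 : Dir μ (coef μ (x + y)) = Dir μ (coef μ x) :=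
    lintegral_congr fun ζ => dz_congr_succ h1
  have h3 : ⟪coef μ x, coef μ y⟫_ℂ = 0 := by
    rw [h, inner_smul_right, ← inner_conj_symm, inner_bas, h0]; simp
  have h4 : Dir μ (coef μ y) = 0 := by
    have : ∀ ζ, dz ζ (coef μ y) = 0 := fun ζ => dz_eq_zero_of_succ fun n => by
      rw [h, E2.smul_apply, bas_apply]; simp
    simp [Dir, this]
  rw [DH.normSq, DH.normSq μ x, DH.normSq μ y, h2, map_add, sq ‖coef μ x + coef μ y‖,
    norm_add_sq_eq_norm_sq_add_norm_sq_of_inner_eq_zero _ _ h3, h4, ENNReal.toReal_zero]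
  ring

lemma inner_oneH_of_coef_zero {x : DH μ} (h0 : coef μ x 0 = 0) : ⟪x, oneH μ⟫_ℂ = 0 := by
  have h1 : ∀ t : ℂ, (t * ⟪x, oneH μ⟫_ℂ).re = 0 := fun t => by
    have h2 := DH.normSq_add_const μ (x := x) (y := t • oneH μ) (t := t)
      (by rw [map_smul, coef_oneH]) h0
    rw [@norm_add_sq ℂ, inner_smul_right] at h2
    have h3 : RCLike.re (t * ⟪x, oneH μ⟫_ℂ) = (t * ⟪x, oneH μ⟫_ℂ).re := rfl
    rw [h3] at h2
    linarith
  have h4 := h1 (conj ⟪x, oneH μ⟫_ℂ)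
  rw [← Complex.normSq_eq_conj_mul_self, Complex.ofReal_re] at h4
  exact Complex.normSq_eq_zero.1 h4

lemma norm_oneH : ‖oneH μ‖ = 1 := by
  have hn : ‖oneH μ‖ ^ 2 = 1 := by
    rw [DH.normSq, coef_oneH, Dir_bas_zero]
    simp [bas]
  have := norm_nonneg (oneH μ)
  nlinarith

lemma inner_oneH (x : DH μ) : ⟪oneH μ, x⟫_ℂ = coef μ x 0 := by
  have hk : coef μ (x - (coef μ x 0) • oneH μ) 0 = 0 := by
    rw [map_sub, map_smul, coef_oneH, E2.sub_apply, E2.smul_apply, bas_apply]; simp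
  have h1 := inner_oneH_of_coef_zero μ hk
  have h2 : ⟪oneH μ, oneH μ⟫_ℂ = 1 := by
    have : ⟪oneH μ, oneH μ⟫_ℂ = (‖oneH μ‖ : ℂ) ^ 2 := inner_self_eq_norm_sq_to_K _
    rw [this, norm_oneH]; simp
  rw [← inner_conj_symm, map_eq_zero, inner_sub_right, inner_smul_right, h2, mul_one,
    sub_eq_zero] at h1
  exact h1

lemma kv_o : kv μ o = oneH μ :=
  ext_inner_right ℂ fun x => by rw [inner_kv, inner_evec_o, inner_oneH]

lemma DH.exists_lift (A : E2 →L[ℂ] E2) {C : ℝ} (hC : 0 ≤ C)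
    (h : ∀ x : DH μ, Dir μ (A (coef μ x)) ≠ ∞ ∧
      ‖A (coef μ x)‖ ^ 2 + (Dir μ (A (coef μ x))).toReal ≤ C ^ 2 * ‖x‖ ^ 2) :
    ∃ T : DH μ →L[ℂ] DH μ, (∀ x, coef μ (T x) = A (coef μ x)) ∧ ∀ x, ‖T x‖ ≤ C * ‖x‖ := by
  choose T hT using fun x => DH.exists_of_Dir μ (h x).1
  have hn : ∀ x, ‖T x‖ ≤ C * ‖x‖ := fun x => by
    rw [← sq_le_sq₀ (norm_nonneg _) (by positivity), DH.normSq, hT, mul_pow]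
    exact (h x).2
  let T' : DH μ →ₗ[ℂ] DH μ :=
    { toFun := T
      map_add' := fun x y => coef_injective μ (by simp only [map_add, hT])
      map_smul' := fun c x => coef_injective μ (by simp only [map_smul, hT, RingHom.id_apply]) }
  exact ⟨T'.mkContinuous C hn, hT, hn⟩

omit [IsFiniteMeasure μ] in
lemma Dir_mono_of {a b : ℕ → ℂ} (h : ∀ ζ, ‖ζ‖ = 1 → dz ζ a ≤ dz ζ b) : Dir μ a ≤ Dir μ b :=
  lintegral_mono_ae ((ae_norm_eq_one μ).mono h)

omit [IsFiniteMeasure μ] in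
lemma Dir_shift_le (a : ℕ → ℂ) : Dir μ (shiftSeq a) ≤
    3 * Dir μ a + ENNReal.ofReal (2 * ‖a 0‖ ^ 2) * μ univ := by
  calc Dir μ (shiftSeq a) ≤ ∫⁻ ζ, (3 * dz ζ a + ENNReal.ofReal (2 * ‖a 0‖ ^ 2)) ∂μ :=
        lintegral_mono_ae ((ae_norm_eq_one μ).mono fun ζ hζ => dz_shift_le hζ a)
    _ = _ := by
        rw [lintegral_add_right _ measurable_const, lintegral_const,
          lintegral_const_mul _ (measurable_dz a), Dir]

lemma exists_shift : ∃ T : DH μ →L[ℂ] DH μ, ∀ x, coef μ (T x) = SE (coef μ x) := by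
  obtain ⟨T, hT, -⟩ := DH.exists_lift μ SE (C := Real.sqrt (3 + 2 * μ.real univ))
    (Real.sqrt_nonneg _) fun x => by
      have h1 := Dir_shift_le μ (coef μ x)
      have hx := Dir_coef_ne_top μ x
      have h2 : 3 * Dir μ (coef μ x) + ENNReal.ofReal (2 * ‖coef μ x 0‖ ^ 2) * μ univ ≠ ∞ :=
        ENNReal.add_ne_top.2 ⟨ENNReal.mul_ne_top (by simp) hx,
          ENNReal.mul_ne_top ENNReal.ofReal_ne_top (measure_ne_top _ _)⟩
      refine ⟨ne_top_of_le_ne_top h2 h1, ?_⟩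
      have h3 := ENNReal.toReal_mono h2 h1
      rw [ENNReal.toReal_add (ENNReal.mul_ne_top (by simp) hx)
        (ENNReal.mul_ne_top ENNReal.ofReal_ne_top (measure_ne_top _ _)), ENNReal.toReal_mul,
        ENNReal.toReal_mul, ENNReal.toReal_ofReal (by positivity)] at h3
      rw [Real.sq_sqrt (by positivity), norm_SE, DH.normSq, coe_SE]
      have h4 : ‖coef μ x 0‖ ^ 2 ≤ ‖coef μ x‖ ^ 2 := by
        gcongr; exact E2.norm_coord_le _ _
      have h5 : 0 ≤ (Dir μ (coef μ x)).toReal := ENNReal.toReal_nonneg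
      have h6 : 0 ≤ μ.real univ := measureReal_nonneg
      have h7 : (μ univ).toReal = μ.real univ := rfl
      have h8 : (3 : ℝ≥0∞).toReal = 3 := by simp
      rw [h7, h8] at h3
      nlinarith [mul_le_mul_of_nonneg_right h4 h6, mul_nonneg h6 h5, sq_nonneg ‖coef μ x‖]
  exact ⟨T, hT⟩

/-- Multiplication by `z`. -/
def TH : DH μ →L[ℂ] DH μ := (exists_shift μ).choose

lemma coef_TH (x : DH μ) : coef μ (TH μ x) = SE (coef μ x) := (exists_shift μ).choose_spec x

lemma exists_tail : ∃ T : DH μ →L[ℂ] DH μ, (∀ x, coef μ (T x) = BE (coef μ x)) ∧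
    ∀ x, ‖T x‖ ≤ 1 * ‖x‖ :=
  DH.exists_lift μ BE zero_le_one fun x => by
    have h1 : Dir μ (BE (coef μ x)) ≤ Dir μ (coef μ x) := by
      rw [coe_BE]; exact Dir_mono_of μ fun ζ hζ => dz_tail_le hζ _
    refine ⟨ne_top_of_le_ne_top (Dir_coef_ne_top μ x) h1, ?_⟩
    have h2 := ENNReal.toReal_mono (Dir_coef_ne_top μ x) h1
    have h3 : ‖BE (coef μ x)‖ ^ 2 ≤ ‖coef μ x‖ ^ 2 := by gcongr; exact norm_BE_le _
    rw [DH.normSq]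
    linarith

/-- The operator `f ↦ (f - f 0) / z`. -/
def LH : DH μ →L[ℂ] DH μ := (exists_tail μ).choose

lemma coef_LH (x : DH μ) : coef μ (LH μ x) = BE (coef μ x) := (exists_tail μ).choose_spec.1 x

lemma norm_LH_le (x : DH μ) : ‖LH μ x‖ ≤ ‖x‖ := by
  have h : ‖LH μ x‖ ≤ 1 * ‖x‖ := (exists_tail μ).choose_spec.2 x
  rwa [one_mul] at h

lemma LH_TH (x : DH μ) : LH μ (TH μ x) = x := coef_injective μ (by rw [coef_LH, coef_TH, BE_SE])

lemma TH_LH (x : DH μ) : TH μ (LH μ x) = x - (coef μ x 0) • oneH μ :=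
  coef_injective μ (by rw [coef_TH, coef_LH, SE_BE, map_sub, map_smul, coef_oneH])

lemma TH_LH_of_coef_zero {x : DH μ} (h : coef μ x 0 = 0) : TH μ (LH μ x) = x := by
  rw [TH_LH, h, zero_smul, sub_zero]

lemma norm_le_norm_TH (x : DH μ) : ‖x‖ ≤ ‖TH μ x‖ := by
  simpa [LH_TH] using norm_LH_le μ (TH μ x)

lemma inner_kv_TH (z : Dsc) (x : DH μ) : ⟪kv μ z, TH μ x⟫_ℂ = z * ⟪kv μ z, x⟫_ℂ := by
  rw [inner_kv, coef_TH, inner_evec_SE, inner_kv]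

lemma TH_concave (x : DH μ) : ‖TH μ (TH μ x)‖ ^ 2 + ‖x‖ ^ 2 ≤ 2 * ‖TH μ x‖ ^ 2 := by
  have h1 : Dir μ (coef μ (TH μ (TH μ x))) + Dir μ (coef μ x) ≤ 2 * Dir μ (coef μ (TH μ x)) := by
    rw [coef_TH, coef_TH, coe_SE, coe_SE]
    simp only [Dir]
    rw [← lintegral_add_right _ (measurable_dz _), ← lintegral_const_mul _ (measurable_dz _)]
    exact lintegral_mono_ae ((ae_norm_eq_one μ).mono fun ζ hζ => dz_shift_concave hζ _)
  have h2 := ENNReal.toReal_mono (ENNReal.mul_ne_top (by simp) (Dir_coef_ne_top μ _)) h1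
  rw [ENNReal.toReal_add (Dir_coef_ne_top μ _) (Dir_coef_ne_top μ _), ENNReal.toReal_mul] at h2
  have h8 : (2 : ℝ≥0∞).toReal = 2 := by simp
  rw [h8] at h2
  rw [DH.normSq, DH.normSq μ x, DH.normSq μ (TH μ x)]
  have h3 : ‖coef μ (TH μ (TH μ x))‖ = ‖coef μ x‖ := by simp only [coef_TH, norm_SE]
  have h4 : ‖coef μ (TH μ x)‖ = ‖coef μ x‖ := by simp only [coef_TH, norm_SE]
  rw [h3, h4]
  linarith

lemma normSq_TH_iterate_le (x : DH μ) (n : ℕ) :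
    ‖(TH μ)^[n] x‖ ^ 2 ≤ ‖x‖ ^ 2 + n * (‖TH μ x‖ ^ 2 - ‖x‖ ^ 2) := by
  have hd : ∀ n : ℕ, ‖(TH μ)^[n + 1] x‖ ^ 2 - ‖(TH μ)^[n] x‖ ^ 2 ≤ ‖TH μ x‖ ^ 2 - ‖x‖ ^ 2 := by
    intro n
    induction n with
    | zero => simp
    | succ n ih =>
      have := TH_concave μ ((TH μ)^[n] x)
      simp only [← Function.iterate_succ_apply' (TH μ)] at this
      linarith
  induction n with
  | zero => simp
  | succ n ih =>
    have := hd n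
    push_cast
    linarith

end Dirichlet

section Resolvent

lemma norm_smul_SE_lt {w : ℂ} (hw : ‖w‖ < 1) : ‖conj w • SE‖ < 1 := by
  refine (ContinuousLinearMap.opNorm_le_bound _ (norm_nonneg w) fun x => ?_).trans_lt hw
  rw [smul_apply, norm_smul, RCLike.norm_conj, norm_SE]

/-- The resolvent `(1 - w̄ S)⁻¹`. -/
def RE (w : ℂ) : E2 →L[ℂ] E2 := Ring.inverse (1 - conj w • SE)

lemma isUnit_one_sub_SE {w : ℂ} (hw : ‖w‖ < 1) : IsUnit (1 - conj w • SE) :=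
  isUnit_one_sub_of_norm_lt_one (norm_smul_SE_lt hw)

lemma RE_sub {w : ℂ} (hw : ‖w‖ < 1) (f : E2) : RE w f - conj w • SE (RE w f) = f := by
  have := congrArg (fun A : E2 →L[ℂ] E2 => A f)
    (Ring.mul_inverse_cancel _ (isUnit_one_sub_SE hw))
  simpa [RE] using this

lemma RE_apply_sub {w : ℂ} (hw : ‖w‖ < 1) (f : E2) : RE w (f - conj w • SE f) = f := by
  have := congrArg (fun A : E2 →L[ℂ] E2 => A f)
    (Ring.inverse_mul_cancel _ (isUnit_one_sub_SE hw))
  exact this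

lemma RE_eq_of {w : ℂ} (hw : ‖w‖ < 1) {f g : E2} (h : g - conj w • SE g = f) : RE w f = g := by
  rw [← h, RE_apply_sub hw]

lemma RE_SE {w : ℂ} (hw : ‖w‖ < 1) (f : E2) : RE w (SE f) = SE (RE w f) := by
  refine RE_eq_of hw ?_
  rw [← map_smul, ← map_sub, RE_sub hw]

lemma RE_bas (w : Dsc) : RE w (bas 0) = evec w := by
  refine RE_eq_of w.2 (E2.ext fun n => ?_)
  rw [E2.sub_apply, E2.smul_apply, bas_apply]
  cases n with
  | zero => simp
  | succ n => simp [pow_succ, mul_comm]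

lemma continuousAt_RE {w : ℂ} (hw : ‖w‖ < 1) : ContinuousAt RE w := by
  obtain ⟨u, hu⟩ := isUnit_one_sub_SE hw
  have h1 := NormedRing.inverse_continuousAt u
  rw [hu] at h1
  have h2 : ContinuousAt (fun w : ℂ => (1 : E2 →L[ℂ] E2) - conj w • SE) w := by
    have : Continuous fun w : ℂ => conj w := Complex.continuous_conj
    fun_prop
  exact ContinuousAt.comp (f := fun w : ℂ => (1 : E2 →L[ℂ] E2) - conj w • SE)
    (g := Ring.inverse) h1 h2

lemma one_sub_normSq_pos (w : Dsc) : 0 < 1 - ‖(w : ℂ)‖ ^ 2 := by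
  have := w.2; have := norm_nonneg (w : ℂ); nlinarith

lemma inner_evec_RE (w : Dsc) (f : E2) :
    ⟪evec w, RE w f⟫_ℂ = ⟪evec w, f⟫_ℂ / ((1 - ‖(w : ℂ)‖ ^ 2 : ℝ) : ℂ) := by
  have h0 : ((1 - ‖(w : ℂ)‖ ^ 2 : ℝ) : ℂ) ≠ 0 := by
    exact_mod_cast (one_sub_normSq_pos w).ne'
  rw [eq_div_iff h0]
  conv_rhs => rw [← RE_sub w.2 f]
  rw [inner_sub_right, inner_smul_right, inner_evec_SE, ← mul_assoc,
    ← Complex.normSq_eq_conj_mul_self, Complex.normSq_eq_norm_sq]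
  push_cast
  ring

lemma inner_evec_evec (w : Dsc) : ⟪evec w, evec w⟫_ℂ = 1 / ((1 - ‖(w : ℂ)‖ ^ 2 : ℝ) : ℂ) := by
  have h := inner_evec_RE w (bas 0)
  rw [RE_bas, ← inner_conj_symm (evec w) (bas 0), inner_bas] at h
  simpa using h

/-- The quadratic form approximating the local Dirichlet integral. -/
def Qf (w : ℂ) (f : E2) : ℝ :=
  ‖RE w f‖ ^ 2 - (1 - ‖w‖ ^ 2) * ‖⟪RE w (bas 0), RE w f⟫_ℂ‖ ^ 2

lemma normSq_RE_sub (w : Dsc) (f : E2) (c : ℂ) :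
    ‖RE w f - c • evec w‖ ^ 2 = Qf w f + ‖c - ⟪evec w, f⟫_ℂ‖ ^ 2 / (1 - ‖(w : ℂ)‖ ^ 2) := by
  have hw := (one_sub_normSq_pos w).ne'
  rw [@norm_sub_sq ℂ, inner_smul_right, ← inner_conj_symm, norm_smul, mul_pow]
  have h1 : ‖evec w‖ ^ 2 = 1 / (1 - ‖(w : ℂ)‖ ^ 2) := by
    have h := inner_evec_evec w
    have h' : ⟪evec w, evec w⟫_ℂ = (‖evec w‖ : ℂ) ^ 2 := inner_self_eq_norm_sq_to_K _
    rw [h'] at h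
    exact_mod_cast h
  rw [h1, Qf, RE_bas, inner_evec_RE, norm_div, Complex.norm_real, Real.norm_of_nonneg
    (one_sub_normSq_pos w).le]
  set t := 1 - ‖(w : ℂ)‖ ^ 2
  set b := ⟪evec w, f⟫_ℂ
  have h2 : RCLike.re (c * conj (b / (t : ℂ))) = (c * conj b).re / t := by
    rw [map_div₀, Complex.conj_ofReal, ← mul_div_assoc]
    exact Complex.div_ofReal_re _ _
  rw [h2]
  have h3 : ‖c - b‖ ^ 2 = ‖c‖ ^ 2 - 2 * (c * conj b).re + ‖b‖ ^ 2 := by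
    simp only [← Complex.normSq_eq_norm_sq]
    rw [Complex.normSq_sub]; ring
  rw [h3]
  field_simp
  ring

lemma Qf_le (w : Dsc) (f : E2) (c : ℂ) : Qf w f ≤ ‖RE w f - c • evec w‖ ^ 2 := by
  rw [normSq_RE_sub]
  have : 0 ≤ ‖c - ⟪evec w, f⟫_ℂ‖ ^ 2 / (1 - ‖(w : ℂ)‖ ^ 2) :=
    div_nonneg (by positivity) (one_sub_normSq_pos w).le
  linarith

lemma Qf_eq (w : Dsc) (f : E2) : Qf w f = ‖RE w f - ⟪evec w, f⟫_ℂ • evec w‖ ^ 2 := by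
  rw [normSq_RE_sub]; simp

lemma Qf_nonneg (w : Dsc) (f : E2) : 0 ≤ Qf w f := by rw [Qf_eq]; positivity

lemma sum_normSq_sub_mul_ge (s : Finset ℕ) (u v : ℕ → ℂ) (c : ℂ)
    (hv : 0 < ∑ j ∈ s, ‖v j‖ ^ 2) :
    ∑ j ∈ s, ‖u j‖ ^ 2 - ‖∑ j ∈ s, conj (v j) * u j‖ ^ 2 / ∑ j ∈ s, ‖v j‖ ^ 2 ≤
      ∑ j ∈ s, ‖u j - c * v j‖ ^ 2 := by
  have h1 : ∀ j, ‖u j - c * v j‖ ^ 2 =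
      ‖u j‖ ^ 2 - 2 * (conj c * (conj (v j) * u j)).re + ‖c‖ ^ 2 * ‖v j‖ ^ 2 := by
    intro j
    simp only [← Complex.normSq_eq_norm_sq]
    rw [Complex.normSq_sub, Complex.normSq_mul, map_mul]
    rw [show u j * (conj c * conj (v j)) = conj c * (conj (v j) * u j) by ring]; ring
  simp only [h1]
  rw [Finset.sum_add_distrib, Finset.sum_sub_distrib, ← Finset.mul_sum, ← Complex.re_sum,
    ← Finset.mul_sum, ← Finset.mul_sum]
  set V := ∑ j ∈ s, ‖v j‖ ^ 2
  set B := ∑ j ∈ s, conj (v j) * u j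
  have h2 : (conj c * B).re ≤ ‖c‖ * ‖B‖ := by
    refine (Complex.re_le_norm _).trans (le_of_eq ?_)
    rw [norm_mul, RCLike.norm_conj]
  have h3 : 0 ≤ (‖B‖ - ‖c‖ * V) ^ 2 / V := by positivity
  have h4 : (‖B‖ - ‖c‖ * V) ^ 2 / V = ‖B‖ ^ 2 / V - 2 * (‖c‖ * ‖B‖) + ‖c‖ ^ 2 * V := by
    field_simp
    ring
  linarith

/-- Coefficients of the resolvent. -/
def ucoef (w : ℂ) (a : ℕ → ℂ) (j : ℕ) : ℂ := ∑ i ∈ Finset.range (j + 1), conj w ^ (j - i) * a i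

lemma RE_apply {w : ℂ} (hw : ‖w‖ < 1) (a : E2) (j : ℕ) : RE w a j = ucoef w a j := by
  have h : ∀ n, RE w a n - conj w * SE (RE w a) n = a n := fun n => by
    conv_rhs => rw [← RE_sub hw a]
    rfl
  induction j with
  | zero =>
    have := h 0
    simpa [ucoef] using this
  | succ j ih =>
    have := h (j + 1)
    rw [SE_succ, ih, sub_eq_iff_eq_add] at this
    have h2 : ucoef w a (j + 1) = conj w * ucoef w a j + a (j + 1) := by
      rw [ucoef, ucoef, Finset.sum_range_succ _ (j + 1), Finset.mul_sum, Nat.sub_self, pow_zero,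
        one_mul]
      congr 1
      refine Finset.sum_congr rfl fun i hi => ?_
      rw [Nat.succ_sub (by simpa [Nat.lt_succ_iff] using hi), pow_succ]
      ring
    rw [this, h2, add_comm (a (j + 1))]

/-- Lower bounds for `Qf` depending on finitely many coefficients. -/
def qK (K : ℕ) (w : ℂ) (a : ℕ → ℂ) : ℝ :=
  ∑ j ∈ Finset.range (K + 1), ‖ucoef w a j‖ ^ 2 -
    ‖∑ j ∈ Finset.range (K + 1), conj (conj w ^ j) * ucoef w a j‖ ^ 2 /
      ∑ j ∈ Finset.range (K + 1), ‖conj w ^ j‖ ^ 2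

lemma sum_normSq_pow_pos (K : ℕ) (w : ℂ) :
    0 < ∑ j ∈ Finset.range (K + 1), ‖conj w ^ j‖ ^ 2 := by
  rw [Finset.sum_range_succ']
  have : 0 ≤ ∑ k ∈ Finset.range K, ‖conj w ^ (k + 1)‖ ^ 2 :=
    Finset.sum_nonneg fun _ _ => by positivity
  simp only [pow_zero, norm_one, one_pow]
  linarith

lemma qK_le_Qf (K : ℕ) (w : Dsc) (a : E2) : qK K w a ≤ Qf w a := by
  rw [Qf_eq]
  refine (sum_normSq_sub_mul_ge _ _ _ ⟪evec w, a⟫_ℂ (sum_normSq_pow_pos K w)).trans ?_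
  refine le_trans (le_of_eq ?_) (E2.sum_le _ (Finset.range (K + 1)))
  refine Finset.sum_congr rfl fun j _ => ?_
  rw [E2.sub_apply, E2.smul_apply, RE_apply w.2, evec_apply]

lemma ucoef_circle {ζ : ℂ} (hζ : ‖ζ‖ = 1) (a : ℕ → ℂ) (j : ℕ) :
    ucoef ζ a j = conj ζ ^ j * psum ζ a j := by
  have h : conj ζ * ζ = 1 := by
    rw [← Complex.normSq_eq_conj_mul_self, Complex.normSq_eq_norm_sq, hζ]; simp
  rw [ucoef, psum, Finset.mul_sum]
  refine Finset.sum_congr rfl fun i hi => ?_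
  have hi' : i ≤ j := by simpa [Nat.lt_succ_iff] using hi
  calc conj ζ ^ (j - i) * a i = conj ζ ^ (j - i) * (conj ζ * ζ) ^ i * a i := by rw [h]; simp
    _ = (conj ζ ^ (j - i) * conj ζ ^ i) * (a i * ζ ^ i) := by rw [mul_pow]; ring
    _ = _ := by rw [← pow_add, Nat.sub_add_cancel hi']

lemma qK_circle {ζ : ℂ} (hζ : ‖ζ‖ = 1) (K : ℕ) (a : ℕ → ℂ) : qK K ζ a = dK K ζ a := by
  have h : ζ * conj ζ = 1 := by
    rw [mul_comm, ← Complex.normSq_eq_conj_mul_self, Complex.normSq_eq_norm_sq, hζ]; simp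
  have h1 : ∀ j, conj (conj ζ ^ j) * (conj ζ ^ j * psum ζ a j) = psum ζ a j := fun j => by
    rw [map_pow, Complex.conj_conj, ← mul_assoc, ← mul_pow, h, one_pow, one_mul]
  simp only [qK, dK, ucoef_circle hζ, h1, norm_mul, norm_pow, RCLike.norm_conj, hζ, one_pow,
    one_mul, Finset.sum_const, Finset.card_range, nsmul_eq_mul, mul_one]
  push_cast
  rfl

lemma tendsto_qK {ι : Type*} {l : Filter ι} {w : ι → ℂ} {a : ι → ℕ → ℂ} {ζ : ℂ} {b : ℕ → ℂ}
    (hw : Tendsto w l (𝓝 ζ)) (ha : ∀ n, Tendsto (fun i => a i n) l (𝓝 (b n))) (K : ℕ) :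
    Tendsto (fun i => qK K (w i) (a i)) l (𝓝 (qK K ζ b)) := by
  have hc : Tendsto (fun i => conj (w i)) l (𝓝 (conj ζ)) :=
    (Complex.continuous_conj.tendsto _).comp hw
  have hu : ∀ j, Tendsto (fun i => ucoef (w i) (a i) j) l (𝓝 (ucoef ζ b j)) := fun j =>
    tendsto_finsetSum _ fun i _ => (hc.pow _).mul (ha i)
  refine Tendsto.sub (tendsto_finsetSum _ fun j _ => (hu j).norm.pow 2) (Tendsto.div ?_ ?_
    (sum_normSq_pow_pos K ζ).ne')
  · exact (tendsto_finsetSum _ fun j _ =>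
      ((Complex.continuous_conj.tendsto _).comp (hc.pow j)).mul (hu j)).norm.pow 2
  · exact tendsto_finsetSum _ fun j _ => (hc.pow j).norm.pow 2

lemma eq_of_rep {ζ c : ℂ} (hζ : ‖ζ‖ = 1) {a g : E2} (h : ∀ j, psum ζ a j = c + ζ ^ j * g j) :
    a = c • bas 0 + (g - conj ζ • SE g) := by
  have hz : conj ζ * ζ = 1 := by
    rw [← Complex.normSq_eq_conj_mul_self, Complex.normSq_eq_norm_sq, hζ]; simp
  have hζ0 : ζ ≠ 0 := by rintro rfl; simp at hζ
  refine E2.ext fun n => ?_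
  rw [E2.add_apply, E2.sub_apply, E2.smul_apply, E2.smul_apply, bas_apply]
  cases n with
  | zero => simpa [psum] using h 0
  | succ n =>
    have h1 : psum ζ a (n + 1) = psum ζ a n + a (n + 1) * ζ ^ (n + 1) := by
      simp only [psum]; rw [Finset.sum_range_succ]
    rw [h, h] at h1
    have h2 : a (n + 1) * ζ ^ (n + 1) = (g (n + 1) - conj ζ * g n) * ζ ^ (n + 1) := by
      linear_combination -h1 + ζ ^ n * g n * hz
    simpa using mul_right_cancel₀ (pow_ne_zero _ hζ0) h2

lemma rep_of_eq {ζ c : ℂ} (hζ : ‖ζ‖ = 1) {a g : E2}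
    (h : a = c • bas 0 + (g - conj ζ • SE g)) (j : ℕ) : psum ζ a j = c + ζ ^ j * g j := by
  have hz : conj ζ * ζ = 1 := by
    rw [← Complex.normSq_eq_conj_mul_self, Complex.normSq_eq_norm_sq, hζ]; simp
  have h' : ∀ n, a n = c * (if n = 0 then 1 else 0) + (g n - conj ζ * SE g n) := fun n => by
    rw [h, E2.add_apply, E2.sub_apply, E2.smul_apply, E2.smul_apply, bas_apply]
  induction j with
  | zero => simp [psum, h']
  | succ n ih =>
    have h1 : psum ζ a (n + 1) = psum ζ a n + a (n + 1) * ζ ^ (n + 1) := by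
      simp only [psum]; rw [Finset.sum_range_succ]
    rw [h1, ih, h' (n + 1), SE_succ]
    simp only [Nat.succ_ne_zero, if_false, mul_zero, zero_add]
    linear_combination -ζ ^ n * g n * hz

lemma norm_sub_smul_SE_le {ζ : ℂ} (hζ : ‖ζ‖ = 1) {r : ℝ} (hr0 : 0 ≤ r) (v : E2) :
    ‖v - conj ζ • SE v‖ ≤ 2 / (1 + r) * ‖v - conj ((r : ℂ) * ζ) • SE v‖ := by
  obtain ⟨u, hu⟩ : ∃ u, u = conj ζ • SE v := ⟨_, rfl⟩
  have hnu : ‖u‖ = ‖v‖ := by rw [hu, norm_smul, RCLike.norm_conj, hζ, one_mul, norm_SE]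
  have h1 : conj ((r : ℂ) * ζ) • SE v = (r : ℂ) • u := by
    rw [map_mul, Complex.conj_ofReal, mul_smul, hu]
  rw [h1, ← hu, ← sq_le_sq₀ (norm_nonneg _) (by positivity), mul_pow, div_pow,
    div_mul_eq_mul_div, le_div_iff₀ (by positivity), @norm_sub_sq ℂ, @norm_sub_sq ℂ,
    inner_smul_right, norm_smul, hnu]
  have h2 : RCLike.re ((r : ℂ) * ⟪v, u⟫_ℂ) = r * RCLike.re ⟪v, u⟫_ℂ := Complex.re_ofReal_mul _ _
  rw [h2, Complex.norm_real, Real.norm_of_nonneg hr0]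
  have h3 : -(‖v‖ ^ 2) ≤ RCLike.re ⟪v, u⟫_ℂ := by
    have := (abs_le.1 ((RCLike.abs_re_le_norm _).trans (norm_inner_le_norm (𝕜 := ℂ) v u))).1
    rw [hnu] at this
    linarith
  nlinarith [mul_nonneg (sq_nonneg (1 - r)) (by linarith : 0 ≤ ‖v‖ ^ 2 + RCLike.re ⟪v, u⟫_ℂ)]

lemma Qf_le_dz {ζ : ℂ} (hζ : ‖ζ‖ = 1) {r : ℝ} (hr0 : 0 ≤ r) (hr1 : r < 1) (a : E2) :
    ENNReal.ofReal (Qf ((r : ℂ) * ζ) a) ≤ ENNReal.ofReal ((2 / (1 + r)) ^ 2) * dz ζ a := by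
  by_cases h : dz ζ a = ∞
  · rw [h, ENNReal.mul_top]
    · exact le_top
    · rw [Ne, ENNReal.ofReal_eq_zero, not_le]; positivity
  obtain ⟨c, g, hg, hrep⟩ := exists_rep_of_dz_ne_top hζ h
  have hw : ‖(r : ℂ) * ζ‖ < 1 := by
    rw [norm_mul, hζ, Complex.norm_real, Real.norm_of_nonneg hr0]; simpa
  set w : Dsc := ⟨(r : ℂ) * ζ, hw⟩ with hwd
  have h1 : RE w a = c • evec w + (RE w g - conj ζ • SE (RE w g)) := by
    conv_lhs => rw [eq_of_rep hζ hrep]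
    rw [map_add, map_sub, map_smul, map_smul, RE_bas, RE_SE w.2]
  have h2 : Qf w a ≤ (2 / (1 + r)) ^ 2 * ‖g‖ ^ 2 := by
    refine (Qf_le w a c).trans ?_
    rw [h1, add_sub_cancel_left, ← mul_pow]
    have := norm_sub_smul_SE_le hζ hr0 (RE w g)
    have h3 : RE (w : ℂ) g - conj ((r : ℂ) * ζ) • SE (RE w g) = g := RE_sub w.2 g
    rw [h3] at this
    gcongr
  calc ENNReal.ofReal (Qf w a) ≤ ENNReal.ofReal ((2 / (1 + r)) ^ 2 * (dz ζ a).toReal) :=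
        ENNReal.ofReal_le_ofReal (h2.trans (by gcongr))
    _ = _ := by rw [ENNReal.ofReal_mul (by positivity), ENNReal.ofReal_toReal h]

end Resolvent

section Approximants

/-- Self-adjoint operators bounded below by the identity. -/
def Good (A : E2 →L[ℂ] E2) : Prop :=
  (∀ x y, ⟪A x, y⟫_ℂ = ⟪x, A y⟫_ℂ) ∧ ∀ x, ‖x‖ ^ 2 ≤ (⟪x, A x⟫_ℂ).re

variable {A : E2 →L[ℂ] E2}

lemma Good.isUnit (h : Good A) : IsUnit A := by
  refine ContinuousLinearMap.isUnit_of_forall_le_norm_inner_map A (c := 1) one_pos fun x => ?_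
  rw [NNReal.coe_one, mul_one, h.1]
  exact (h.2 x).trans (Complex.re_le_norm _)

lemma Good.apply_inverse (h : Good A) (x : E2) : A (Ring.inverse A x) = x :=
  congrArg (fun B : E2 →L[ℂ] E2 => B x) (Ring.mul_inverse_cancel _ h.isUnit)

lemma Good.inverse_apply (h : Good A) (x : E2) : Ring.inverse A (A x) = x :=
  congrArg (fun B : E2 →L[ℂ] E2 => B x) (Ring.inverse_mul_cancel _ h.isUnit)

lemma Good.inverse_eq (h : Good A) {x y : E2} (hx : A x = y) : Ring.inverse A y = x := by
  rw [← hx, h.inverse_apply]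

lemma Good.inner_inverse (h : Good A) (x y : E2) :
    ⟪Ring.inverse A x, y⟫_ℂ = ⟪x, Ring.inverse A y⟫_ℂ := by
  conv_lhs => rw [← h.apply_inverse y]
  rw [← h.1, h.apply_inverse]

lemma Good.normSq_inverse_le (h : Good A) (x : E2) :
    ‖Ring.inverse A x‖ ^ 2 ≤ (⟪x, Ring.inverse A x⟫_ℂ).re := by
  have := h.2 (Ring.inverse A x)
  rwa [h.apply_inverse, h.inner_inverse] at this

lemma Good.norm_inverse_le (h : Good A) (x : E2) : ‖Ring.inverse A x‖ ≤ ‖x‖ := by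
  have h1 := (h.normSq_inverse_le x).trans ((Complex.re_le_norm _).trans (norm_inner_le_norm _ _))
  rw [sq] at h1
  by_cases h0 : ‖Ring.inverse A x‖ = 0
  · rw [h0]; exact norm_nonneg _
  · exact le_of_mul_le_mul_right h1 (lt_of_le_of_ne (norm_nonneg _) (Ne.symm h0))

/-- The reproducing kernel of the Hilbert space with Gram operator `A`. -/
def kA (A : E2 →L[ℂ] E2) (z u : Dsc) : ℂ := ⟪evec z, Ring.inverse A (evec u)⟫_ℂ

lemma Good.psd (h : Good A) : PSD (kA A) := by
  refine ⟨fun x y => ?_, fun s c => ?_⟩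
  · rw [kA, kA, inner_conj_symm, h.inner_inverse]
  · have h1 : ∑ i ∈ s, ∑ j ∈ s, conj (c i) * kA A i j * c j =
        ⟪∑ i ∈ s, c i • evec i, Ring.inverse A (∑ i ∈ s, c i • evec i)⟫_ℂ := by
      rw [map_sum, sum_inner]
      refine Finset.sum_congr rfl fun i _ => ?_
      rw [inner_sum]
      refine Finset.sum_congr rfl fun j _ => ?_
      rw [map_smul, inner_smul_left, inner_smul_right, kA]; ring
    rw [h1]
    exact (sq_nonneg _).trans (h.normSq_inverse_le _)

lemma evec_ne_zero (z : Dsc) : evec z ≠ 0 := fun h => by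
  have h1 : evec z 0 = (0 : E2) 0 := by rw [h]
  rw [evec_apply] at h1
  simp at h1

lemma Good.normSq_kappa_pos (h : Good A) (z : Dsc) : 0 < ‖Ring.inverse A (evec z)‖ ^ 2 := by
  have : Ring.inverse A (evec z) ≠ 0 := fun h0 => evec_ne_zero z <| by
    rw [← h.apply_inverse (evec z), h0, map_zero]
  positivity

lemma Good.diag_pos (h : Good A) (z : Dsc) : 0 < (kA A z z).re :=
  (h.normSq_kappa_pos z).trans_le (h.normSq_inverse_le _)

lemma exists_smul_bas_of_BE_eq_zero {x : E2} (h : BE x = 0) : x = x 0 • bas 0 := by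
  refine E2.ext fun n => ?_
  rw [E2.smul_apply, bas_apply]
  cases n with
  | zero => simp
  | succ n =>
    have h1 : BE x n = (0 : E2) n := by rw [h]
    rw [BE_apply] at h1
    rw [h1]
    simp

lemma Good.cnp_of_BE_SE (h : Good A) (hA : ∀ x, BE (A (SE x)) = A x) : CNP (kA A) := by
  have hpos := h.diag_pos o
  have hdiag := h.psd.diag_eq o
  set K := (kA A o o).re with hK
  have h0 : (K : ℂ) ≠ 0 := by exact_mod_cast hpos.ne'
  have key : ∀ z u : Dsc, kA A z u * (1 - z * conj (u : ℂ)) = kA A z o * kA A o u / K := by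
    intro z u
    set κ := Ring.inverse A (evec u) with hκ
    have h1 : BE (A (κ - conj (u : ℂ) • SE κ)) = 0 := by
      rw [map_sub, map_sub, map_smul, map_smul, hA, hκ, h.apply_inverse, BE_evec, sub_self]
    have h2 := exists_smul_bas_of_BE_eq_zero h1
    obtain ⟨l, hl⟩ : ∃ l : ℂ, A (κ - conj (u : ℂ) • SE κ) = l • bas 0 := ⟨_, h2⟩
    have h3 := h.inverse_eq hl
    rw [map_smul, ← evec_o] at h3
    have h4 : ∀ x : Dsc, kA A x u * (1 - x * conj (u : ℂ)) = l * kA A x o := fun x => by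
      have := congrArg (fun y => ⟪evec x, y⟫_ℂ) h3
      simp only [inner_smul_right, inner_sub_right, inner_evec_SE] at this
      rw [kA, kA, this, ← hκ]
      ring
    have h5 := h4 o
    rw [o_val, zero_mul, sub_zero, mul_one, hdiag] at h5
    rw [h4, h5]
    field_simp
  have hne : ∀ z, kA A z o ≠ 0 := fun z hz => by
    have h1 := key z z
    rw [hz, zero_mul, zero_div, mul_eq_zero, h.psd.diag_eq z, Complex.mul_conj,
      Complex.normSq_eq_norm_sq] at h1
    rcases h1 with h1 | h1
    · exact (h.diag_pos z).ne' (by exact_mod_cast h1)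
    · exact (one_sub_normSq_pos z).ne' (by exact_mod_cast h1)
  have hs : (Real.sqrt K : ℂ) ≠ 0 := by exact_mod_cast (Real.sqrt_pos.2 hpos).ne'
  refine ⟨fun z => kA A z o / Real.sqrt K, fun z u => z * conj (u : ℂ),
    PSD.rankOne fun z : Dsc => (z : ℂ), fun z => div_ne_zero (hne z) hs, fun z u => ?_⟩
  rw [key, map_div₀, Complex.conj_ofReal, h.psd.1 u o, div_mul_div_comm,
    ← Complex.ofReal_mul, Real.mul_self_sqrt hpos.le]

/-- Rank one operator `f ↦ ⟪e, f⟫ • e`. -/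
def rk (e : E2) : E2 →L[ℂ] E2 := InnerProductSpace.rankOne ℂ e e

lemma rk_apply (e f : E2) : rk e f = ⟪e, f⟫_ℂ • e := InnerProductSpace.rankOne_apply _ _ _

lemma inner_rk_comm (e x y : E2) : ⟪rk e x, y⟫_ℂ = ⟪x, rk e y⟫_ℂ := by
  rw [rk_apply, rk_apply, inner_smul_left, inner_smul_right, inner_conj_symm]; ring

lemma inner_rk (e x : E2) : ⟪x, rk e x⟫_ℂ = ((‖⟪e, x⟫_ℂ‖ ^ 2 : ℝ) : ℂ) := by
  rw [rk_apply, inner_smul_right, ← inner_conj_symm, Complex.conj_mul', inner_conj_symm,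
    ← inner_conj_symm, RCLike.norm_conj]
  push_cast
  rfl

lemma Good.cnp_sub_rk (h : Good A) (hc : CNP (kA A)) {c : ℝ} (h0 : 0 ≤ c) (w : Dsc)
    (h' : Good (A - (c : ℂ) • rk (evec w))) : CNP (kA (A - (c : ℂ) • rk (evec w))) := by
  have hd := h.psd.diag_eq w
  have hpos := h.diag_pos w
  set K := (kA A w w).re
  set κ := Ring.inverse A (evec w) with hκ
  have hA' : ∀ x, (A - (c : ℂ) • rk (evec w)) x = A x - (c : ℂ) • ⟪evec w, x⟫_ℂ • evec w :=
    fun x => by rw [sub_apply, smul_apply, rk_apply]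
  have hK : c * K < 1 := by
    have h1 : ⟪κ, (A - (c : ℂ) • rk (evec w)) κ⟫_ℂ = ((K - c * K ^ 2 : ℝ) : ℂ) := by
      have h2 : ⟪evec w, κ⟫_ℂ = K := hd
      rw [hA', hκ, h.apply_inverse, ← hκ, inner_sub_right, inner_smul_right, inner_smul_right,
        ← inner_conj_symm κ, h2, Complex.conj_ofReal]
      push_cast
      ring
    have h2 := (h.normSq_kappa_pos w).trans_le (h'.2 κ)
    rw [h1, Complex.ofReal_re] at h2
    nlinarith
  have hK' : (1 - c * K : ℂ) ≠ 0 := by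
    have : (1 - c * K : ℝ) ≠ 0 := by linarith
    exact_mod_cast this
  have hker : ∀ z u, kA (A - (c : ℂ) • rk (evec w)) z u =
      kA A z u + ((c / (1 - c * K) : ℝ) : ℂ) * (kA A z w * kA A w u) := by
    intro z u
    have h1 : Ring.inverse (A - (c : ℂ) • rk (evec w)) (evec u) = Ring.inverse A (evec u) +
        ((c / (1 - c * K) : ℂ) * kA A w u) • κ := by
      refine h'.inverse_eq ?_
      have h2 : ⟪evec w, κ⟫_ℂ = K := hd
      have h3 : ⟪evec w, Ring.inverse A (evec u)⟫_ℂ = kA A w u := rfl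
      rw [hA', map_add, map_smul, h.apply_inverse, hκ, h.apply_inverse, ← hκ, inner_add_right,
        inner_smul_right, h2, h3, smul_smul, add_sub_assoc, ← sub_smul, add_eq_left]
      convert zero_smul ℂ (evec w) using 2
      field_simp
      ring
    rw [kA, h1, inner_add_right, inner_smul_right, ← kA, hκ, ← kA]
    push_cast
    ring
  have := hc.update h.psd w (t := c / (1 - c * K)) (div_nonneg h0 (by linarith))
  convert this using 1
  funext z u
  exact hker z u

/-- The positive operator with quadratic form `Qf w`. -/
def Qop (w : ℂ) : E2 →L[ℂ] E2 :=
  ContinuousLinearMap.adjoint (RE w) ∘L RE w -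
    ((1 / (1 - ‖w‖ ^ 2) : ℝ) : ℂ) • rk (RE w (bas 0))

lemma inner_Qop (w : Dsc) (f : E2) : ⟪f, Qop w f⟫_ℂ = (Qf w f : ℂ) := by
  have hp := one_sub_normSq_pos w
  have h1 : ⟪RE w f, RE w f⟫_ℂ = (‖RE w f‖ : ℂ) ^ 2 := inner_self_eq_norm_sq_to_K _
  rw [Qop, sub_apply, smul_apply, inner_sub_right, inner_smul_right, inner_rk,
    ContinuousLinearMap.comp_apply, ContinuousLinearMap.adjoint_inner_right, h1, Qf, RE_bas,
    inner_evec_RE, norm_div, Complex.norm_real, Real.norm_of_nonneg hp.le]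
  norm_cast
  field_simp

lemma Qop_bas (w : Dsc) : Qop w (bas 0) = 0 := by
  refine ext_inner_left ℂ fun f => ?_
  rw [inner_zero_right, Qop, sub_apply, smul_apply, inner_sub_right, inner_smul_right, rk_apply,
    inner_smul_right, ContinuousLinearMap.comp_apply, ContinuousLinearMap.adjoint_inner_right,
    RE_bas, ← inner_conj_symm (RE (w : ℂ) f), inner_evec_RE, ← inner_conj_symm (evec w) (bas 0),
    inner_bas, evec_apply, map_div₀, Complex.conj_ofReal, inner_conj_symm]
  push_cast
  simp
  ring

lemma continuous_rk : Continuous rk := by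
  have h := (ContinuousLinearMap.smulRightL ℂ E2 E2).continuous₂.comp
    ((innerSL ℂ (E := E2)).continuous.prodMk continuous_id)
  refine h.congr fun e => ?_
  ext1 f
  rw [rk_apply]
  rfl

lemma continuousAt_Qop {w : ℂ} (hw : ‖w‖ < 1) : ContinuousAt Qop w := by
  have h1 := continuousAt_RE hw
  have h2 : ContinuousAt (fun w => ContinuousLinearMap.adjoint (RE w)) w :=
    ContinuousLinearMap.adjoint.continuous.continuousAt.comp h1
  have h3 : ContinuousAt (fun w => RE w (bas 0)) w := h1.clm_apply continuousAt_const
  have h4 : ContinuousAt (fun w => rk (RE w (bas 0))) w :=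
    continuous_rk.continuousAt.comp h3
  have h5 : (1 - ‖w‖ ^ 2 : ℝ) ≠ 0 := (one_sub_normSq_pos ⟨w, hw⟩).ne'
  have h6 : ContinuousAt (fun w : ℂ => ((1 / (1 - ‖w‖ ^ 2) : ℝ) : ℂ)) w :=
    Complex.continuous_ofReal.continuousAt.comp
      (continuousAt_const.div (by fun_prop) h5)
  have h7 := h2.clm_comp h1
  have h8 := h6.smul h4
  exact h7.sub h8

lemma re_inner_sum_smul {ι : Type*} (s : Finset ι) (c : ι → ℝ) (B : ι → E2 →L[ℂ] E2) (x : E2) :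
    (⟪x, (∑ i ∈ s, (c i : ℂ) • B i) x⟫_ℂ).re = ∑ i ∈ s, c i * (⟪x, B i x⟫_ℂ).re := by
  rw [sum_apply, inner_sum, Complex.re_sum]
  refine Finset.sum_congr rfl fun i _ => ?_
  rw [smul_apply, inner_smul_right, Complex.re_ofReal_mul]

lemma inner_sum_smul_comm {ι : Type*} (s : Finset ι) (c : ι → ℝ) (B : ι → E2 →L[ℂ] E2)
    (h : ∀ i x y, ⟪B i x, y⟫_ℂ = ⟪x, B i y⟫_ℂ) (x y : E2) :
    ⟪(∑ i ∈ s, (c i : ℂ) • B i) x, y⟫_ℂ = ⟪x, (∑ i ∈ s, (c i : ℂ) • B i) y⟫_ℂ := by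
  rw [sum_apply, sum_apply, inner_sum, sum_inner]
  refine Finset.sum_congr rfl fun i _ => ?_
  rw [smul_apply, smul_apply, inner_smul_right, inner_smul_left, Complex.conj_ofReal, h]

lemma re_inner_adjoint_comp (w : ℂ) (f : E2) :
    (⟪f, (ContinuousLinearMap.adjoint (RE w) ∘L RE w) f⟫_ℂ).re = ‖RE w f‖ ^ 2 := by
  have h1 : ⟪RE w f, RE w f⟫_ℂ = (‖RE w f‖ : ℂ) ^ 2 := inner_self_eq_norm_sq_to_K _
  rw [ContinuousLinearMap.comp_apply, ContinuousLinearMap.adjoint_inner_right, h1]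
  norm_cast

lemma re_inner_self (f : E2) : (⟪f, f⟫_ℂ).re = ‖f‖ ^ 2 := by
  have h1 : ⟪f, f⟫_ℂ = (‖f‖ : ℂ) ^ 2 := inner_self_eq_norm_sq_to_K _
  rw [h1]
  norm_cast

lemma normSq_evec_div_le (w : Dsc) (f : E2) :
    1 / (1 - ‖(w : ℂ)‖ ^ 2) * ‖⟪evec w, f⟫_ℂ‖ ^ 2 ≤ ‖RE w f‖ ^ 2 := by
  have h := Qf_nonneg w f
  have hp := one_sub_normSq_pos w
  rw [Qf, RE_bas, inner_evec_RE, norm_div, Complex.norm_real, Real.norm_of_nonneg hp.le] at h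
  have h2 : (1 - ‖(w : ℂ)‖ ^ 2) * (‖⟪evec w, f⟫_ℂ‖ / (1 - ‖(w : ℂ)‖ ^ 2)) ^ 2 =
    1 / (1 - ‖(w : ℂ)‖ ^ 2) * ‖⟪evec w, f⟫_ℂ‖ ^ 2 := by field_simp
  linarith

section FiniteSum

variable {ι : Type*} [Fintype ι] (c : ι → ℝ) (w : ι → Dsc)

/-- Partially updated Gram operators. -/
def partA (s : Finset ι) : E2 →L[ℂ] E2 :=
  1 + ∑ i, (c i : ℂ) • (ContinuousLinearMap.adjoint (RE (w i)) ∘L RE (w i)) -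
    ∑ i ∈ s, ((c i * (1 / (1 - ‖(w i : ℂ)‖ ^ 2)) : ℝ) : ℂ) • rk (evec (w i))

lemma good_partA (hc : ∀ i, 0 ≤ c i) (s : Finset ι) : Good (partA c w s) := by
  refine ⟨fun x y => ?_, fun x => ?_⟩
  · rw [partA, sub_apply, sub_apply, add_apply, add_apply, inner_sub_left, inner_sub_right,
      inner_add_left, inner_add_right, inner_sum_smul_comm _ _ _ fun i => inner_rk_comm _,
      inner_sum_smul_comm _ _ _ fun i x y => ?_]
    · rfl
    · simp only [ContinuousLinearMap.comp_apply, ContinuousLinearMap.adjoint_inner_right,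
        ContinuousLinearMap.adjoint_inner_left]
  · rw [partA, sub_apply, add_apply, inner_sub_right, inner_add_right, Complex.sub_re,
      Complex.add_re, re_inner_sum_smul, re_inner_sum_smul, one_apply_eq_self,
      re_inner_self]
    have h1 : ∑ i ∈ s, c i * (1 / (1 - ‖(w i : ℂ)‖ ^ 2)) * (⟪x, rk (evec (w i)) x⟫_ℂ).re ≤
        ∑ i, c i * (⟪x, (ContinuousLinearMap.adjoint (RE (w i)) ∘L RE (w i)) x⟫_ℂ).re := by
      refine (Finset.sum_le_sum (g := fun i => c i * (⟪x, (ContinuousLinearMap.adjoint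
        (RE (w i)) ∘L RE (w i)) x⟫_ℂ).re) fun i _ => ?_).trans
        (Finset.sum_le_sum_of_subset_of_nonneg (Finset.subset_univ s) fun i _ _ => ?_)
      · rw [re_inner_adjoint_comp, inner_rk, Complex.ofReal_re, mul_assoc]
        exact mul_le_mul_of_nonneg_left (normSq_evec_div_le _ _) (hc i)
      · rw [re_inner_adjoint_comp]
        exact mul_nonneg (hc i) (sq_nonneg _)
    linarith

lemma cnp_partA (hc : ∀ i, 0 ≤ c i) (s : Finset ι) : CNP (kA (partA c w s)) := by
  classical
  induction s using Finset.induction_on with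
  | empty =>
    refine (good_partA c w hc ∅).cnp_of_BE_SE fun x => ?_
    rw [partA, Finset.sum_empty, sub_zero, add_apply, add_apply, sum_apply, sum_apply, map_add,
      map_sum, one_apply_eq_self, BE_SE]
    congr 1
    refine Finset.sum_congr rfl fun i _ => ?_
    rw [smul_apply, smul_apply, map_smul]
    congr 1
    refine ext_inner_left ℂ fun y => ?_
    rw [BE, ContinuousLinearMap.adjoint_inner_right, ContinuousLinearMap.comp_apply,
      ContinuousLinearMap.comp_apply, ContinuousLinearMap.adjoint_inner_right,
      ContinuousLinearMap.adjoint_inner_right, RE_SE (w i).2, RE_SE (w i).2, inner_SE]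
  | insert i s hi ih =>
    have h := good_partA c w hc (insert i s)
    have e : partA c w (insert i s) = partA c w s -
        ((c i * (1 / (1 - ‖(w i : ℂ)‖ ^ 2)) : ℝ) : ℂ) • rk (evec (w i)) := by
      rw [partA, partA, Finset.sum_insert hi]
      abel
    rw [e] at h ⊢
    exact (good_partA c w hc s).cnp_sub_rk ih
      (mul_nonneg (hc i) (one_div_nonneg.2 (one_sub_normSq_pos _).le)) _ h

lemma partA_univ : partA c w Finset.univ = 1 + ∑ i, (c i : ℂ) • Qop (w i) := by
  rw [partA, add_sub_assoc, ← Finset.sum_sub_distrib]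
  congr 1
  refine Finset.sum_congr rfl fun i _ => ?_
  rw [Qop, smul_sub, smul_smul, RE_bas]
  push_cast
  rfl

lemma partA_univ_bas : partA c w Finset.univ (bas 0) = bas 0 := by
  rw [partA_univ, add_apply, sum_apply, one_apply_eq_self, Finset.sum_eq_zero,
    add_zero]
  intro i _
  rw [smul_apply, Qop_bas, smul_zero]

lemma psd_partA_univ (hc : ∀ i, 0 ≤ c i) :
    PSD (fun z u => 1 - 1 / kA (partA c w Finset.univ) z u) := by
  have h := good_partA c w hc Finset.univ
  refine (cnp_partA c w hc _).normalized h.psd (w := o) fun x => ?_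
  rw [kA, evec_o, h.inverse_eq (partA_univ_bas c w), ← inner_conj_symm, inner_bas, evec_apply]
  simp

end FiniteSum

end Approximants

section Limit

variable (μ : Measure ℂ) [IsFiniteMeasure μ] [Fact (OnCircle μ)]

lemma norm_real_mul_lt {r : ℝ} (hr0 : 0 ≤ r) (hr1 : r < 1) {ζ : ℂ} (hζ : ‖ζ‖ = 1) :
    ‖(r : ℂ) * ζ‖ < 1 := by
  rw [norm_mul, hζ, Complex.norm_real, Real.norm_of_nonneg hr0]; simpa

lemma integrable_Qop {r : ℝ} (hr0 : 0 ≤ r) (hr1 : r < 1) :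
    Integrable (fun ζ : ℂ => Qop (r * ζ)) μ := by
  have h : IntegrableOn (fun ζ : ℂ => Qop (r * ζ)) (sphere 0 1) μ := by
    refine ContinuousOn.integrableOn_compact (isCompact_sphere _ _) fun ζ hζ => ?_
    have h1 := continuousAt_Qop (norm_real_mul_lt hr0 hr1 (by simpa using hζ))
    exact (ContinuousAt.comp (f := fun ζ : ℂ => (r : ℂ) * ζ) h1
      (by fun_prop)).continuousWithinAt
  rwa [IntegrableOn, Measure.restrict_eq_self_of_ae_mem] at h
  filter_upwards [ae_norm_eq_one μ] with ζ hζ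
  simpa using hζ

lemma exists_finite_average {r : ℝ} (hr0 : 0 ≤ r) (hr1 : r < 1) {ε : ℝ} (hε : 0 < ε) :
    ∃ (ι : Type) (_ : Fintype ι) (c : ι → ℝ) (w : ι → Dsc), (∀ i, 0 ≤ c i) ∧
      ‖∑ i, (c i : ℂ) • Qop (w i) - ∫ ζ, Qop (r * ζ) ∂μ‖ ≤ ε := by
  rcases eq_or_ne μ 0 with h0 | h0
  · refine ⟨PEmpty, inferInstance, fun i => i.elim, fun i => i.elim, fun i => i.elim, ?_⟩
    simp [h0, hε.le]
  have : NeZero μ := ⟨h0⟩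
  set S : Set (E2 →L[ℂ] E2) := Set.range fun w : Dsc => Qop w
  have hm : 0 < μ.real univ := by
    rw [measureReal_def, ENNReal.toReal_pos_iff]
    exact ⟨pos_iff_ne_zero.2 (by simpa using h0), measure_lt_top _ _⟩
  have h1 : ⨍ ζ, Qop (r * ζ) ∂μ ∈ closure (convexHull ℝ S) := by
    refine Convex.average_mem (convex_convexHull ℝ S).closure isClosed_closure ?_
      (integrable_Qop μ hr0 hr1)
    filter_upwards [ae_norm_eq_one μ] with ζ hζ
    exact subset_closure (subset_convexHull ℝ S ⟨⟨_, norm_real_mul_lt hr0 hr1 hζ⟩, rfl⟩)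
  obtain ⟨B, hB, hBd⟩ := Metric.mem_closure_iff.1 h1 (ε / μ.real univ) (by positivity)
  obtain ⟨ι, hι, c, z, hc, -, hz, hsum⟩ := mem_convexHull_iff_exists_fintype.1 hB
  choose w hw using hz
  refine ⟨ι, hι, fun i => μ.real univ * c i, w, fun i => mul_nonneg hm.le (hc i), ?_⟩
  have h2 : ∑ i, ((μ.real univ * c i : ℝ) : ℂ) • Qop (w i) = μ.real univ • B := by
    rw [← hsum, Finset.smul_sum]
    refine Finset.sum_congr rfl fun i _ => ?_
    rw [smul_smul, ← hw i]
    exact Complex.coe_smul _ _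
  have h3 : ∫ ζ, Qop (r * ζ) ∂μ = μ.real univ • ⨍ ζ, Qop (r * ζ) ∂μ := by
    rw [average_eq, smul_smul, mul_inv_cancel₀ hm.ne', one_smul]
  rw [h2, h3, ← smul_sub, norm_smul, Real.norm_of_nonneg hm.le, ← dist_eq_norm, dist_comm]
  calc μ.real univ * _ ≤ μ.real univ * (ε / μ.real univ) := by gcongr
    _ = ε := by field_simp

lemma integrable_Qf {r : ℝ} (hr0 : 0 ≤ r) (hr1 : r < 1) (f : E2) :
    Integrable (fun ζ : ℂ => Qf (r * ζ) f) μ ∧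
      ∫ ζ, Qf (r * ζ) f ∂μ = (⟪f, (∫ ζ, Qop (r * ζ) ∂μ) f⟫_ℂ).re := by
  set L : (E2 →L[ℂ] E2) →L[ℝ] ℝ := Complex.reCLM ∘L
    ((innerSL ℂ f) ∘L (ContinuousLinearMap.apply ℂ E2 f)).restrictScalars ℝ with hL
  have hLa : ∀ B, L B = (⟪f, B f⟫_ℂ).re := fun B => rfl
  have hae : (fun ζ : ℂ => L (Qop (r * ζ))) =ᵐ[μ] fun ζ => Qf (r * ζ) f := by
    filter_upwards [ae_norm_eq_one μ] with ζ hζ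
    have := inner_Qop ⟨_, norm_real_mul_lt hr0 hr1 hζ⟩ f
    rw [hLa, this, Complex.ofReal_re]
  have hi := integrable_Qop μ hr0 hr1
  refine ⟨(L.integrable_comp hi).congr hae, ?_⟩
  rw [← integral_congr_ae hae, L.integral_comp_comm hi, hLa]

lemma exists_approximant {r : ℝ} (hr0 : 0 ≤ r) (hr1 : r < 1) {ε : ℝ} (hε : 0 < ε) :
    ∃ A, Good A ∧ PSD (fun z u => 1 - 1 / kA A z u) ∧ (∀ z u, kA A z u ≠ 0) ∧
      ∀ f, |(⟪f, A f⟫_ℂ).re - (‖f‖ ^ 2 + ∫ ζ, Qf (r * ζ) f ∂μ)| ≤ ε * ‖f‖ ^ 2 := by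
  obtain ⟨ι, _, c, w, hc, hd⟩ := exists_finite_average μ hr0 hr1 hε
  refine ⟨partA c w Finset.univ, good_partA c w hc _, psd_partA_univ c w hc,
    (cnp_partA c w hc _).ne_zero, fun f => ?_⟩
  rw [partA_univ, (integrable_Qf μ hr0 hr1 f).2, add_apply, inner_add_right,
    one_apply_eq_self, Complex.add_re, re_inner_self, add_sub_add_left_eq_sub, ← Complex.sub_re,
    ← inner_sub_right, ← sub_apply]
  refine (Complex.abs_re_le_norm _).trans ((norm_inner_le_norm _ _).trans ?_)
  calc ‖f‖ * _ ≤ ‖f‖ * (ε * ‖f‖) := by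
        gcongr; exact ContinuousLinearMap.le_of_opNorm_le _ hd f
    _ = _ := by ring

variable {μ}

lemma ofReal_integral_Qf {r : ℝ} (hr0 : 0 ≤ r) (hr1 : r < 1) (f : E2) :
    ENNReal.ofReal (∫ ζ, Qf (r * ζ) f ∂μ) = ∫⁻ ζ, ENNReal.ofReal (Qf (r * ζ) f) ∂μ := by
  refine ofReal_integral_eq_lintegral_ofReal (integrable_Qf μ hr0 hr1 f).1 ?_
  filter_upwards [ae_norm_eq_one μ] with ζ hζ
  exact Qf_nonneg ⟨_, norm_real_mul_lt hr0 hr1 hζ⟩ f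

omit [IsFiniteMeasure μ] in
lemma integral_Qf_nonneg {r : ℝ} (hr0 : 0 ≤ r) (hr1 : r < 1) (f : E2) :
    0 ≤ ∫ ζ, Qf (r * ζ) f ∂μ := by
  refine integral_nonneg_of_ae ?_
  filter_upwards [ae_norm_eq_one μ] with ζ hζ
  exact Qf_nonneg ⟨_, norm_real_mul_lt hr0 hr1 hζ⟩ f

lemma integral_Qf_le {r : ℝ} (hr0 : 0 ≤ r) (hr1 : r < 1) {f : E2} (hf : Dir μ f ≠ ∞) :
    ∫ ζ, Qf (r * ζ) f ∂μ ≤ (2 / (1 + r)) ^ 2 * (Dir μ f).toReal := by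
  have h1 : ENNReal.ofReal (∫ ζ, Qf (r * ζ) f ∂μ) ≤
      ENNReal.ofReal ((2 / (1 + r)) ^ 2) * Dir μ f := by
    rw [ofReal_integral_Qf hr0 hr1, Dir, ← lintegral_const_mul _ (measurable_dz f)]
    refine lintegral_mono_ae ?_
    filter_upwards [ae_norm_eq_one μ] with ζ hζ
    exact Qf_le_dz hζ hr0 hr1 f
  rw [← ENNReal.ofReal_toReal hf, ← ENNReal.ofReal_mul (by positivity)] at h1
  exact (ENNReal.ofReal_le_ofReal_iff (by positivity)).1 h1

lemma continuous_qK (K : ℕ) (r : ℝ) (a : ℕ → ℂ) : Continuous fun ζ : ℂ => qK K (r * ζ) a := by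
  have h : Continuous fun ζ : ℂ => (r : ℂ) * ζ := by fun_prop
  refine continuous_iff_continuousAt.2 fun ζ => ?_
  exact tendsto_qK (w := fun ζ : ℂ => (r : ℂ) * ζ) (a := fun _ => a) (h.tendsto ζ)
    (fun _ => tendsto_const_nhds) K

lemma Dir_le_of_tendsto {r : ℕ → ℝ} (hr0 : ∀ n, 0 ≤ r n) (hr1 : ∀ n, r n < 1)
    (hr : Tendsto r atTop (𝓝 1)) {f : ℕ → E2} {a : E2}
    (hf : ∀ j, Tendsto (fun n => f n j) atTop (𝓝 (a j))) {b : ℕ → ℝ} {B : ℝ}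
    (hb : Tendsto b atTop (𝓝 B)) (h : ∀ n, ∫ ζ, Qf (r n * ζ) (f n) ∂μ ≤ b n) :
    Dir μ a ≤ ENNReal.ofReal B := by
  have hK : ∀ K, ∫⁻ ζ, ENNReal.ofReal (dK K ζ a) ∂μ ≤ ENNReal.ofReal B := by
    intro K
    calc ∫⁻ ζ, ENNReal.ofReal (dK K ζ a) ∂μ
        = ∫⁻ ζ, liminf (fun n => ENNReal.ofReal (qK K (r n * ζ) (f n))) atTop ∂μ := by
          refine lintegral_congr_ae ?_
          filter_upwards [ae_norm_eq_one μ] with ζ hζ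
          refine (Tendsto.liminf_eq ?_).symm
          rw [← qK_circle hζ]
          refine (ENNReal.continuous_ofReal.tendsto _).comp (tendsto_qK ?_ hf K)
          have : Tendsto (fun n => (r n : ℂ)) atTop (𝓝 ((1 : ℝ) : ℂ)) :=
            (Complex.continuous_ofReal.tendsto _).comp hr
          simpa using this.mul_const ζ
      _ ≤ liminf (fun n => ∫⁻ ζ, ENNReal.ofReal (qK K (r n * ζ) (f n)) ∂μ) atTop :=
          lintegral_liminf_le fun n => (continuous_qK K (r n) (f n)).measurable.ennreal_ofReal
      _ ≤ liminf (fun n => ENNReal.ofReal (b n)) atTop := by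
          refine liminf_le_liminf (Eventually.of_forall fun n => ?_)
          refine le_trans ?_ (ENNReal.ofReal_le_ofReal (h n))
          rw [ofReal_integral_Qf (hr0 n) (hr1 n)]
          refine lintegral_mono_ae ?_
          filter_upwards [ae_norm_eq_one μ] with ζ hζ
          exact ENNReal.ofReal_le_ofReal
            (qK_le_Qf K ⟨_, norm_real_mul_lt (hr0 n) (hr1 n) hζ⟩ (f n))
      _ = ENNReal.ofReal B := ((ENNReal.continuous_ofReal.tendsto _).comp hb).liminf_eq
  calc Dir μ a = ∫⁻ ζ, liminf (fun K => ENNReal.ofReal (dK K ζ a)) atTop ∂μ :=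
        lintegral_congr fun ζ => (tendsto_dK ζ a).liminf_eq.symm
    _ ≤ liminf (fun K => ∫⁻ ζ, ENNReal.ofReal (dK K ζ a) ∂μ) atTop := by
        refine lintegral_liminf_le fun K => Measurable.ennreal_ofReal ?_
        simp only [dK_eq_sum]
        refine Finset.measurable_sum _ fun k _ => ?_
        have := continuous_hsum a (k + 1)
        fun_prop
    _ ≤ liminf (fun _ : ℕ => ENNReal.ofReal B) atTop :=
        liminf_le_liminf (Eventually.of_forall hK)
    _ = ENNReal.ofReal B := liminf_const _

lemma kappa_limit {r ε : ℕ → ℝ} (hr0 : ∀ n, 0 ≤ r n) (hr1 : ∀ n, r n < 1)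
    (hr : Tendsto r atTop (𝓝 1)) (hε : Tendsto ε atTop (𝓝 0)) (hε0 : ∀ n, 0 < ε n)
    {A : ℕ → E2 →L[ℂ] E2} (hA : ∀ n, Good (A n))
    (hAd : ∀ n f, |(⟪f, A n f⟫_ℂ).re - (‖f‖ ^ 2 + ∫ ζ, Qf (r n * ζ) f ∂μ)| ≤ ε n * ‖f‖ ^ 2)
    (u : Dsc) {a : ℕ → ℂ}
    (ha : ∀ j, Tendsto (fun n => Ring.inverse (A n) (evec u) j) atTop (𝓝 (a j))) :
    ∀ j, a j = coef μ (kv μ u) j := by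
  set κ := fun n => Ring.inverse (A n) (evec u) with hκ
  have hκb : ∀ n, ‖κ n‖ ≤ ‖evec u‖ := fun n => (hA n).norm_inverse_le _
  obtain ⟨f, hfa, -⟩ := E2.exists_of_sum_le (a := a) (C := ‖evec u‖ ^ 2) fun K => by
    refine le_of_tendsto' (tendsto_finsetSum _ fun j _ => (ha j).norm.pow 2) fun n => ?_
    exact (E2.sum_le (κ n) _).trans (by have := hκb n; gcongr)
  have hf : ∀ j, Tendsto (fun n => κ n j) atTop (𝓝 (f j)) := fun j => by rw [hfa]; exact ha j
  have hlim : Tendsto (fun n => (⟪evec u, κ n⟫_ℂ).re) atTop (𝓝 (⟪evec u, f⟫_ℂ).re) :=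
    (Complex.continuous_re.tendsto _).comp (E2.tendsto_inner hκb hf _)
  have hεC : ∀ C : ℝ, Tendsto (fun n => ε n * C) atTop (𝓝 0) := fun C => by
    simpa using hε.mul_const C
  have hNκ : ∀ n, ‖κ n‖ ^ 2 + ∫ ζ, Qf (r n * ζ) (κ n) ∂μ ≤
      (⟪evec u, κ n⟫_ℂ).re + ε n * ‖evec u‖ ^ 2 := fun n => by
    have h1 := (abs_le.1 (hAd n (κ n))).1
    have h2 : (⟪κ n, A n (κ n)⟫_ℂ).re = (⟪evec u, κ n⟫_ℂ).re := by
      rw [hκ, (hA n).apply_inverse, (hA n).inner_inverse]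
    have h3 : ε n * ‖κ n‖ ^ 2 ≤ ε n * ‖evec u‖ ^ 2 := by
      have := hκb n
      have := (hε0 n).le
      gcongr
    linarith
  have hDirK : ∀ K, Dir μ f ≤ ENNReal.ofReal ((⟪evec u, f⟫_ℂ).re -
      ∑ j ∈ Finset.range K, ‖f j‖ ^ 2) := fun K => by
    refine Dir_le_of_tendsto hr0 hr1 hr hf (b := fun n => (⟪evec u, κ n⟫_ℂ).re +
      ε n * ‖evec u‖ ^ 2 - ∑ j ∈ Finset.range K, ‖κ n j‖ ^ 2) ?_ fun n => ?_
    · have := (hlim.add (hεC (‖evec u‖ ^ 2))).sub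
        (tendsto_finsetSum (Finset.range K) fun j _ => (hf j).norm.pow 2)
      simpa using this
    · have := hNκ n
      have := E2.sum_le (κ n) (Finset.range K)
      linarith
  have hsum : ∀ K, ∑ j ∈ Finset.range K, ‖f j‖ ^ 2 ≤ (⟪evec u, f⟫_ℂ).re := fun K => by
    have h1 := tendsto_finsetSum (Finset.range K) fun j _ => (hf j).norm.pow 2
    have h2 := hlim.add (hεC (‖evec u‖ ^ 2))
    rw [add_zero] at h2
    refine le_of_tendsto_of_tendsto' h1 h2 fun n => ?_
    have := hNκ n
    have := E2.sum_le (κ n) (Finset.range K)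
    have := integral_Qf_nonneg (μ := μ) (hr0 n) (hr1 n) (κ n)
    linarith
  have hDir : Dir μ f ≠ ∞ := ne_top_of_le_ne_top ENNReal.ofReal_ne_top (hDirK 0)
  obtain ⟨x, hx⟩ := DH.exists_of_Dir μ hDir
  have hx1 : ‖x‖ ^ 2 ≤ (⟪evec u, f⟫_ℂ).re := by
    rw [DH.normSq, hx, ← le_sub_iff_add_le]
    refine E2.normSq_le_of_sum_le f fun K => ?_
    have h1 := ENNReal.toReal_le_of_le_ofReal (by linarith [hsum K]) (hDirK K)
    linarith
  set g := coef μ (kv μ u) with hg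
  have hgu : (⟪evec u, g⟫_ℂ).re = ‖kv μ u‖ ^ 2 := by
    rw [hg, ← inner_kv]
    have h1 : ⟪kv μ u, kv μ u⟫_ℂ = (‖kv μ u‖ : ℂ) ^ 2 := inner_self_eq_norm_sq_to_K _
    rw [h1]
    norm_cast
  have hx2 : ‖kv μ u‖ ^ 2 ≤ (⟪evec u, f⟫_ℂ).re := by
    have h1 : ∀ n, ‖kv μ u‖ ^ 2 * 2 ≤ (‖g‖ ^ 2 + (2 / (1 + r n)) ^ 2 * (Dir μ g).toReal +
        ε n * ‖g‖ ^ 2) + (⟪evec u, κ n⟫_ℂ).re := fun n => by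
      have h2 := (sq_nonneg _).trans ((hA n).2 (g - κ n))
      rw [map_sub, (hA n).apply_inverse, inner_sub_left, inner_sub_right, inner_sub_right,
        ← inner_conj_symm g (evec u), ← (hA n).1 (κ n) g, (hA n).apply_inverse,
        ← inner_conj_symm (κ n) (evec u)] at h2
      simp only [Complex.sub_re, Complex.conj_re, hgu] at h2
      have h3 := (abs_le.1 (hAd n g)).2
      have h4 := integral_Qf_le (hr0 n) (hr1 n) (Dir_coef_ne_top μ (kv μ u))
      linarith
    have h2 : Tendsto (fun n => (‖g‖ ^ 2 + (2 / (1 + r n)) ^ 2 * (Dir μ g).toReal +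
        ε n * ‖g‖ ^ 2) + (⟪evec u, κ n⟫_ℂ).re) atTop
        (𝓝 ((‖g‖ ^ 2 + (2 / (1 + 1)) ^ 2 * (Dir μ g).toReal + 0) + (⟪evec u, f⟫_ℂ).re)) :=
      (((tendsto_const_nhds.add (((tendsto_const_nhds.div (tendsto_const_nhds.add hr)
        (by norm_num)).pow 2).mul_const _)).add (hεC _)).add hlim)
    have h3 := ge_of_tendsto' h2 h1
    have h4 := DH.normSq μ (kv μ u)
    rw [← hg] at h4
    norm_num at h3
    linarith
  have hxk : x = kv μ u := by
    rw [← sub_eq_zero, ← norm_eq_zero, ← sq_eq_zero_iff]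
    refine le_antisymm ?_ (sq_nonneg _)
    have h1 : RCLike.re ⟪x, kv μ u⟫_ℂ = (⟪evec u, f⟫_ℂ).re := by
      rw [← inner_conj_symm, inner_kv, hx]
      exact Complex.conj_re _
    rw [@norm_sub_sq ℂ, h1]
    linarith
  intro j
  rw [← hfa, hg, ← hxk, hx]

variable (μ)

/-- The kernel of `D(μ)` is a normalized complete Pick kernel. -/
theorem exists_pick_kernel :
    ∃ P : Dsc → Dsc → ℂ, PSD P ∧ ∀ z u, ⟪kv μ z, kv μ u⟫_ℂ * (1 - P z u) = 1 := by
  set ε : ℕ → ℝ := fun n => 1 / ((n : ℝ) + 1) with hε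
  have hε0 : ∀ n, 0 < ε n := fun n => by rw [hε]; positivity
  have hε1 : ∀ n, ε n ≤ 1 := fun n => by
    rw [hε]; dsimp only; rw [div_le_one (by positivity)]; linarith [n.cast_nonneg (α := ℝ)]
  have hεl : Tendsto ε atTop (𝓝 0) := tendsto_one_div_add_atTop_nhds_zero_nat
  have hr0 : ∀ n, 0 ≤ 1 - ε n := fun n => sub_nonneg.2 (hε1 n)
  have hr1 : ∀ n, 1 - ε n < 1 := fun n => sub_lt_self _ (hε0 n)
  have hrl : Tendsto (fun n => 1 - ε n) atTop (𝓝 1) := by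
    simpa using (tendsto_const_nhds (x := (1 : ℝ))).sub hεl
  choose A hA hP hne hAd using fun n => exists_approximant μ (hr0 n) (hr1 n) (hε0 n)
  have hlim : ∀ z u, Tendsto (fun n => kA (A n) z u) atTop (𝓝 ⟪kv μ z, kv μ u⟫_ℂ) := by
    intro z u
    refine tendsto_of_subseq_tendsto fun ns hns => ?_
    have hcpt := isCompact_univ_pi (s := fun _ : ℕ => closedBall (0 : ℂ) ‖evec u‖)
      fun _ => isCompact_closedBall _ _
    obtain ⟨a, -, φ, hφ, hlim⟩ := hcpt.tendsto_subseq
      (x := fun n j => Ring.inverse (A (ns n)) (evec u) j) fun n j _ => by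
        rw [mem_closedBall_zero_iff]
        exact (E2.norm_coord_le _ j).trans ((hA _).norm_inverse_le _)
    have hmono := hns.comp hφ.tendsto_atTop
    have ha := tendsto_pi_nhds.1 hlim
    have key := kappa_limit (μ := μ) (r := fun k => 1 - ε (ns (φ k))) (ε := fun k => ε (ns (φ k)))
      (A := fun k => A (ns (φ k))) (fun _ => hr0 _) (fun _ => hr1 _) (hrl.comp hmono)
      (hεl.comp hmono) (fun _ => hε0 _) (fun _ => hA _) (fun _ => hAd _) u ha
    refine ⟨φ, ?_⟩
    rw [inner_kv]
    exact E2.tendsto_inner (fun k => (hA (ns (φ k))).norm_inverse_le (evec u))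
      (fun j => by rw [← key j]; exact ha j) _
  obtain ⟨h1, h2⟩ := psd_one_sub_inv_of_tendsto (fun n => (hA n).psd)
    (fun n => (hA n).diag_pos) hP hne hlim
  refine ⟨_, h2, fun z u => ?_⟩
  have := h1 z u
  field_simp
  ring

end Limit

section Hardy

/-- `f` has the Taylor expansion `∑ aₙ zⁿ` on the disc. -/
def HasCoef (f : ℂ → ℂ) (a : ℕ → ℂ) : Prop :=
  ∀ z : ℂ, ‖z‖ < 1 → HasSum (fun n => a n * z ^ n) (f z)

variable {f : ℂ → ℂ} {a : ℕ → ℂ}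

lemma HasCoef.summable_norm (h : HasCoef f a) {r : ℝ} (hr0 : 0 ≤ r) (hr1 : r < 1) :
    Summable fun n => ‖a n‖ * r ^ n := by
  have h1 := (h r (by rwa [Complex.norm_real, Real.norm_of_nonneg hr0])).summable.norm
  simpa [abs_of_nonneg hr0] using h1

lemma HasCoef.hasFPowerSeriesOnBall (h : HasCoef f a) :
    HasFPowerSeriesOnBall f (FormalMultilinearSeries.ofScalars ℂ a) 0 1 where
  r_le := by
    refine ENNReal.le_of_forall_nnreal_lt fun r hr => ?_
    refine FormalMultilinearSeries.le_radius_of_summable_norm _ ?_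
    have := h.summable_norm r.2 (by exact_mod_cast hr)
    refine this.of_nonneg_of_le (fun n => by positivity) fun n => ?_
    exact (congrArg (· * (r : ℝ) ^ n) (FormalMultilinearSeries.ofScalars_norm ℂ a n)).le
  r_pos := one_pos
  hasSum := fun {y} hy => by
    have h1 := h y (by simpa [← ofReal_norm, ENNReal.ofReal_lt_one] using hy)
    simpa [FormalMultilinearSeries.ofScalars_apply_eq, mul_comm] using h1

lemma HasCoef.differentiableOn (h : HasCoef f a) : DifferentiableOn ℂ f disc := by
  have := h.hasFPowerSeriesOnBall.differentiableOn
  rwa [show (1 : ℝ≥0∞) = ENNReal.ofReal 1 by simp, Metric.eball_ofReal] at this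

lemma HasCoef.unique {b : ℕ → ℂ} (h : HasCoef f a) (h' : HasCoef f b) : a = b := by
  rw [← sub_eq_zero]
  refine eq_zero_of_hasSum_pow fun z hz => ?_
  simpa [sub_mul] using (h z hz).sub (h' z hz)

lemma hasCoef_taylor (h : DifferentiableOn ℂ f disc) :
    HasCoef f fun n => (n.factorial : ℂ)⁻¹ * iteratedDeriv n f 0 := fun z hz => by
  have h1 := Complex.hasSum_taylorSeries_on_ball h (z := z) (by simpa using hz)
  have h2 : (fun n : ℕ => (n.factorial : ℂ)⁻¹ * iteratedDeriv n f 0 * z ^ n) =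
      fun n => (n.factorial : ℂ)⁻¹ • (z - 0) ^ n • iteratedDeriv n f 0 := by
    funext n
    simp only [sub_zero, smul_eq_mul]
    ring
  rwa [h2]

lemma exists_hasCoef (h : DifferentiableOn ℂ f disc) : ∃ a, HasCoef f a := ⟨_, hasCoef_taylor h⟩

lemma norm_bpt (t : ℝ) : ‖bpt t‖ = 1 := by
  rw [bpt, mul_comm]; exact Complex.norm_exp_ofReal_mul_I t

lemma circleMap_eq_bpt (t : ℝ) : circleMap 0 1 t = bpt t := by
  rw [circleMap, bpt, mul_comm Complex.I]; simp

lemma norm_real_mul_bpt {r : ℝ} (hr0 : 0 ≤ r) (t : ℝ) : ‖(r : ℂ) * bpt t‖ = r := by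
  rw [norm_mul, norm_bpt, mul_one, Complex.norm_real, Real.norm_of_nonneg hr0]

lemma circle_parseval_finset (b : ℕ → ℂ) (N : ℕ) :
    ∑ n ∈ Finset.range N, ‖b n‖ ^ 2 = (1 / (2 * Real.pi)) *
      ∫ t in (0 : ℝ)..(2 * Real.pi), ‖∑ n ∈ Finset.range N, b n * bpt t ^ n‖ ^ 2 := by
  set p : Polynomial ℂ := ∑ n ∈ Finset.range N, Polynomial.C (b n) * Polynomial.X ^ n with hp
  have hc : ∀ i, p.coeff i = if i ∈ Finset.range N then b i else 0 := fun i => by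
    rw [hp, Polynomial.finsetSum_coeff]
    simp
  have h := p.sum_sq_norm_coeff_eq_circleAverage
  rw [Real.circleAverage] at h
  have h1 : ∑ i ∈ p.support, ‖p.coeff i‖ ^ 2 = ∑ n ∈ Finset.range N, ‖b n‖ ^ 2 := by
    rw [Finset.sum_subset (s₂ := Finset.range N)]
    · exact Finset.sum_congr rfl fun i hi => by rw [hc, if_pos hi]
    · intro i hi
      by_contra h0
      exact Polynomial.mem_support_iff.1 hi (by rw [hc, if_neg h0])
    · intro i _ hi
      rw [Polynomial.notMem_support_iff.1 hi]; simp
  rw [← h1, h, smul_eq_mul, one_div]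
  congr 1
  refine intervalIntegral.integral_congr fun t _ => ?_
  simp only [circleMap_eq_bpt, hp, Polynomial.eval_finsetSum, Polynomial.eval_mul,
    Polynomial.eval_C, Polynomial.eval_pow, Polynomial.eval_X]

lemma continuous_bpt : Continuous bpt := by unfold bpt; fun_prop

lemma HasCoef.circle_parseval (h : HasCoef f a) {r : ℝ} (hr0 : 0 ≤ r) (hr1 : r < 1) :
    HasSum (fun n => ‖a n‖ ^ 2 * r ^ (2 * n)) ((1 / (2 * Real.pi)) *
      ∫ t in (0 : ℝ)..(2 * Real.pi), ‖f ((r : ℂ) * bpt t)‖ ^ 2) := by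
  rw [hasSum_iff_tendsto_nat_of_nonneg fun n => by positivity]
  have hs := h.summable_norm hr0 hr1
  have h1 : ∀ N, ∑ n ∈ Finset.range N, ‖a n‖ ^ 2 * r ^ (2 * n) = (1 / (2 * Real.pi)) *
      ∫ t in (0 : ℝ)..(2 * Real.pi),
        ‖∑ n ∈ Finset.range N, a n * ((r : ℂ) * bpt t) ^ n‖ ^ 2 := fun N => by
    have := circle_parseval_finset (fun n => a n * (r : ℂ) ^ n) N
    simp only [norm_mul, norm_pow, Complex.norm_real, Real.norm_of_nonneg hr0, mul_pow,
      ← pow_mul, mul_comm _ 2] at this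
    rw [this]
    simp only [mul_pow, mul_assoc]
  simp only [h1]
  refine Tendsto.const_mul _ ?_
  refine intervalIntegral.tendsto_integral_filter_of_dominated_convergence
    (fun _ => (∑' n, ‖a n‖ * r ^ n) ^ 2) ?_ ?_ ?_ ?_
  · refine Eventually.of_forall fun N => Continuous.aestronglyMeasurable ?_
    have := continuous_bpt
    fun_prop
  · refine Eventually.of_forall fun N => Eventually.of_forall fun t _ => ?_
    rw [norm_pow, norm_norm]
    gcongr
    refine (norm_sum_le _ _).trans ?_
    simp only [norm_mul, norm_pow, norm_bpt, mul_one, Complex.norm_real, Real.norm_of_nonneg hr0]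
    exact hs.sum_le_tsum _ fun n _ => by positivity
  · exact intervalIntegrable_const
  · refine Eventually.of_forall fun t _ => ?_
    exact ((h _ (by rwa [norm_real_mul_bpt hr0])).tendsto_sum_nat.norm).pow 2

lemma HasCoef.mem_hardySet (h : HasCoef f a) {x : ℝ} :
    x ∈ hardySet f ↔ ∃ r : ℝ, 0 < r ∧ r < 1 ∧ HasSum (fun n => ‖a n‖ ^ 2 * r ^ (2 * n)) x := by
  refine exists_congr fun r => and_congr_right fun h0 => and_congr_right fun h1 => ?_
  have := h.circle_parseval h0.le h1
  exact ⟨fun hx => by rwa [hx], fun hx => hx.unique this⟩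

lemma HasCoef.bddAbove (h : HasCoef f a) {C : ℝ} (hC : ∀ K, ∑ n ∈ Finset.range K, ‖a n‖ ^ 2 ≤ C) :
    ∀ x ∈ hardySet f, x ≤ C := by
  intro x hx
  obtain ⟨r, h0, h1, hs⟩ := h.mem_hardySet.1 hx
  refine le_of_tendsto' hs.tendsto_sum_nat fun K => le_trans ?_ (hC K)
  refine Finset.sum_le_sum fun n _ => ?_
  exact mul_le_of_le_one_right (by positivity) (pow_le_one₀ h0.le h1.le)

lemma HasCoef.sum_le (h : HasCoef f a) {C : ℝ} (hC : ∀ x ∈ hardySet f, x ≤ C) (K : ℕ) :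
    ∑ n ∈ Finset.range K, ‖a n‖ ^ 2 ≤ C := by
  have hl : Tendsto (fun r : ℝ => ∑ n ∈ Finset.range K, ‖a n‖ ^ 2 * r ^ (2 * n)) (𝓝[<] 1)
      (𝓝 (∑ n ∈ Finset.range K, ‖a n‖ ^ 2)) := by
    have : Continuous fun r : ℝ => ∑ n ∈ Finset.range K, ‖a n‖ ^ 2 * r ^ (2 * n) := by fun_prop
    simpa using (this.tendsto 1).mono_left nhdsWithin_le_nhds
  refine le_of_tendsto hl ?_
  filter_upwards [Ioo_mem_nhdsLT (zero_lt_one' ℝ)] with r hr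
  have hs := h.circle_parseval hr.1.le hr.2
  exact (sum_le_hasSum _ (fun n _ => by positivity [hr.1]) hs).trans
    (hC _ ⟨r, hr.1, hr.2, rfl⟩)

lemma MemHardy2.exists_coef (h : MemHardy2 f) : ∃ a : E2, HasCoef f a := by
  obtain ⟨a, ha⟩ := exists_hasCoef h.1
  obtain ⟨C, hC⟩ := h.2
  obtain ⟨x, hx, -⟩ := E2.exists_of_sum_le fun K => ha.sum_le (fun x hx => hC hx) K
  exact ⟨x, by rwa [show (x : ℕ → ℂ) = a from funext hx]⟩

lemma HasCoef.hardyNormSq {a : E2} (h : HasCoef f a) : hardyNormSq f = ‖a‖ ^ 2 := by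
  have h1 := h.bddAbove (C := ‖a‖ ^ 2) fun K => E2.sum_le a _
  refine le_antisymm (Real.sSup_le h1 (sq_nonneg _)) ?_
  refine E2.normSq_le_of_sum_le a (h.sum_le fun x hx => le_csSup ⟨_, h1⟩ hx)

lemma HasCoef.memHardy2 {a : E2} (h : HasCoef f a) : MemHardy2 f :=
  ⟨h.differentiableOn, _, h.bddAbove fun _ => E2.sum_le a _⟩

lemma hasCoef_inner (a : E2) (h : ∀ z : Dsc, f z = ⟪evec z, a⟫_ℂ) : HasCoef f a := fun z hz => by
  rw [h ⟨z, hz⟩]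
  exact hasSum_inner_evec ⟨z, hz⟩ a

lemma HasCoef.eq_inner {a : E2} (h : HasCoef f a) (z : Dsc) : f z = ⟪evec z, a⟫_ℂ :=
  (h z z.2).unique (hasSum_inner_evec z a)

/-- Holomorphic functions bounded by one act contractively on the Hardy space. -/
lemma exists_bounded_mul {b : ℂ → ℂ} (hb : DifferentiableOn ℂ b disc)
    (hb1 : ∀ z : Dsc, ‖b z‖ ≤ 1) (a : E2) :
    ∃ c : E2, ‖c‖ ≤ ‖a‖ ∧ ∀ z : Dsc, ⟪evec z, c⟫_ℂ = b z * ⟪evec z, a⟫_ℂ := by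
  classical
  set F : ℂ → ℂ := fun z => if hz : ‖z‖ < 1 then ⟪evec ⟨z, hz⟩, a⟫_ℂ else 0
  have hF : ∀ z : Dsc, F z = ⟪evec z, a⟫_ℂ := fun z => dif_pos z.2
  have hFc := hasCoef_inner a hF
  obtain ⟨c, hc⟩ := exists_hasCoef (hb.mul hFc.differentiableOn)
  have hle : ∀ x ∈ hardySet (b * F), x ≤ ‖a‖ ^ 2 := by
    rintro x ⟨r, h0, h1, rfl⟩
    refine le_trans ?_ (hFc.bddAbove (C := ‖a‖ ^ 2) (fun _ => E2.sum_le a _) _ ⟨r, h0, h1, rfl⟩)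
    gcongr
    have hd : ∀ g : ℂ → ℂ, DifferentiableOn ℂ g disc →
        Continuous fun t => ‖g ((r : ℂ) * bpt t)‖ ^ 2 := fun g hg => by
      refine (ContinuousOn.comp_continuous hg.continuousOn (f := fun t => (r : ℂ) * bpt t)
        (by have := continuous_bpt; fun_prop) fun t => ?_).norm.pow 2
      rw [disc, mem_ball_zero_iff, norm_real_mul_bpt h0.le]; exact h1
    refine intervalIntegral.integral_mono_on (by positivity)
      ((hd _ (hb.mul hFc.differentiableOn)).intervalIntegrable _ _)
      ((hd _ hFc.differentiableOn).intervalIntegrable _ _) fun t _ => ?_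
    rw [Pi.mul_apply, norm_mul, mul_pow]
    refine mul_le_of_le_one_left (by positivity) (pow_le_one₀ (norm_nonneg _) ?_)
    exact hb1 ⟨_, by rwa [norm_real_mul_bpt h0.le]⟩
  obtain ⟨x, hx, hxn⟩ := E2.exists_of_sum_le (hc.sum_le hle)
  have hcx : HasCoef (b * F) x := by rwa [show (x : ℕ → ℂ) = c from funext hx]
  refine ⟨x, (sq_le_sq₀ (norm_nonneg _) (norm_nonneg _)).1 hxn, fun z => ?_⟩
  rw [← hcx.eq_inner z, Pi.mul_apply, hF]

end Hardy

section Dilation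

lemma E2.ext_evec {a b : E2} (h : ∀ z : Dsc, ⟪evec z, a⟫_ℂ = ⟪evec z, b⟫_ℂ) : a = b := by
  rw [← sub_eq_zero]
  have h0 : ((a - b : E2) : ℕ → ℂ) = 0 := eq_zero_of_hasSum_pow fun z hz => by
    have := hasSum_inner_evec ⟨z, hz⟩ (a - b)
    rwa [inner_sub_right, h, sub_self] at this
  refine E2.ext fun n => ?_
  rw [h0]; rfl

lemma inner_evec_bas_zero (z : Dsc) : ⟪evec z, bas 0⟫_ℂ = 1 := by
  rw [← inner_conj_symm, inner_bas, evec_apply]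
  simp

lemma exists_dilation {r : ℝ} (hr0 : 0 ≤ r) (hr1 : r ≤ 1) (a : E2) :
    ∃ d : E2, ‖d‖ ≤ ‖a‖ ∧ ∀ n, d n = (r : ℂ) ^ n * a n := by
  obtain ⟨d, hd, hdn⟩ := E2.exists_of_sum_le (a := fun n => (r : ℂ) ^ n * a n) (C := ‖a‖ ^ 2)
    fun K => by
      refine (Finset.sum_le_sum fun n _ => ?_).trans (E2.sum_le a _)
      rw [norm_mul, mul_pow, norm_pow, Complex.norm_real, Real.norm_of_nonneg hr0]
      exact mul_le_of_le_one_left (by positivity)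
        (pow_le_one₀ (by positivity) (pow_le_one₀ hr0 hr1))
  exact ⟨d, (sq_le_sq₀ (norm_nonneg _) (norm_nonneg _)).1 hdn, hd⟩

lemma inner_evec_dilation {r : ℝ} {a d : E2} (hd : ∀ n, d n = (r : ℂ) ^ n * a n) {z w : Dsc}
    (hw : (w : ℂ) = r * z) : ⟪evec z, d⟫_ℂ = ⟪evec w, a⟫_ℂ := by
  refine (hasSum_inner_evec z d).unique ?_
  have h := hasSum_inner_evec w a
  rw [show (fun n => d n * (z : ℂ) ^ n) = fun n => a n * (w : ℂ) ^ n from funext fun n => by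
    rw [hd, hw]; ring]
  exact h

lemma exists_backward_resolvent {w : ℂ} (hw : ‖w‖ < 1) (y : E2) :
    ∃ v : E2, (∀ n, v n = y n + w * v (n + 1)) ∧ (1 - ‖w‖) * ‖v‖ ≤ ‖y‖ := by
  have hn : ‖w • BE‖ < 1 := by
    refine (ContinuousLinearMap.opNorm_le_bound _ (norm_nonneg w) fun x => ?_).trans_lt hw
    rw [smul_apply, norm_smul]
    exact mul_le_mul_of_nonneg_left (norm_BE_le x) (norm_nonneg _)
  have hu : IsUnit (1 - w • BE) := isUnit_one_sub_of_norm_lt_one hn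
  set v : E2 := Ring.inverse (1 - w • BE) y with hv
  have h1 : v - w • BE v = y := by
    have := congrArg (fun A : E2 →L[ℂ] E2 => A y) (Ring.mul_inverse_cancel _ hu)
    simpa using this
  refine ⟨v, fun n => ?_, ?_⟩
  · conv_rhs => rw [← h1]
    rw [E2.sub_apply, E2.smul_apply, BE_apply]; ring
  · have h2 : ‖v‖ - ‖w • BE v‖ ≤ ‖y‖ := by rw [← h1]; exact norm_sub_norm_le _ _
    rw [norm_smul] at h2
    have := mul_le_mul_of_nonneg_left (norm_BE_le v) (norm_nonneg w)
    linarith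

lemma dilation_rep {ζ : ℂ} (hζ : ‖ζ‖ = 1) {r : ℝ} (hr0 : 0 ≤ r) (hr1 : r < 1) {a d y : E2} {c : ℂ}
    (h : a = c • bas 0 + (y - conj ζ • SE y)) (hd : ∀ n, d n = (r : ℂ) ^ n * a n) :
    ∃ (c' : ℂ) (y' : E2), ‖y'‖ ≤ 2 * ‖y‖ ∧ d = c' • bas 0 + (y' - conj ζ • SE y') := by
  have hz : conj ζ * ζ = 1 := by
    rw [← Complex.normSq_eq_conj_mul_self, Complex.normSq_eq_norm_sq, hζ]; simp
  have hw : ‖(r : ℂ) * ζ‖ = r := by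
    rw [norm_mul, hζ, mul_one, Complex.norm_real, Real.norm_of_nonneg hr0]
  obtain ⟨v, hv, hvn⟩ := exists_backward_resolvent (w := r * ζ) (by rwa [hw]) y
  rw [hw] at hvn
  obtain ⟨dy, hdyn, hdy⟩ := exists_dilation hr0 hr1.le y
  obtain ⟨dv, hdvn, hdv⟩ := exists_dilation hr0 hr1.le v
  refine ⟨c + (1 - r) * v 0, dy - ((1 - r : ℝ) : ℂ) • dv, ?_, E2.ext fun n => ?_⟩
  · have h1 : ‖((1 - r : ℝ) : ℂ) • dv‖ ≤ ‖y‖ := by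
      rw [norm_smul, Complex.norm_real, Real.norm_of_nonneg (by linarith)]
      exact (mul_le_mul_of_nonneg_left hdvn (by linarith)).trans hvn
    linarith [norm_sub_le dy (((1 - r : ℝ) : ℂ) • dv)]
  · rw [hd, h, E2.add_apply, E2.sub_apply, E2.smul_apply, E2.smul_apply, E2.add_apply,
      E2.sub_apply, E2.smul_apply, E2.smul_apply, bas_apply, E2.sub_apply, E2.smul_apply, hdy, hdv]
    cases n with
    | zero =>
      rw [SE_zero, SE_zero]
      simp
    | succ n =>
      rw [SE_succ, SE_succ, E2.sub_apply, E2.smul_apply, hdy, hdv]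
      have hvn' := hv n
      simp only [Nat.succ_ne_zero, if_false]
      push_cast
      linear_combination (-(1 - (r : ℂ)) * r ^ n * conj ζ) * hvn' -
        (1 - (r : ℂ)) * r ^ (n + 1) * v (n + 1) * hz

end Dilation

section Multiplier

variable (μ : Measure ℂ) [IsFiniteMeasure μ] [Fact (OnCircle μ)]

lemma kv_ne_zero (z : Dsc) : kv μ z ≠ 0 := fun h => by
  have := inner_kv_oneH μ z
  rw [h, inner_zero_left] at this
  exact zero_ne_one this

variable {μ}

lemma IsMul.norm_symbol_le {b : Dsc → ℂ} {B : DH μ →L[ℂ] DH μ} (hB : IsMul (kv μ) b B)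
    (z : Dsc) : ‖b z‖ ≤ ‖B‖ := by
  have h1 := (ContinuousLinearMap.adjoint B).le_opNorm (kv μ z)
  rw [hB.adjoint_apply, norm_smul, RCLike.norm_conj, LinearIsometryEquiv.norm_map] at h1
  exact le_of_mul_le_mul_right h1 (norm_pos_iff.2 (kv_ne_zero μ z))

lemma IsMul.exists_symbol {b : Dsc → ℂ} {B : DH μ →L[ℂ] DH μ} (hB : IsMul (kv μ) b B) :
    ∃ β : ℂ → ℂ, HasCoef β (coef μ (B (oneH μ))) ∧ ∀ z : Dsc, β z = b z := by
  classical
  refine ⟨fun z => if hz : ‖z‖ < 1 then b ⟨z, hz⟩ else 0, ?_, fun z => dif_pos z.2⟩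
  refine hasCoef_inner _ fun z => ?_
  rw [dif_pos z.2, ← inner_kv, hB, inner_kv_oneH, mul_one]

lemma IsMul.comm_TH {b : Dsc → ℂ} {B : DH μ →L[ℂ] DH μ} (hB : IsMul (kv μ) b B) (f : DH μ) :
    B (TH μ f) = TH μ (B f) := by
  rw [← sub_eq_zero]
  refine eq_zero_of_inner_kv μ _ fun z => ?_
  rw [inner_sub_right, hB, inner_kv_TH, inner_kv_TH, hB]
  ring

lemma dz_dilated_mul_le {ζ : ℂ} (hζ : ‖ζ‖ = 1) {r : ℝ} (hr0 : 0 ≤ r) (hr1 : r < 1) {β : ℂ → ℂ}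
    {ψ : E2} (hβ : HasCoef β ψ) (hβ1 : ∀ z : Dsc, ‖β z‖ ≤ 1) {f g F : E2}
    (hg : ∀ z : Dsc, ⟪evec z, g⟫_ℂ = β z * ⟪evec z, f⟫_ℂ)
    (hF : ∀ z : Dsc, ⟪evec z, F⟫_ℂ = β (r * z) * ⟪evec z, f⟫_ℂ) :
    dz ζ F ≤ 8 * dz ζ g + 18 * dz ζ f := by
  by_cases hfin : dz ζ g = ∞
  · rw [hfin]; simp
  by_cases hfin' : dz ζ f = ∞
  · rw [hfin']; simp
  obtain ⟨c, u, hun, hu⟩ := exists_rep_of_dz_ne_top hζ hfin'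
  obtain ⟨c', v, hvn, hv⟩ := exists_rep_of_dz_ne_top hζ hfin
  have hu := eq_of_rep hζ hu
  have hv := eq_of_rep hζ hv
  have hrz : ∀ z : Dsc, ‖(r : ℂ) * z‖ < 1 := fun z => by
    rw [norm_mul, Complex.norm_real, Real.norm_of_nonneg hr0]
    exact mul_lt_one_of_nonneg_of_lt_one_left hr0 hr1 z.2.le
  obtain ⟨p, hpn, hp⟩ := exists_bounded_mul hβ.differentiableOn hβ1 u
  have hβr : DifferentiableOn ℂ (fun z => β (r * z)) disc := by
    refine hβ.differentiableOn.comp (by fun_prop) fun z hz => ?_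
    rw [disc, mem_ball_zero_iff] at hz ⊢
    exact hrz ⟨z, hz⟩
  obtain ⟨q, hqn, hq⟩ := exists_bounded_mul hβr (fun z => hβ1 ⟨_, hrz z⟩) u
  have hev : ∀ (z : Dsc) (c : ℂ) (y : E2), ⟪evec z, c • bas 0 + (y - conj ζ • SE y)⟫_ℂ =
      c + (1 - conj ζ * z) * ⟪evec z, y⟫_ℂ := fun z c y => by
    rw [inner_add_right, inner_sub_right, inner_smul_right, inner_smul_right, inner_evec_SE,
      inner_evec_bas_zero]
    ring
  have h1 : c • ψ = c' • bas 0 + ((v - p) - conj ζ • SE (v - p)) := by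
    refine E2.ext_evec fun z => ?_
    have e1 := hg z
    rw [hu, hv, hev, hev] at e1
    rw [hev, inner_smul_right, ← hβ.eq_inner, inner_sub_right, hp]
    linear_combination -e1
  obtain ⟨d, -, hd⟩ := exists_dilation hr0 hr1.le (c • ψ)
  obtain ⟨c'', y, hyn, hy⟩ := dilation_rep hζ hr0 hr1 h1 hd
  have h2 : F = c'' • bas 0 + ((y + q) - conj ζ • SE (y + q)) := by
    refine E2.ext_evec fun z => ?_
    have e1 := inner_evec_dilation hd (z := z) (w := ⟨_, hrz z⟩) rfl
    rw [hy, hev, inner_smul_right, ← hβ.eq_inner] at e1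
    rw [hF, hu, hev, hev, inner_add_right, hq]
    linear_combination -e1
  refine (dz_le_of_rep hζ _ (rep_of_eq hζ h2)).trans ?_
  rw [← ENNReal.ofReal_toReal hfin, ← ENNReal.ofReal_toReal hfin',
    show (8 : ℝ≥0∞) = ENNReal.ofReal 8 by simp, show (18 : ℝ≥0∞) = ENNReal.ofReal 18 by simp,
    ← ENNReal.ofReal_mul (by norm_num), ← ENNReal.ofReal_mul (by norm_num),
    ← ENNReal.ofReal_add (by positivity) (by positivity)]
  refine ENNReal.ofReal_le_ofReal ?_
  have h3 : ‖y + q‖ ≤ 2 * ‖v‖ + 3 * ‖u‖ := by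
    linarith [norm_add_le y q, norm_sub_le v p]
  have h4 := pow_le_pow_left₀ (norm_nonneg _) h3 2
  nlinarith [sq_nonneg (2 * ‖v‖ - 3 * ‖u‖)]

/-- Approximating the symbol by its dilations, inside a closed shift-invariant subspace. -/
lemma exists_dilated_mul {M : Submodule ℂ (DH μ)} (hMc : IsClosed (M : Set (DH μ)))
    (hT : ∀ f ∈ M, TH μ f ∈ M) {β : ℂ → ℂ} {ψ : E2} (hβ : HasCoef β ψ) {f : DH μ} (hf : f ∈ M)
    {r : ℝ} (hr0 : 0 ≤ r) (hr1 : r < 1) :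
    ∃ F ∈ M, ∀ z : Dsc, ⟪kv μ z, F⟫_ℂ = β (r * z) * ⟪kv μ z, f⟫_ℂ := by
  have hrz : ∀ z : Dsc, ‖(r : ℂ) * z‖ < 1 := fun z => by
    rw [norm_mul, Complex.norm_real, Real.norm_of_nonneg hr0]
    exact mul_lt_one_of_nonneg_of_lt_one_left hr0 hr1 z.2.le
  set A : ℝ := ‖f‖ + ‖TH μ f‖ with hA
  have hit : ∀ n, (TH μ)^[n] f ∈ M := fun n => by
    induction n with
    | zero => exact hf
    | succ n ih => rw [Function.iterate_succ_apply']; exact hT _ ih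
  have hitn : ∀ n : ℕ, ‖(TH μ)^[n] f‖ ≤ (n + 1) * A := fun n => by
    have h1 := normSq_TH_iterate_le μ f n
    refine (sq_le_sq₀ (norm_nonneg _) (by positivity)).1 (h1.trans ?_)
    rw [hA, mul_pow]
    have h2 : (0 : ℝ) ≤ n := Nat.cast_nonneg n
    have h3 := norm_nonneg f
    have h4 := norm_nonneg (TH μ f)
    have h5 : ‖f‖ ^ 2 + ‖TH μ f‖ ^ 2 ≤ (‖f‖ + ‖TH μ f‖) ^ 2 := by nlinarith
    calc _ ≤ ‖f‖ ^ 2 + n * ‖TH μ f‖ ^ 2 := by gcongr; nlinarith [sq_nonneg ‖f‖]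
      _ ≤ (n + 1) * (‖f‖ ^ 2 + ‖TH μ f‖ ^ 2) := by
        nlinarith [mul_nonneg h2 (sq_nonneg ‖f‖), sq_nonneg ‖TH μ f‖]
      _ ≤ (n + 1) ^ 2 * (‖f‖ + ‖TH μ f‖) ^ 2 := by
        gcongr
        nlinarith
  have hsum : Summable fun n : ℕ => (ψ n * (r : ℂ) ^ n) • (TH μ)^[n] f := by
    refine Summable.of_norm_bounded (g := fun n : ℕ => ‖ψ‖ * A * (((n : ℝ) + 1) * r ^ n)) ?_ ?_
    · refine Summable.mul_left _ ?_
      have h1 := summable_pow_mul_geometric_of_norm_lt_one (R := ℝ) 1 (r := r)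
        (by rwa [Real.norm_of_nonneg hr0])
      have h2 := summable_geometric_of_lt_one hr0 hr1
      refine (h1.add h2).congr fun n => ?_
      ring
    · intro n
      rw [norm_smul, norm_mul, norm_pow, Complex.norm_real, Real.norm_of_nonneg hr0]
      calc _ ≤ ‖ψ‖ * r ^ n * ((n + 1) * A) := by
            gcongr
            · exact E2.norm_coord_le ψ n
            · exact hitn n
        _ = _ := by ring
  refine ⟨∑' n, (ψ n * (r : ℂ) ^ n) • (TH μ)^[n] f, ?_, fun z => ?_⟩
  · refine hMc.mem_of_tendsto hsum.hasSum (Eventually.of_forall fun s => ?_)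
    exact M.sum_mem fun n _ => M.smul_mem _ (hit n)
  · have hin : ∀ n, ⟪kv μ z, (TH μ)^[n] f⟫_ℂ = (z : ℂ) ^ n * ⟪kv μ z, f⟫_ℂ := fun n => by
      induction n with
      | zero => simp
      | succ n ih => rw [Function.iterate_succ_apply', inner_kv_TH, ih]; ring
    have h1 := hsum.hasSum.mapL (innerSL ℂ (kv μ z))
    have h2 := (hβ _ (hrz z)).mul_right ⟪kv μ z, f⟫_ℂ
    refine h1.unique ?_
    rw [show (fun n => innerSL ℂ (kv μ z) ((ψ n * (r : ℂ) ^ n) • (TH μ)^[n] f)) =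
      fun n => ψ n * (r * (z : ℂ)) ^ n * ⟪kv μ z, f⟫_ℂ from funext fun n => by
        rw [innerSL_apply_apply, inner_smul_right, hin]; ring]
    exact h2

lemma mem_of_tendsto_inner {E : Type*} [NormedAddCommGroup E] [InnerProductSpace ℂ E]
    [CompleteSpace E] {M : Submodule ℂ E} (hMc : IsClosed (M : Set E)) {f : ℕ → E} {g : E}
    (hf : ∀ n, f n ∈ M) (h : ∀ y, Tendsto (fun n => ⟪y, f n⟫_ℂ) atTop (𝓝 ⟪y, g⟫_ℂ)) : g ∈ M := by
  have : CompleteSpace M := hMc.completeSpace_coe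
  rw [← M.orthogonal_orthogonal, Submodule.mem_orthogonal]
  intro y hy
  refine tendsto_nhds_unique (h y) ?_
  simp only [(Submodule.mem_orthogonal' _ _).1 hy _ (hf _)]
  exact tendsto_const_nhds

/-- Closed shift-invariant subspaces are invariant under contractive multipliers. -/
theorem IsMul.apply_mem {M : Submodule ℂ (DH μ)} (hMc : IsClosed (M : Set (DH μ)))
    (hT : ∀ f ∈ M, TH μ f ∈ M) {b : Dsc → ℂ} {B : DH μ →L[ℂ] DH μ} (hB : IsMul (kv μ) b B)
    (hB1 : ∀ f, ‖B f‖ ≤ ‖f‖) {f : DH μ} (hf : f ∈ M) : B f ∈ M := by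
  obtain ⟨β, hβ, hβb⟩ := hB.exists_symbol
  have hβ1 : ∀ z : Dsc, ‖β z‖ ≤ 1 := fun z => by
    rw [hβb]
    exact (hB.norm_symbol_le z).trans
      (ContinuousLinearMap.opNorm_le_bound _ zero_le_one (by simpa using hB1))
  set r : ℕ → ℝ := fun n => 1 - 1 / ((n : ℝ) + 1) with hr
  have hr0 : ∀ n, 0 ≤ r n := fun n => by
    rw [hr, sub_nonneg, div_le_one (by positivity)]
    linarith [Nat.cast_nonneg (α := ℝ) n]
  have hr1 : ∀ n, r n < 1 := fun n => by
    have : 0 < 1 / ((n : ℝ) + 1) := by positivity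
    simp only [hr]; linarith
  choose F hFM hF using fun n => exists_dilated_mul hMc hT hβ hf (hr0 n) (hr1 n)
  have hrz : ∀ n, ∀ z : Dsc, ‖(r n : ℂ) * z‖ < 1 := fun n z => by
    rw [norm_mul, Complex.norm_real, Real.norm_of_nonneg (hr0 n)]
    exact mul_lt_one_of_nonneg_of_lt_one_left (hr0 n) (hr1 n) z.2.le
  have hlim : Tendsto r atTop (𝓝 1) := by
    simpa [hr] using (tendsto_one_div_add_atTop_nhds_zero_nat (𝕜 := ℝ)).const_sub 1
  have hDir : ∀ n, Dir μ (coef μ (F n)) ≤ 8 * Dir μ (coef μ (B f)) + 18 * Dir μ (coef μ f) := by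
    intro n
    rw [Dir, Dir, Dir, ← lintegral_const_mul _ (measurable_dz _),
      ← lintegral_const_mul _ (measurable_dz _), ← lintegral_add_left
      ((measurable_dz _).const_mul _)]
    refine lintegral_mono_ae ?_
    filter_upwards [ae_norm_eq_one μ] with ζ hζ
    refine dz_dilated_mul_le hζ (hr0 n) (hr1 n) hβ hβ1 (fun z => ?_) fun z => ?_
    · rw [← inner_kv, ← inner_kv, hB, hβb]
    · rw [← inner_kv, ← inner_kv, hF]
  have hcoef : ∀ n, ‖coef μ (F n)‖ ≤ ‖coef μ f‖ := by
    intro n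
    have hβr : DifferentiableOn ℂ (fun z => β (r n * z)) disc := by
      refine hβ.differentiableOn.comp (by fun_prop) fun z hz => ?_
      rw [disc, mem_ball_zero_iff] at hz ⊢
      exact hrz n ⟨z, hz⟩
    obtain ⟨q, hqn, hq⟩ := exists_bounded_mul hβr (fun z => hβ1 ⟨_, hrz n z⟩) (coef μ f)
    rwa [show coef μ (F n) = q from E2.ext_evec fun z => by
      rw [hq, ← inner_kv, ← inner_kv, hF]]
  have hfin : 8 * Dir μ (coef μ (B f)) + 18 * Dir μ (coef μ f) ≠ ∞ := by
    refine ENNReal.add_ne_top.2 ⟨ENNReal.mul_ne_top (by simp) (Dir_coef_ne_top μ _),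
      ENNReal.mul_ne_top (by simp) (Dir_coef_ne_top μ _)⟩
  have hn : ∀ n, ‖F n‖ ≤ Real.sqrt (‖coef μ f‖ ^ 2 +
      (8 * Dir μ (coef μ (B f)) + 18 * Dir μ (coef μ f)).toReal) := fun n => by
    refine Real.le_sqrt_of_sq_le ?_
    rw [DH.normSq]
    exact add_le_add (pow_le_pow_left₀ (norm_nonneg _) (hcoef n) 2)
      (ENNReal.toReal_mono hfin (hDir n))
  refine mem_of_tendsto_inner hMc hFM (DH.tendsto_inner μ hn fun z => ?_)
  rw [hB f z, ← hβb]
  simp only [hF]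
  refine Tendsto.mul_const _ ?_
  have hc : ContinuousAt β z :=
    hβ.differentiableOn.continuousOn.continuousAt (isOpen_ball.mem_nhds (by
      rw [mem_ball_zero_iff]; exact z.2))
  refine hc.tendsto.comp ?_
  have h1 : Tendsto (fun n => (r n : ℂ)) atTop (𝓝 1) := by
    have h2 := (Complex.continuous_ofReal.tendsto 1).comp hlim
    rwa [Complex.ofReal_one] at h2
  simpa using h1.mul_const (z : ℂ)

end Multiplier

section Generator

variable {μ : Measure ℂ} [IsFiniteMeasure μ] [Fact (OnCircle μ)]

lemma IsMul.comm {b b' : Dsc → ℂ} {B B' : DH μ →L[ℂ] DH μ} (hB : IsMul (kv μ) b B)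
    (hB' : IsMul (kv μ) b' B') (f : DH μ) : B (B' f) = B' (B f) := by
  rw [← sub_eq_zero]
  refine eq_zero_of_inner_kv μ _ fun z => ?_
  rw [inner_sub_right, hB, hB', hB', hB]
  ring

lemma TH_injective : Function.Injective (TH μ) := fun x y h => by
  rw [← LH_TH μ x, h, LH_TH]

/-- Factorization of the reproducing kernel of a closed shift-invariant subspace. -/
theorem exists_mul_kv {M : Submodule ℂ (DH μ)} (hMc : IsClosed (M : Set (DH μ)))
    (hT : ∀ f ∈ M, TH μ f ∈ M) [M.HasOrthogonalProjection] (w : Dsc) :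
    ∃ (b : Dsc → ℂ) (B : DH μ →L[ℂ] DH μ), IsMul (kv μ) b B ∧ (∀ f, B f ∈ M) ∧
      M.starProjection (kv μ w) = B (kv μ w) := by
  obtain ⟨P, hP, hkP⟩ := exists_pick_kernel μ
  exact exists_kernel_factor (eq_zero_of_inner_kv μ) hP hkP M
    (fun b B hB hB1 f hf => hB.apply_mem hMc hT hB1 hf) w

/-- `f ↦ (f - f(0) φ / φ(0)) / z`. -/
def divOp (φ : DH μ) : DH μ →L[ℂ] DH μ :=
  LH μ ∘L (ContinuousLinearMap.id ℂ (DH μ) -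
    ((coef μ φ 0)⁻¹ • innerSL ℂ (oneH μ)).smulRight φ)

lemma divOp_apply (φ f : DH μ) :
    divOp φ f = LH μ (f - ((coef μ φ 0)⁻¹ * coef μ f 0) • φ) := by
  simp [divOp, inner_oneH]

lemma TH_divOp {φ : DH μ} (hφ : coef μ φ 0 ≠ 0) (f : DH μ) :
    TH μ (divOp φ f) = f - ((coef μ φ 0)⁻¹ * coef μ f 0) • φ := by
  rw [divOp_apply, TH_LH_of_coef_zero]
  rw [map_sub, map_smul, E2.sub_apply, E2.smul_apply]
  field_simp
  ring

lemma divOp_mem {M : Submodule ℂ (DH μ)} (hMc : IsClosed (M : Set (DH μ)))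
    (hT : ∀ f ∈ M, TH μ f ∈ M) {b : Dsc → ℂ} {B : DH μ →L[ℂ] DH μ} (hB : IsMul (kv μ) b B)
    (hBM : ∀ f, B f ∈ M) (h0 : coef μ (B (oneH μ)) 0 ≠ 0) {f : DH μ} (hf : f ∈ M) :
    divOp (B (oneH μ)) f ∈ M := by
  have : CompleteSpace M := hMc.completeSpace_coe
  choose b' B' hB' hBM' hp using exists_mul_kv hMc hT
  set φ := B (oneH μ) with hφ
  have hev : ∀ q, coef μ (B q) 0 = coef μ φ 0 * coef μ q 0 := fun q => by
    simp only [← inner_oneH, ← kv_o, hφ]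
    rw [hB, hB, kv_o, inner_oneH, inner_oneH, coef_oneH, bas_apply]
    simp
  have key : ∀ w q, divOp φ (B' w q) ∈ M := fun w q => by
    have h1 : coef μ φ 0 • divOp φ (B' w q) =
        B (LH μ (B' w q)) - B' w (LH μ (B q - coef μ φ 0 • q)) := by
      refine TH_injective ?_
      rw [map_smul, TH_divOp h0, map_sub, ← hB.comm_TH, ← (hB' w).comm_TH, TH_LH,
        TH_LH_of_coef_zero]
      · rw [map_sub, map_sub, map_smul, map_smul, hB.comm (hB' w), smul_sub, smul_smul,
          mul_inv_cancel_left₀ h0]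
        abel
      · rw [map_sub, map_smul, E2.sub_apply, E2.smul_apply, hev, sub_self]
    have h2 : divOp φ (B' w q) = (coef μ φ 0)⁻¹ • (coef μ φ 0 • divOp φ (B' w q)) := by
      rw [smul_smul, inv_mul_cancel₀ h0, one_smul]
    rw [h2, h1]
    exact M.smul_mem _ (M.sub_mem (hBM _) (hBM' _ _))
  have hcl : IsClosed ((divOp φ ∘L M.starProjection) ⁻¹' (M : Set (DH μ))) :=
    hMc.preimage (ContinuousLinearMap.continuous _)
  have hall : ∀ y, y ∈ (divOp φ ∘L M.starProjection) ⁻¹' (M : Set (DH μ)) := fun y => by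
    refine closure_minimal (fun x hx => ?_) hcl (dense_span_kv μ y)
    induction hx using Submodule.span_induction with
    | mem x hx =>
      obtain ⟨w, rfl⟩ := hx
      simp only [Set.mem_preimage, ContinuousLinearMap.comp_apply, hp]
      exact key w _
    | zero => simp
    | add x y _ _ hx hy =>
      simp only [Set.mem_preimage, map_add]
      exact M.add_mem hx hy
    | smul c x _ hx =>
      simp only [Set.mem_preimage, map_smul]
      exact M.smul_mem c hx
  have := hall f
  rwa [Set.mem_preimage, ContinuousLinearMap.comp_apply,
    M.starProjection_eq_self_iff.2 hf] at this

lemma eq_sum_add_iterate {φ : DH μ} (hφ : coef μ φ 0 ≠ 0) (x : DH μ) (n : ℕ) :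
    ∃ y ∈ Submodule.span ℂ (Set.range fun i => (TH μ)^[i] φ),
      x = y + (TH μ)^[n] ((divOp φ)^[n] x) := by
  induction n with
  | zero => exact ⟨0, Submodule.zero_mem _, by simp⟩
  | succ n ih =>
    obtain ⟨y, hy, hxy⟩ := ih
    refine ⟨y + ((coef μ φ 0)⁻¹ * coef μ ((divOp φ)^[n] x) 0) • (TH μ)^[n] φ,
      Submodule.add_mem _ hy (Submodule.smul_mem _ _ (Submodule.subset_span ⟨n, rfl⟩)), ?_⟩
    conv_lhs => rw [hxy]
    rw [Function.iterate_succ_apply (TH μ), Function.iterate_succ_apply' (divOp φ),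
      TH_divOp hφ, ← FunLike.coe_pow_eq_iterate, map_sub, map_smul]
    abel

lemma inner_kv_TH_iterate (z : Dsc) (x : DH μ) (n : ℕ) :
    ⟪kv μ z, (TH μ)^[n] x⟫_ℂ = (z : ℂ) ^ n * ⟪kv μ z, x⟫_ℂ := by
  induction n with
  | zero => simp
  | succ n ih => rw [Function.iterate_succ_apply', inner_kv_TH, ih]; ring

lemma eq_zero_of_inner_iterate {M : Submodule ℂ (DH μ)} {φ : DH μ} (h0 : coef μ φ 0 ≠ 0)
    (hφ : ∀ y ∈ M, ⟪φ, TH μ y⟫_ℂ = 0) (hdiv : ∀ y ∈ M, divOp φ y ∈ M) {x : DH μ} (hx : x ∈ M)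
    (hort : ∀ i, ⟪x, (TH μ)^[i] φ⟫_ℂ = 0) : x = 0 := by
  set y : ℕ → DH μ := fun n => (divOp φ)^[n] x with hy
  have hyM : ∀ n, y n ∈ M := fun n => by
    induction n with
    | zero => exact hx
    | succ n ih => simp only [hy]; rw [Function.iterate_succ_apply']; exact hdiv _ ih
  have hTy : ∀ n, ‖TH μ (y (n + 1))‖ ^ 2 ≤ ‖y n‖ ^ 2 := fun n => by
    have h1 : y n = ((coef μ φ 0)⁻¹ * coef μ (y n) 0) • φ + TH μ (y (n + 1)) := by
      simp only [hy]
      rw [Function.iterate_succ_apply', TH_divOp h0]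
      abel
    have h2 := @norm_add_sq ℂ _ _ _ _ (((coef μ φ 0)⁻¹ * coef μ (y n) 0) • φ) (TH μ (y (n + 1)))
    rw [← h1, inner_smul_left, hφ _ (hyM _), mul_zero, map_zero] at h2
    nlinarith [sq_nonneg ‖((coef μ φ 0)⁻¹ * coef μ (y n) 0) • φ‖]
  have hmono : ∀ n, ‖y (n + 1)‖ ^ 2 ≤ ‖y n‖ ^ 2 := fun n =>
    (pow_le_pow_left₀ (norm_nonneg _) (norm_le_norm_TH μ _) 2).trans (hTy n)
  have hle : ∀ n, ‖y n‖ ^ 2 ≤ ‖x‖ ^ 2 := fun n => by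
    induction n with
    | zero => exact le_rfl
    | succ n ih => exact (hmono n).trans ih
  set d : ℕ → ℝ := fun n => ‖y n‖ ^ 2 - ‖y (n + 1)‖ ^ 2 with hd
  have hd0 : ∀ n, 0 ≤ d n := fun n => sub_nonneg.2 (hmono n)
  have hsum : Summable d := by
    refine summable_of_sum_range_le (c := ‖x‖ ^ 2) hd0 fun n => ?_
    rw [hd, Finset.sum_range_sub']
    have : ‖y 0‖ = ‖x‖ := rfl
    rw [this]
    linarith [sq_nonneg ‖y n‖]
  have hfreq : ∃ᶠ n : ℕ in atTop, ((n : ℝ) + 1) * d n ≤ 1 := by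
    intro hev
    refine Real.not_summable_one_div_natCast ((summable_nat_add_iff 1).1 ?_)
    refine summable_of_isBigO_nat hsum (Asymptotics.IsBigO.of_bound 1 ?_)
    filter_upwards [hev] with n hn
    rw [one_mul, Real.norm_of_nonneg (by positivity), Real.norm_of_nonneg (hd0 n)]
    push_cast
    rw [div_le_iff₀ (by positivity)]
    linarith
  obtain ⟨s, hs, hsd⟩ := extraction_of_frequently_atTop hfreq
  set F : ℕ → DH μ := fun n => (TH μ)^[s n + 1] (y (s n + 1)) with hF
  have hFn : ∀ n, ‖F n‖ ≤ Real.sqrt (‖x‖ ^ 2 + 1) := fun n => by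
    refine Real.le_sqrt_of_sq_le ((normSq_TH_iterate_le μ _ _).trans ?_)
    have h1 := hTy (s n)
    have h2 := hsd n
    have h3 : ‖TH μ (y (s n + 1))‖ ^ 2 - ‖y (s n + 1)‖ ^ 2 ≤ d (s n) := by
      simp only [hd]; linarith
    have h4 := mul_le_mul_of_nonneg_left h3 (by positivity : (0 : ℝ) ≤ (s n : ℝ) + 1)
    push_cast
    linarith [hle (s n + 1)]
  have hlim := DH.tendsto_inner μ (l := atTop) (g := 0) hFn (fun z => by
    rw [inner_zero_right]
    have hz : Tendsto (fun n => ‖(z : ℂ)‖ ^ (s n + 1) * (‖kv μ z‖ * ‖x‖)) atTop (𝓝 0) := by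
      have h1 := (tendsto_pow_atTop_nhds_zero_of_lt_one (norm_nonneg (z : ℂ)) z.2).comp
        ((tendsto_add_atTop_nat 1).comp hs.tendsto_atTop)
      simpa using h1.mul_const (‖kv μ z‖ * ‖x‖)
    refine squeeze_zero_norm (fun n => ?_) hz
    rw [hF, inner_kv_TH_iterate, norm_mul, norm_pow]
    refine mul_le_mul_of_nonneg_left ((norm_inner_le_norm _ _).trans ?_) (by positivity)
    refine mul_le_mul_of_nonneg_left ?_ (norm_nonneg _)
    exact (sq_le_sq₀ (norm_nonneg _) (norm_nonneg _)).1 (hle _)) x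
  have hconst : ∀ n, ⟪x, F n⟫_ℂ = ⟪x, x⟫_ℂ := fun n => by
    obtain ⟨v, hv, hxv⟩ := eq_sum_add_iterate h0 x (s n + 1)
    have h1 : ⟪x, v⟫_ℂ = 0 := by
      have : Submodule.span ℂ (Set.range fun i => (TH μ)^[i] φ) ≤ (ℂ ∙ x)ᗮ := by
        rw [Submodule.span_le]
        rintro _ ⟨i, rfl⟩
        exact Submodule.mem_orthogonal_singleton_iff_inner_right.2 (hort i)
      exact Submodule.mem_orthogonal_singleton_iff_inner_right.1 (this hv)
    rw [show F n = x - v from eq_sub_iff_add_eq'.2 hxv.symm, inner_sub_right, h1, sub_zero]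
  simp only [hconst, inner_zero_right] at hlim
  exact inner_self_eq_zero.1 (tendsto_nhds_unique tendsto_const_nhds hlim)

lemma eq_closure_of_projection_ne_zero {M : Submodule ℂ (DH μ)}
    (hMc : IsClosed (M : Set (DH μ))) (hT : ∀ f ∈ M, TH μ f ∈ M)
    (h1 : ∃ f ∈ M, coef μ f 0 ≠ 0) :
    ∃ (b : Dsc → ℂ) (B : DH μ →L[ℂ] DH μ), IsMul (kv μ) b B ∧
      M = (Submodule.span ℂ (Set.range fun i => (TH μ)^[i] (B (oneH μ)))).topologicalClosure := by
  have : CompleteSpace M := hMc.completeSpace_coe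
  obtain ⟨b, B, hB, hBM, hp⟩ := exists_mul_kv hMc hT o
  rw [kv_o] at hp
  refine ⟨b, B, hB, ?_⟩
  set φ := B (oneH μ) with hφ
  have hin : ∀ y ∈ M, ⟪φ, y⟫_ℂ = coef μ y 0 := fun y hy => by
    rw [← hp, Submodule.inner_starProjection_left_eq_right, M.starProjection_eq_self_iff.2 hy,
      inner_oneH]
  have h0 : coef μ φ 0 ≠ 0 := by
    rw [← hin φ (hBM _)]
    obtain ⟨f, hf, hf0⟩ := h1
    rw [inner_self_ne_zero]
    intro h
    rw [← hin f hf, h, inner_zero_left] at hf0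
    exact hf0 rfl
  set K := (Submodule.span ℂ (Set.range fun i => (TH μ)^[i] φ)).topologicalClosure with hK
  have hKM : K ≤ M := by
    refine Submodule.topologicalClosure_minimal _ ?_ hMc
    rw [Submodule.span_le]
    rintro _ ⟨i, rfl⟩
    induction i with
    | zero => exact hBM _
    | succ n ih => simp only [Function.iterate_succ_apply']; exact hT _ ih
  have : CompleteSpace K := (Submodule.isClosed_topologicalClosure _).completeSpace_coe
  refine le_antisymm (fun x hx => ?_) hKM
  have hz : x - K.starProjection x = 0 := by
    refine eq_zero_of_inner_iterate (M := M) h0 (fun y hy => ?_)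
      (fun y hy => divOp_mem hMc hT hB hBM h0 hy)
      (M.sub_mem hx (hKM (K.starProjection_apply_mem x))) fun i => ?_
    · rw [hin _ (hT y hy), coef_TH, SE_zero]
    · exact K.starProjection_inner_eq_zero x _
        (Submodule.le_topologicalClosure _ (Submodule.subset_span ⟨i, rfl⟩))
  rw [sub_eq_zero.1 hz]
  exact K.starProjection_apply_mem x

lemma coef_LH_iterate (x : DH μ) (n i : ℕ) : coef μ ((LH μ)^[n] x) i = coef μ x (n + i) := by
  induction n generalizing i with
  | zero => simp
  | succ n ih => rw [Function.iterate_succ_apply', coef_LH, BE_apply, ih, show n + (i + 1) = n + 1 + i by ring]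

lemma TH_iterate_LH_iterate {x : DH μ} {n : ℕ} (h : ∀ i < n, coef μ x i = 0) :
    (TH μ)^[n] ((LH μ)^[n] x) = x := by
  induction n with
  | zero => rfl
  | succ n ih =>
    rw [Function.iterate_succ_apply, Function.iterate_succ_apply' (LH μ), TH_LH_of_coef_zero,
      ih fun i hi => h i (by lia)]
    rw [coef_LH_iterate]
    exact h _ (by lia)

/-- Closed shift-invariant subspaces are generated by the image of `1` under a multiplier. -/
theorem exists_isMul_generator {M : Submodule ℂ (DH μ)} (hMc : IsClosed (M : Set (DH μ)))
    (hT : ∀ f ∈ M, TH μ f ∈ M) :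
    ∃ (b : Dsc → ℂ) (B : DH μ →L[ℂ] DH μ), IsMul (kv μ) b B ∧
      M = (Submodule.span ℂ (Set.range fun i => (TH μ)^[i] (B (oneH μ)))).topologicalClosure := by
  classical
  by_cases hM : ∃ n, ∃ f ∈ M, coef μ f n ≠ 0
  · set n := Nat.find hM with hn
    obtain ⟨f, hf, hfn⟩ := Nat.find_spec hM
    have hlt : ∀ g ∈ M, ∀ i < n, coef μ g i = 0 := fun g hg i hi => by
      by_contra h
      exact Nat.find_min hM hi ⟨g, hg, h⟩
    set M' : Submodule ℂ (DH μ) := M.comap ((TH μ ^ n : DH μ →L[ℂ] DH μ) : DH μ →ₗ[ℂ] DH μ)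
      with hM'
    have hmem : ∀ x, x ∈ M' ↔ (TH μ)^[n] x ∈ M := fun x => by
      rw [hM', Submodule.mem_comap, ContinuousLinearMap.coe_coe, FunLike.coe_pow_eq_iterate]
    have hL : ∀ x ∈ M, (LH μ)^[n] x ∈ M' := fun x hx => by
      rw [hmem, TH_iterate_LH_iterate (hlt x hx)]; exact hx
    obtain ⟨b, B, hB, hBM⟩ := eq_closure_of_projection_ne_zero (M := M')
      (hMc.preimage (TH μ ^ n : DH μ →L[ℂ] DH μ).continuous)
      (fun x hx => by
        rw [hmem] at hx ⊢
        rw [← Function.iterate_succ_apply, Function.iterate_succ_apply']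
        exact hT _ hx)
      ⟨_, hL f hf, by rwa [coef_LH_iterate]⟩
    refine ⟨fun z => (z : ℂ) ^ n * b z, (TH μ ^ n) ∘L B, fun x z => ?_, ?_⟩
    · rw [ContinuousLinearMap.comp_apply, FunLike.coe_pow_eq_iterate, inner_kv_TH_iterate, hB]
      ring
    · have hcomm : ∀ i, (TH μ)^[i] (((TH μ ^ n) ∘L B) (oneH μ)) =
          (TH μ ^ n : DH μ →L[ℂ] DH μ) ((TH μ)^[i] (B (oneH μ))) := fun i => by
        rw [ContinuousLinearMap.comp_apply, FunLike.coe_pow_eq_iterate,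
          ← Function.iterate_add_apply, ← Function.iterate_add_apply, add_comm]
      simp only [hcomm]
      refine le_antisymm (fun x hx => ?_) (Submodule.topologicalClosure_minimal _ ?_ hMc)
      · have h1 := hL x hx
        rw [hBM] at h1
        rw [← TH_iterate_LH_iterate (hlt x hx), ← FunLike.coe_pow_eq_iterate]
        refine map_mem_closure (TH μ ^ n : DH μ →L[ℂ] DH μ).continuous h1 fun y hy => ?_
        induction hy using Submodule.span_induction with
        | mem y hy =>
          obtain ⟨i, rfl⟩ := hy
          exact Submodule.subset_span ⟨i, rfl⟩
        | zero => simp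
        | add y z _ _ hy hz => rw [map_add]; exact Submodule.add_mem _ hy hz
        | smul c y _ hy => rw [map_smul]; exact Submodule.smul_mem _ c hy
      · rw [Submodule.span_le]
        rintro _ ⟨i, rfl⟩
        have h1 : (TH μ)^[i] (B (oneH μ)) ∈ M' := by
          rw [hBM]
          exact Submodule.le_topologicalClosure _ (Submodule.subset_span ⟨i, rfl⟩)
        exact h1
  · push Not at hM
    have hbot : M = ⊥ := by
      rw [Submodule.eq_bot_iff]
      intro x hx
      exact DH.ext μ fun n => by rw [hM n x hx, map_zero]; rfl
    refine ⟨0, 0, fun x z => by simp, ?_⟩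
    have : Submodule.span ℂ (Set.range fun i => (TH μ)^[i] ((0 : DH μ →L[ℂ] DH μ) (oneH μ))) =
        ⊥ := by
      rw [Submodule.span_eq_bot]
      rintro _ ⟨i, rfl⟩
      induction i with
      | zero => rfl
      | succ n ih => simp only [Function.iterate_succ_apply'] at ih ⊢; rw [ih, map_zero]
    rw [this, hbot]
    refine le_antisymm bot_le (Submodule.topologicalClosure_minimal _ le_rfl ?_)
    rw [Submodule.bot_coe]
    exact isClosed_singleton

end Generator

section AreaIntegral

variable {f : ℂ → ℂ} {a : ℕ → ℂ}

lemma lintegral_circle {c : ℕ → ℂ} (h : HasCoef f c) {r : ℝ} (hr0 : 0 ≤ r) (hr1 : r < 1) :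
    ∫⁻ t in Set.Ioo (-Real.pi) Real.pi, ENNReal.ofReal (‖f ((r : ℂ) * bpt t)‖ ^ 2) =
      ENNReal.ofReal (2 * Real.pi) * ∑' k, ENNReal.ofReal (‖c k‖ ^ 2 * r ^ (2 * k)) := by
  have hcont : Continuous fun t => ‖f ((r : ℂ) * bpt t)‖ ^ 2 := by
    refine (ContinuousOn.comp_continuous h.differentiableOn.continuousOn
      (f := fun t => (r : ℂ) * bpt t) (by have := continuous_bpt; fun_prop) fun t => ?_).norm.pow 2
    rw [disc, mem_ball_zero_iff, norm_real_mul_bpt hr0]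
    exact hr1
  have hper : Function.Periodic (fun t => ‖f ((r : ℂ) * bpt t)‖ ^ 2) (2 * Real.pi) := fun t => by
    simp only [← circleMap_eq_bpt]
    rw [periodic_circleMap 0 1 t]
  have h1 := h.circle_parseval hr0 hr1
  have h2 := hper.intervalIntegral_add_eq 0 (-Real.pi)
  rw [zero_add, show -Real.pi + 2 * Real.pi = Real.pi by ring] at h2
  rw [h2] at h1
  rw [← ENNReal.ofReal_tsum_of_nonneg (fun _ => by positivity) h1.summable, h1.tsum_eq,
    ← ENNReal.ofReal_mul (by positivity), ← ofReal_integral_eq_lintegral_ofReal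
      (hcont.integrableOn_Icc.mono_set Set.Ioo_subset_Icc_self)
      (Eventually.of_forall fun _ => by positivity),
    ← integral_Ioc_eq_integral_Ioo, ← intervalIntegral.integral_of_le (by
      linarith [Real.pi_pos])]
  congr 1
  field_simp

lemma lintegral_radial (k : ℕ) :
    ∫⁻ r in Set.Ioo (0 : ℝ) 1, ENNReal.ofReal (r * (1 - r ^ 2) * r ^ (2 * k)) =
      ENNReal.ofReal (1 / (2 * ((k + 1) * (k + 2)))) := by
  rw [← ofReal_integral_eq_lintegral_ofReal]
  · rw [← integral_Ioc_eq_integral_Ioo, ← intervalIntegral.integral_of_le zero_le_one]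
    have h1 : ∀ r : ℝ, r * (1 - r ^ 2) * r ^ (2 * k) = r ^ (2 * k + 1) - r ^ (2 * k + 3) :=
      fun r => by ring
    simp only [h1]
    rw [intervalIntegral.integral_sub (by simp) (by simp), integral_pow, integral_pow]
    congr 1
    push_cast
    simp only [one_pow, zero_pow (Nat.succ_ne_zero _)]
    field_simp
    ring
  · have : Continuous fun r : ℝ => r * (1 - r ^ 2) * r ^ (2 * k) := by fun_prop
    exact this.integrableOn_Icc.mono_set Set.Ioo_subset_Icc_self
  · filter_upwards [ae_restrict_mem measurableSet_Ioo] with r hr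
    have h1 : 0 ≤ 1 - r ^ 2 := by nlinarith [hr.1, hr.2]
    have h2 := hr.1.le
    simp only [Pi.zero_apply]
    positivity

lemma HasCoef.lintegral_disc {c : ℕ → ℂ} (h : HasCoef f c) :
    ∫⁻ z in disc, ENNReal.ofReal (‖f z‖ ^ 2 * (1 - ‖z‖ ^ 2)) =
      ENNReal.ofReal Real.pi * ∑' k : ℕ, ENNReal.ofReal (‖c k‖ ^ 2 / ((k + 1) * (k + 2))) := by
  classical
  have hms : MeasurableSet disc := measurableSet_ball
  set Φ : ℂ → ℝ≥0∞ := disc.indicator fun z => ENNReal.ofReal (‖f z‖ ^ 2 * (1 - ‖z‖ ^ 2)) with hΦ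
  have hΦm : Measurable Φ := by
    have hc : ContinuousOn (fun z => ENNReal.ofReal (‖f z‖ ^ 2 * (1 - ‖z‖ ^ 2))) disc := by
      refine ENNReal.continuous_ofReal.comp_continuousOn ?_
      exact (h.differentiableOn.continuousOn.norm.pow 2).mul (by fun_prop)
    have := hc.measurable_piecewise (g := (0 : ℂ → ℝ≥0∞)) continuousOn_const hms
    rwa [Set.piecewise_eq_indicator] at this
  have hsymm : ∀ p : ℝ × ℝ, Complex.polarCoord.symm p = (p.1 : ℂ) * bpt p.2 := fun p => by
    rw [Complex.polarCoord_symm_apply, bpt, mul_comm Complex.I, Complex.exp_mul_I]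
    push_cast
    rfl
  have hpm : Measurable fun p : ℝ × ℝ => ENNReal.ofReal p.1 * Φ (p.1 * bpt p.2) := by
    have h1 : Measurable fun p : ℝ × ℝ => (p.1 : ℂ) * bpt p.2 := by
      have := continuous_bpt
      exact Continuous.measurable (by fun_prop)
    exact (by fun_prop : Measurable fun p : ℝ × ℝ => ENNReal.ofReal p.1).mul (hΦm.comp h1)
  have hin : ∀ r ∈ Set.Ioi (0 : ℝ), ∫⁻ t in Set.Ioo (-Real.pi) Real.pi,
      ENNReal.ofReal r * Φ (r * bpt t) = (Set.Ioo (0 : ℝ) 1).indicator (fun r =>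
        ∑' k, ENNReal.ofReal (2 * Real.pi * ‖c k‖ ^ 2) *
          ENNReal.ofReal (r * (1 - r ^ 2) * r ^ (2 * k))) r := fun r hr => by
    have hr0 : 0 < r := hr
    by_cases hr1 : r < 1
    · have h1 : 0 ≤ 1 - r ^ 2 := by nlinarith
      rw [Set.indicator_of_mem (show r ∈ Set.Ioo (0 : ℝ) 1 from ⟨hr0, hr1⟩)]
      have h2 : ∀ t, ENNReal.ofReal r * Φ (r * bpt t) = ENNReal.ofReal (r * (1 - r ^ 2)) *
          ENNReal.ofReal (‖f ((r : ℂ) * bpt t)‖ ^ 2) := fun t => by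
        rw [hΦ, Set.indicator_of_mem, norm_real_mul_bpt hr0.le, ENNReal.ofReal_mul (by positivity),
          ENNReal.ofReal_mul hr0.le]
        · ring
        · rw [disc, mem_ball_zero_iff, norm_real_mul_bpt hr0.le]
          exact hr1
      simp only [h2]
      rw [lintegral_const_mul' _ _ ENNReal.ofReal_ne_top, lintegral_circle h hr0.le hr1,
        ← ENNReal.tsum_mul_left, ← ENNReal.tsum_mul_left]
      refine tsum_congr fun k => ?_
      rw [← ENNReal.ofReal_mul (by positivity), ← ENNReal.ofReal_mul (by positivity),
        ← ENNReal.ofReal_mul (by positivity)]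
      congr 1
      ring
    · rw [Set.indicator_of_notMem fun h => hr1 h.2]
      have h2 : ∀ t, Φ (r * bpt t) = 0 := fun t => by
        rw [hΦ, Set.indicator_of_notMem]
        rw [disc, mem_ball_zero_iff, norm_real_mul_bpt hr0.le]
        exact hr1
      simp [h2]
  calc _ = ∫⁻ z, Φ z := (lintegral_indicator hms _).symm
    _ = ∫⁻ p in polarCoord.target, ENNReal.ofReal p.1 * Φ (p.1 * bpt p.2) := by
      rw [← Complex.lintegral_comp_polarCoord_symm]
      simp only [hsymm, smul_eq_mul]
    _ = ∫⁻ r in Set.Ioi (0 : ℝ), ∫⁻ t in Set.Ioo (-Real.pi) Real.pi,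
        ENNReal.ofReal r * Φ (r * bpt t) := by
      rw [polarCoord_target, Measure.volume_eq_prod, setLIntegral_prod _ hpm.aemeasurable]
    _ = ∫⁻ r in Set.Ioi (0 : ℝ), (Set.Ioo (0 : ℝ) 1).indicator (fun r =>
        ∑' k, ENNReal.ofReal (2 * Real.pi * ‖c k‖ ^ 2) *
          ENNReal.ofReal (r * (1 - r ^ 2) * r ^ (2 * k))) r :=
      setLIntegral_congr_fun measurableSet_Ioi hin
    _ = ∫⁻ r in Set.Ioo (0 : ℝ) 1, ∑' k, ENNReal.ofReal (2 * Real.pi * ‖c k‖ ^ 2) *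
          ENNReal.ofReal (r * (1 - r ^ 2) * r ^ (2 * k)) := by
      rw [lintegral_indicator measurableSet_Ioo, Measure.restrict_restrict measurableSet_Ioo,
        Set.inter_eq_left.2 fun r hr => hr.1]
    _ = _ := by
      rw [lintegral_tsum fun k => by fun_prop, ← ENNReal.tsum_mul_left]
      refine tsum_congr fun k => ?_
      rw [lintegral_const_mul' _ _ ENNReal.ofReal_ne_top, lintegral_radial,
        ← ENNReal.ofReal_mul (by positivity), ← ENNReal.ofReal_mul (by positivity)]
      congr 1
      field_simp

lemma HasCoef.deriv (h : HasCoef f a) : HasCoef (deriv f) fun n => (n + 1) * a (n + 1) := by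
  have h1 := hasCoef_taylor h.differentiableOn
  have h2 := hasCoef_taylor (h.differentiableOn.deriv isOpen_ball)
  rw [h.unique h1]
  convert h2 using 2 with n
  beta_reduce
  rw [iteratedDeriv_succ', Nat.factorial_succ]
  have : (n : ℂ) + 1 ≠ 0 := by exact_mod_cast n.succ_ne_zero
  push_cast
  field_simp

lemma HasCoef.mul_shift (h : HasCoef f a) : HasCoef (fun z => z * f z) (shiftSeq a) := by
  intro z hz
  rw [← hasSum_nat_add_iff' 1]
  have e := (h z hz).mul_left z
  rw [show (fun n => z * (a n * z ^ n)) = fun n => shiftSeq a (n + 1) * z ^ (n + 1) from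
    funext fun n => by simp only [shiftSeq]; ring] at e
  simpa using e

lemma HasCoef.deriv_div (h : HasCoef f a) {ζ : ℂ} (hζ : ‖ζ‖ = 1) :
    HasCoef (fun z => _root_.deriv f z / (1 - conj ζ * z)) fun k =>
      conj ζ ^ (k + 1) * hsum ζ a (k + 1) := by
  have hz : conj ζ * ζ = 1 := by
    rw [← Complex.normSq_eq_conj_mul_self, Complex.normSq_eq_norm_sq, hζ]; simp
  have hne : ∀ z ∈ disc, 1 - conj ζ * z ≠ 0 := fun z hz h0 => by
    rw [disc, mem_ball_zero_iff] at hz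
    have : ‖conj ζ * z‖ < 1 := by rwa [norm_mul, RCLike.norm_conj, hζ, one_mul]
    rw [← sub_eq_zero.1 h0, norm_one] at this
    exact lt_irrefl _ this
  obtain ⟨c, hc⟩ := exists_hasCoef
    ((h.differentiableOn.deriv isOpen_ball).div (by fun_prop : DifferentiableOn ℂ
      (fun z => 1 - conj ζ * z) disc) hne)
  have h1 : HasCoef (_root_.deriv f) fun k => c k - conj ζ * shiftSeq c k := fun z hz => by
    have e := (hc z hz).sub ((hc.mul_shift z hz).mul_left (conj ζ))
    have h0 := hne z (by rwa [disc, mem_ball_zero_iff])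
    rw [show (fun k => c k * z ^ k - conj ζ * (shiftSeq c k * z ^ k)) =
      fun k => (c k - conj ζ * shiftSeq c k) * z ^ k from funext fun k => by ring] at e
    have e1 : _root_.deriv f z = _root_.deriv f z / (1 - conj ζ * z) -
        conj ζ * (z * (_root_.deriv f z / (1 - conj ζ * z))) := by field_simp
    rw [e1]
    exact e
  have h2 := congrFun (h.deriv.unique h1)
  have h3 : c = fun k => conj ζ ^ (k + 1) * hsum ζ a (k + 1) := by
    funext k
    induction k with
    | zero =>
      have := h2 0
      simp only [shiftSeq_zero, hsum, Finset.sum_range_succ] at this ⊢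
      simp at this ⊢
      linear_combination -this - a 1 * hz
    | succ k ih =>
      have h4 := h2 (k + 1)
      have h5 : hsum ζ a (k + 1 + 1) = hsum ζ a (k + 1) +
          ((k : ℂ) + 2) * a (k + 2) * ζ ^ (k + 2) := by
        simp only [hsum]
        rw [Finset.sum_range_succ _ (k + 2)]
        push_cast
        ring
      have h6 : conj ζ ^ (k + 2) * ζ ^ (k + 2) = 1 := by rw [← mul_pow, hz, one_pow]
      simp only [shiftSeq, ih] at h4
      push_cast at h4
      rw [h5]
      linear_combination -h4 - ((k : ℂ) + 2) * a (k + 2) * h6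
  rw [← h3]
  exact hc

/-- The local Dirichlet integral as an area integral. -/
lemma HasCoef.lintegral_local (h : HasCoef f a) {ζ : ℂ} (hζ : ‖ζ‖ = 1) :
    ∫⁻ z in disc, ENNReal.ofReal (‖_root_.deriv f z‖ ^ 2 *
      ((1 - ‖z‖ ^ 2) / ‖1 - conj ζ * z‖ ^ 2)) = ENNReal.ofReal Real.pi * dz ζ a := by
  have h1 := (h.deriv_div hζ).lintegral_disc
  simp only [norm_mul, norm_pow, RCLike.norm_conj, hζ, one_pow, one_mul] at h1
  rw [dz, ← h1]
  congr 1
  funext z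
  rw [norm_div]
  congr 1
  ring

end AreaIntegral

section DirichletIntegral

variable (μ : Measure ℂ) [IsFiniteMeasure μ] [Fact (OnCircle μ)] {f : ℂ → ℂ}

lemma poisson_nonneg {z ζ : ℂ} (hz : z ∈ disc) :
    0 ≤ (1 - ‖z‖ ^ 2) / ‖1 - conj ζ * z‖ ^ 2 := by
  rw [disc, mem_ball_zero_iff] at hz
  have : 0 ≤ 1 - ‖z‖ ^ 2 := by nlinarith [norm_nonneg z]
  positivity

lemma measurable_poisson :
    Measurable (Function.uncurry fun z ζ : ℂ => (1 - ‖z‖ ^ 2) / ‖1 - conj ζ * z‖ ^ 2) := by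
  unfold Function.uncurry
  have : Measurable fun p : ℂ × ℂ => conj p.2 := Complex.continuous_conj.measurable.comp
    measurable_snd
  fun_prop

lemma integrable_poisson {z : ℂ} (hz : z ∈ disc) :
    Integrable (fun ζ : ℂ => (1 - ‖z‖ ^ 2) / ‖1 - conj ζ * z‖ ^ 2) μ := by
  have hz1 := hz
  rw [disc, mem_ball_zero_iff] at hz1
  have h0 : 0 ≤ 1 - ‖z‖ ^ 2 := by nlinarith [norm_nonneg z]
  refine Integrable.of_bound (measurable_poisson.comp
    measurable_prodMk_left).aestronglyMeasurable ((1 - ‖z‖ ^ 2) / (1 - ‖z‖) ^ 2) ?_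
  filter_upwards [ae_norm_eq_one μ] with ζ hζ
  rw [Real.norm_of_nonneg (poisson_nonneg hz)]
  have h1 : 1 - ‖z‖ ≤ ‖1 - conj ζ * z‖ := by
    have := norm_sub_norm_le 1 (conj ζ * z)
    rwa [norm_mul, RCLike.norm_conj, hζ, one_mul, norm_one] at this
  have h2 : 0 < 1 - ‖z‖ := by linarith
  gcongr

omit [IsFiniteMeasure μ] [Fact (OnCircle μ)] in
lemma dirichletDensity_nonneg {z : ℂ} (hz : z ∈ disc) : 0 ≤ dirichletDensity μ f z :=
  mul_nonneg (sq_nonneg _) (integral_nonneg fun _ => poisson_nonneg hz)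

omit [Fact (OnCircle μ)] in
lemma measurable_dirichletDensity : Measurable (dirichletDensity μ f) := by
  have h1 : Measurable (poissonMu μ) :=
    (measurable_poisson.stronglyMeasurable.integral_prod_right (ν := μ)).measurable
  have h2 := measurable_deriv f
  unfold dirichletDensity
  fun_prop

lemma HasCoef.lintegral_dirichletDensity {a : ℕ → ℂ} (h : HasCoef f a) :
    ∫⁻ z in disc, ENNReal.ofReal (dirichletDensity μ f z) = ENNReal.ofReal Real.pi * Dir μ a := by
  have hms : MeasurableSet disc := measurableSet_ball
  calc _ = ∫⁻ z in disc, ∫⁻ ζ, ENNReal.ofReal (‖_root_.deriv f z‖ ^ 2 *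
        ((1 - ‖z‖ ^ 2) / ‖1 - conj ζ * z‖ ^ 2)) ∂μ := by
        refine setLIntegral_congr_fun hms fun z hz => ?_
        rw [dirichletDensity, poissonMu, ← integral_const_mul, ofReal_integral_eq_lintegral_ofReal
          ((integrable_poisson μ hz).const_mul _)
          (Eventually.of_forall fun ζ => mul_nonneg (sq_nonneg _) (poisson_nonneg hz))]
    _ = ∫⁻ ζ, ∫⁻ z in disc, ENNReal.ofReal (‖_root_.deriv f z‖ ^ 2 *
        ((1 - ‖z‖ ^ 2) / ‖1 - conj ζ * z‖ ^ 2)) ∂volume ∂μ := by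
        refine lintegral_lintegral_swap (Measurable.aemeasurable ?_)
        have h1 : Measurable fun p : ℂ × ℂ => _root_.deriv f p.1 :=
          (measurable_deriv f).comp measurable_fst
        exact ((h1.norm.pow_const 2).mul measurable_poisson).ennreal_ofReal
    _ = ∫⁻ ζ, ENNReal.ofReal Real.pi * dz ζ a ∂μ := by
        refine lintegral_congr_ae ?_
        filter_upwards [ae_norm_eq_one μ] with ζ hζ
        exact h.lintegral_local hζ
    _ = _ := lintegral_const_mul _ (measurable_dz a)

lemma HasCoef.integrableOn_iff {a : ℕ → ℂ} (h : HasCoef f a) :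
    IntegrableOn (dirichletDensity μ f) disc ↔ Dir μ a ≠ ∞ := by
  have hnn : 0 ≤ᵐ[volume.restrict disc] dirichletDensity μ f := by
    filter_upwards [ae_restrict_mem (show MeasurableSet disc from measurableSet_ball)] with z hz
    exact dirichletDensity_nonneg μ hz
  have hm : AEStronglyMeasurable (dirichletDensity μ f) (volume.restrict disc) :=
    (measurable_dirichletDensity μ).aestronglyMeasurable
  rw [IntegrableOn, Integrable, hasFiniteIntegral_iff_ofReal hnn, h.lintegral_dirichletDensity μ,
    and_iff_right hm]
  have hpi : ENNReal.ofReal Real.pi ≠ 0 := by simp [Real.pi_pos]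
  constructor
  · intro h1 h2
    rw [h2, ENNReal.mul_top hpi] at h1
    exact lt_irrefl _ h1
  · exact fun h1 => ENNReal.mul_lt_top ENNReal.ofReal_lt_top h1.lt_top

lemma HasCoef.dirichletIntegral_eq {a : ℕ → ℂ} (h : HasCoef f a) :
    dirichletIntegral μ f = (Dir μ a).toReal := by
  have hnn : 0 ≤ᵐ[volume.restrict disc] dirichletDensity μ f := by
    filter_upwards [ae_restrict_mem (show MeasurableSet disc from measurableSet_ball)] with z hz
    exact dirichletDensity_nonneg μ hz
  have hm : AEStronglyMeasurable (dirichletDensity μ f) (volume.restrict disc) :=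
    (measurable_dirichletDensity μ).aestronglyMeasurable
  rw [dirichletIntegral, integral_eq_lintegral_of_nonneg_ae hnn hm, h.lintegral_dirichletDensity μ,
    ENNReal.toReal_mul, ENNReal.toReal_ofReal Real.pi_pos.le]
  field_simp

end DirichletIntegral

section FunctionSpace

variable (μ : Measure ℂ) [IsFiniteMeasure μ] [Fact (OnCircle μ)]

/-- The holomorphic function `f` is represented on the disc by the vector `x`. -/
def Represents (f : ℂ → ℂ) (x : DH μ) : Prop := ∀ z : Dsc, f z = ⟪kv μ z, x⟫_ℂ

variable {μ} {f g : ℂ → ℂ} {x y : DH μ}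

lemma Represents.hasCoef (h : Represents μ f x) : HasCoef f (coef μ x) :=
  hasCoef_inner (coef μ x) fun z => by rw [h z, inner_kv]

lemma HasCoef.represents (h : HasCoef f (coef μ x)) : Represents μ f x := fun z => by
  rw [h.eq_inner, inner_kv]

lemma Represents.add (hf : Represents μ f x) (hg : Represents μ g y) :
    Represents μ (fun z => f z + g z) (x + y) := fun z => by
  simp only [inner_add_right, hf z, hg z]

lemma Represents.sub (hf : Represents μ f x) (hg : Represents μ g y) :
    Represents μ (fun z => f z - g z) (x - y) := fun z => by
  simp only [inner_sub_right, hf z, hg z]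

lemma Represents.const_mul (c : ℂ) (hf : Represents μ f x) :
    Represents μ (fun z => c * f z) (c • x) := fun z => by
  simp only [inner_smul_right, hf z]

lemma Represents.shift (hf : Represents μ f x) :
    Represents μ (fun z => z * f z) (TH μ x) := fun z => by
  simp only [inner_kv_TH, hf z]

lemma memD_iff_exists_represents : MemD μ f ↔ ∃ x : DH μ, Represents μ f x := by
  constructor
  · rintro ⟨h1, h2⟩
    obtain ⟨a, ha⟩ := h1.exists_coef
    obtain ⟨x, rfl⟩ := DH.exists_of_Dir μ ((ha.integrableOn_iff μ).1 h2)
    exact ⟨x, ha.represents⟩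
  · rintro ⟨x, hx⟩
    exact ⟨hx.hasCoef.memHardy2, (hx.hasCoef.integrableOn_iff μ).2 (Dir_coef_ne_top μ x)⟩

lemma Represents.dNormSq_eq (h : Represents μ f x) : dNormSq μ f = ‖x‖ ^ 2 := by
  rw [dNormSq, h.hasCoef.hardyNormSq, h.hasCoef.dirichletIntegral_eq μ, DH.normSq]

lemma Represents.mem_of_mem {M : Set (ℂ → ℂ)} (hM : ClosedInvSubspace μ M)
    (hf : Represents μ f x) (hg : Represents μ g x) (hfM : f ∈ M) : g ∈ M := by
  refine hM.closed g (memD_iff_exists_represents.2 ⟨x, hg⟩) fun ε hε => ⟨f, hfM, ?_⟩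
  rw [(hg.sub hf).dNormSq_eq, sub_self, norm_zero]
  simpa using hε

/-- The vectors representing the functions of an invariant subspace. -/
def ClosedInvSubspace.toSubmodule {M : Set (ℂ → ℂ)} (hM : ClosedInvSubspace μ M) :
    Submodule ℂ (DH μ) where
  carrier := {x | ∃ f ∈ M, Represents μ f x}
  zero_mem' := ⟨_, hM.zero_mem, fun z => (inner_zero_right _).symm⟩
  add_mem' := by
    rintro _ _ ⟨f, hf, hfx⟩ ⟨g, hg, hgy⟩
    exact ⟨_, hM.add_mem f hf g hg, hfx.add hgy⟩
  smul_mem' := by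
    rintro c _ ⟨f, hf, hfx⟩
    exact ⟨_, hM.smul_mem c f hf, hfx.const_mul c⟩

lemma ClosedInvSubspace.mem_toSubmodule {M : Set (ℂ → ℂ)} (hM : ClosedInvSubspace μ M)
    (hf : Represents μ f x) : x ∈ hM.toSubmodule ↔ f ∈ M :=
  ⟨fun ⟨_, hg, hgx⟩ => hgx.mem_of_mem hM hf hg, fun h => ⟨f, h, hf⟩⟩

lemma ClosedInvSubspace.TH_mem {M : Set (ℂ → ℂ)} (hM : ClosedInvSubspace μ M) :
    ∀ x ∈ hM.toSubmodule, TH μ x ∈ hM.toSubmodule := by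
  rintro x ⟨f, hf, hfx⟩
  exact ⟨_, hM.shift_mem f hf, hfx.shift⟩

lemma exists_represents (x : DH μ) : ∃ f, Represents μ f x := by
  classical
  refine ⟨fun z => if hz : ‖z‖ < 1 then ⟪kv μ ⟨z, hz⟩, x⟫_ℂ else 0, fun z => ?_⟩
  have : ‖(z : ℂ)‖ < 1 := z.2
  simp only [this, dif_pos, Subtype.coe_eta]

lemma ClosedInvSubspace.isClosed_toSubmodule {M : Set (ℂ → ℂ)} (hM : ClosedInvSubspace μ M) :
    IsClosed (hM.toSubmodule : Set (DH μ)) := by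
  refine isClosed_of_closure_subset fun x hx => ?_
  obtain ⟨f, hf⟩ := exists_represents x
  refine (hM.mem_toSubmodule hf).2 (hM.closed f (memD_iff_exists_represents.2 ⟨x, hf⟩)
    fun ε hε => ?_)
  obtain ⟨y, ⟨g, hg, hgy⟩, hxy⟩ := Metric.mem_closure_iff.1 hx (√ε) (Real.sqrt_pos.2 hε)
  refine ⟨g, hg, ?_⟩
  rw [(hf.sub hgy).dNormSq_eq, ← dist_eq_norm]
  exact (Real.lt_sqrt dist_nonneg).1 hxy

lemma Represents.iterate (hf : Represents μ f x) (n : ℕ) :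
    Represents μ (fun z => z ^ n * f z) ((TH μ)^[n] x) := fun z => by
  simp only [inner_kv_TH_iterate, hf z]

lemma Represents.exists_mem_span (hf : Represents μ f x) (q : Polynomial ℂ) :
    ∃ y ∈ Submodule.span ℂ (Set.range fun i => (TH μ)^[i] x),
      Represents μ (fun z => q.eval z * f z) y := by
  induction q using Polynomial.induction_on' with
  | add p q hp hq =>
    obtain ⟨y, hy, hyp⟩ := hp
    obtain ⟨w, hw, hwq⟩ := hq
    exact ⟨y + w, add_mem hy hw, by simpa only [Polynomial.eval_add, add_mul] using hyp.add hwq⟩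
  | monomial n c =>
    refine ⟨c • (TH μ)^[n] x, Submodule.smul_mem _ _ (Submodule.subset_span ⟨n, rfl⟩), ?_⟩
    simpa only [Polynomial.eval_monomial, mul_assoc] using (hf.iterate n).const_mul c

lemma Represents.exists_polynomial (hf : Represents μ f x)
    (hy : y ∈ Submodule.span ℂ (Set.range fun i => (TH μ)^[i] x)) :
    ∃ q : Polynomial ℂ, Represents μ (fun z => q.eval z * f z) y := by
  induction hy using Submodule.span_induction with
  | mem y hy =>
    obtain ⟨n, rfl⟩ := hy
    exact ⟨Polynomial.X ^ n, by simpa using hf.iterate n⟩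
  | zero => exact ⟨0, fun z => by simp⟩
  | add y w _ _ hy hw =>
    obtain ⟨p, hp⟩ := hy
    obtain ⟨q, hq⟩ := hw
    exact ⟨p + q, by simpa only [Polynomial.eval_add, add_mul] using hp.add hq⟩
  | smul c y _ hy =>
    obtain ⟨p, hp⟩ := hy
    exact ⟨Polynomial.C c * p, by
      simpa only [Polynomial.eval_mul, Polynomial.eval_C, mul_assoc] using hp.const_mul c⟩

lemma Represents.mem_closedSpan_iff (hf : Represents μ f x) (hg : Represents μ g y) :
    g ∈ closedSpan μ f ↔
      y ∈ (Submodule.span ℂ (Set.range fun i => (TH μ)^[i] x)).topologicalClosure := by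
  rw [← SetLike.mem_coe, Submodule.topologicalClosure_coe, Metric.mem_closure_iff]
  constructor
  · rintro ⟨-, h⟩ ε hε
    obtain ⟨q, hq⟩ := h (ε ^ 2) (by positivity)
    obtain ⟨w, hw, hwq⟩ := hf.exists_mem_span q
    refine ⟨w, hw, ?_⟩
    rw [(hg.sub hwq).dNormSq_eq, ← dist_eq_norm] at hq
    exact lt_of_pow_lt_pow_left₀ 2 hε.le hq
  · refine fun h => ⟨memD_iff_exists_represents.2 ⟨y, hg⟩, fun ε hε => ?_⟩
    obtain ⟨w, hw, hyw⟩ := h (√ε) (Real.sqrt_pos.2 hε)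
    obtain ⟨q, hq⟩ := hf.exists_polynomial hw
    refine ⟨q, ?_⟩
    rw [(hg.sub hq).dNormSq_eq, ← dist_eq_norm]
    exact (Real.lt_sqrt dist_nonneg).1 hyw

end FunctionSpace

/-- Every closed shift-invariant subspace of `D(μ)` is generated by a multiplier. -/
theorem exists_multiplier_generator
    (μ : Measure ℂ) [IsFiniteMeasure μ] (hμ : OnCircle μ)
    (M : Set (ℂ → ℂ)) (hM : ClosedInvSubspace μ M) :
    ∃ φ : ℂ → ℂ, IsMultiplier μ φ ∧ M = closedSpan μ φ := by
  have := Fact.mk hμ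
  obtain ⟨b, B, hB, hMB⟩ := exists_isMul_generator hM.isClosed_toSubmodule hM.TH_mem
  obtain ⟨φ, hφ, hφb⟩ := hB.exists_symbol
  refine ⟨φ, ⟨hφ.differentiableOn, fun g hg => ?_⟩, Set.ext fun g => ?_⟩
  · obtain ⟨x, hx⟩ := memD_iff_exists_represents.1 hg
    exact memD_iff_exists_represents.2 ⟨B x, fun z => by simp only [hB _ z, hφb, hx z]⟩
  · have hmem : ∀ x, Represents μ g x → (g ∈ M ↔ g ∈ closedSpan μ φ) := fun x hx => by
      rw [hφ.represents.mem_closedSpan_iff hx, ← hMB, hM.mem_toSubmodule hx]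
    constructor
    · intro hg
      obtain ⟨x, hx⟩ := memD_iff_exists_represents.1 (hM.subset hg)
      exact (hmem x hx).1 hg
    · intro hg
      obtain ⟨x, hx⟩ := memD_iff_exists_represents.1 hg.1
      exact (hmem x hx).2 hg

end DirichletMu
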